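/- If ℵ₁^{L[a]} < ℵ₁ for a real a, then there are no infinite Σ¹₂(a) maximal almost disjoint families: for every almost disjoint family 𝒜 ⊆ 𝒫(ω) defined by a Σ¹₂ formula with parameter a, there is an infinite x ⊆ ω with x ∩ y finite for all y ∈ 𝒜. -/

import Mathlib

/-- Almost disjoint family of subsets of `ω`. -/
def AlmostDisjointFam (𝒜 : Set (Set ℕ)) : Prop :=
  ∀ x ∈ 𝒜, ∀ y ∈ 𝒜, x = y ∨ (x ∩ y).Finite

/-- `S ⊆ 2^ω` is (lightface) `Π¹₁(a)`, via the classical normal form: membership is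
`∀ z ∈ ω^ω ∃ n R(x ↾ n, z ↾ n, a ↾ n)` for a computable predicate `R` on finite
sequences. -/
def Pi11In (a : ℕ → ℕ) (S : Set (ℕ → Bool)) : Prop :=
  ∃ R : List Bool × List ℕ × List ℕ → Bool, Computable R ∧
    S = {x | ∀ z : ℕ → ℕ, ∃ n : ℕ,
      R (List.ofFn fun i : Fin n => x i, List.ofFn fun i : Fin n => z i,
         List.ofFn fun i : Fin n => a i) = true}

/-- A family `𝒜` of subsets of `ω` is (lightface) `Σ¹₂(a)`, via the classical normal
form `∃ y ∈ ω^ω ∀ z ∈ ω^ω ∃ n R(x ↾ n, y ↾ n, z ↾ n, a ↾ n)` with `R` computable. -/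
def Sigma12In (a : ℕ → ℕ) (𝒜 : Set (Set ℕ)) : Prop :=
  ∃ R : List Bool × List ℕ × List ℕ × List ℕ → Bool, Computable R ∧
    𝒜 = {A | ∃ x : ℕ → Bool, {n | x n = true} = A ∧
      ∃ y : ℕ → ℕ, ∀ z : ℕ → ℕ, ∃ n : ℕ,
        R (List.ofFn fun i : Fin n => x i, List.ofFn fun i : Fin n => y i,
           List.ofFn fun i : Fin n => z i, List.ofFn fun i : Fin n => a i) = true}

/-- The classical Solovay–Mansfield equivalent of `ℵ₁^{L[a]} < ℵ₁`: every `Π¹₁(a)`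
subset of Cantor space is countable or contains a nonempty perfect set. -/
def Aleph1OfLaCountable (a : ℕ → ℕ) : Prop :=
  ∀ S : Set (ℕ → Bool), Pi11In a S →
    S.Countable ∨ ∃ C ⊆ S, Perfect C ∧ C.Nonempty

open Encodable

/-- The list of the first `n` values of `x`. -/
def pre {β : Type*} (x : ℕ → β) (n : ℕ) : List β := (List.range n).map x

theorem ofFn_eq_pre {β : Type*} (x : ℕ → β) (n : ℕ) :
    (List.ofFn fun i : Fin n => x i) = pre x n := by
  apply List.ext_getElem <;> simp [pre]

theorem pre_getD {β : Type*} (x : ℕ → β) (d : β) {n i : ℕ} (h : i < n) :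
    (pre x n).getD i d = x i := by
  simp [pre, h]

@[simp] theorem length_pre {β : Type*} (x : ℕ → β) (n : ℕ) : (pre x n).length = n := by
  simp [pre]

theorem pre_congr {β : Type*} {x y : ℕ → β} {n : ℕ} (h : ∀ i < n, x i = y i) :
    pre x n = pre y n := by
  apply List.map_congr_left
  simpa using h

/-- The order pattern of a list with respect to a relation `lt`. -/
def pat {β : Type*} (lt : β → β → Bool) (L : List β) : List ℕ :=
  L.map fun x => (L.filter fun y => lt y x).length

/-- Index-based lexicographic comparison of lists with respect to `lt`. -/
def lexB {β : Type*} (lt : β → β → Bool) (d : β) (b t : List β) : Bool :=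
  (List.range b.length).any fun i => lt (b.getD i d) (t.getD i d) &&
    (List.range i).all fun j => !lt (b.getD j d) (t.getD j d) && !lt (t.getD j d) (b.getD j d)

theorem length_pat {β : Type*} (lt : β → β → Bool) (L : List β) :
    (pat lt L).length = L.length := by simp [pat]

theorem pat_congr {β : Type*} {lt lt' : β → β → Bool} {L : List β}
    (h : ∀ x ∈ L, ∀ y ∈ L, lt x y = lt' x y) : pat lt L = pat lt' L := by
  unfold pat
  apply List.map_congr_left
  intro x hx
  congr 1
  apply List.filter_congr
  intro y hy
  exact h y hy x hx

theorem pat_map {β γ : Type*} (lt : γ → γ → Bool) (f : β → γ) (L : List β) :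
    pat lt (L.map f) = pat (fun x y => lt (f x) (f y)) L := by
  simp [pat, List.filter_map, Function.comp_def]

theorem lexB_congr {β : Type*} {lt lt' : β → β → Bool} {d : β} {b t : List β}
    (hlen : b.length = t.length)
    (h : ∀ x ∈ b ++ t, ∀ y ∈ b ++ t, lt x y = lt' x y) : lexB lt d b t = lexB lt' d b t := by
  unfold lexB
  rw [Bool.eq_iff_iff]
  simp only [List.any_eq_true, List.mem_range, List.all_eq_true, Bool.and_eq_true]
  have hb : ∀ i < b.length, b.getD i d ∈ b ++ t := fun i hi => by
    rw [List.getD_eq_getElem _ _ hi]; simp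
  have ht : ∀ i < b.length, t.getD i d ∈ b ++ t := fun i hi => by
    rw [List.getD_eq_getElem _ _ (hlen ▸ hi)]; simp
  refine exists_congr fun i => and_congr_right fun hi => and_congr ?_
    (forall_congr' fun j => forall_congr' fun hj => ?_)
  · rw [h _ (hb i hi) _ (ht i hi)]
  · rw [h _ (hb j (by omega)) _ (ht j (by omega)), h _ (ht j (by omega)) _ (hb j (by omega))]

theorem lexB_map {β γ : Type*} (lt : γ → γ → Bool) (f : β → γ) (d : β) (b t : List β) :
    lexB lt (f d) (b.map f) (t.map f) = lexB (fun x y => lt (f x) (f y)) d b t := by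
  have key : ∀ (l : List β) i, (l.map f).getD i (f d) = f (l.getD i d) := by
    intro l i; simp [List.getD_eq_getElem?_getD]
  simp only [lexB, key, List.length_map]

theorem lexB_default {β : Type*} (lt : β → β → Bool) (d d' : β) {b t : List β}
    (hlen : b.length = t.length) : lexB lt d b t = lexB lt d' b t := by
  have key : ∀ (l : List β) i, i < l.length → l.getD i d = l.getD i d' := by
    intro l i hi
    rw [List.getD_eq_getElem _ _ hi, List.getD_eq_getElem _ _ hi]
  unfold lexB
  rw [Bool.eq_iff_iff]
  simp only [List.any_eq_true, List.mem_range, List.all_eq_true, Bool.and_eq_true]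
  refine exists_congr fun i => and_congr_right fun hi => and_congr ?_
    (forall_congr' fun j => forall_congr' fun hj => ?_)
  · rw [key b i hi, key t i (by omega)]
  · rw [key b j (by omega), key t j (by omega)]

/-- Strict comparison of ordinals as a Boolean. -/
noncomputable def oLt (x y : Ordinal.{0}) : Bool := decide (x < y)

@[simp] theorem oLt_iff {x y : Ordinal.{0}} : oLt x y = true ↔ x < y := by simp [oLt]

theorem eq_of_not_lexB {b t : List Ordinal.{0}} (hlen : b.length = t.length)
    (h1 : lexB oLt 0 b t = false) (h2 : lexB oLt 0 t b = false) : b = t := by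
  by_contra hne
  have : ∃ i, i < b.length ∧ b.getD i 0 ≠ t.getD i 0 := by
    by_contra! hall
    apply hne
    apply List.ext_getElem hlen
    intro i hi hi'
    have := hall i hi
    rwa [List.getD_eq_getElem _ _ hi, List.getD_eq_getElem _ _ hi'] at this
  classical
  have hs := Nat.find_spec this
  have hm : ∀ j < Nat.find this, b.getD j 0 = t.getD j 0 := by
    intro j hj
    have := Nat.find_min this hj
    by_contra hc
    exact this ⟨by omega, hc⟩
  rw [← Bool.not_eq_true] at h1 h2
  simp only [lexB, List.any_eq_true, List.mem_range, List.all_eq_true, Bool.and_eq_true,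
    oLt_iff, not_exists, not_and] at h1 h2
  rcases lt_or_gt_of_ne hs.2 with hlt | hlt
  · refine h1 _ hs.1 hlt ?_
    intro j hj
    rw [hm j hj]; simp [oLt]
  · refine h2 _ (hlen ▸ hs.1) hlt ?_
    intro j hj
    rw [hm j hj]; simp [oLt]

theorem exists_lexB_min : ∀ (n : ℕ) (W : Set (List Ordinal.{0})), W.Nonempty →
    (∀ b ∈ W, b.length = n) → ∃ t ∈ W, ∀ b ∈ W, lexB oLt 0 b t = false
  | 0, W, ⟨t, ht⟩, hl => ⟨t, ht, fun b hb => by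
      have := hl b hb
      simp [lexB, this]⟩
  | n + 1, W, hne, hl => by
    obtain ⟨t0, ht0, hmin⟩ := (InvImage.wf (fun b : List Ordinal.{0} => b.headD 0)
      Ordinal.lt_wf).has_min W hne
    obtain ⟨t, ht, htm⟩ := exists_lexB_min n {b | t0.headD 0 :: b ∈ W} (by
      refine ⟨t0.tail, ?_⟩
      have := hl t0 ht0
      cases t0 with
      | nil => simp at this
      | cons x l => simpa using ht0) (by
        intro b hb
        simpa using hl _ hb)
    refine ⟨t0.headD 0 :: t, ht, ?_⟩
    intro b hb
    have hlb := hl b hb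
    have hmb := hmin b hb
    cases b with
    | nil => simp at hlb
    | cons x b =>
      simp only [InvImage, List.headD_cons, not_lt] at hmb
      rw [← Bool.not_eq_true]
      simp only [lexB, List.any_eq_true, List.mem_range, List.all_eq_true, Bool.and_eq_true,
        oLt_iff]
      rintro ⟨i, hi, h1, h2⟩
      cases i with
      | zero =>
        simp at h1
        exact absurd h1 (not_lt.2 (by simpa using hmb))
      | succ i =>
        have h0 := h2 0 (by omega)
        simp [oLt] at h0
        have hx : x = t0.headD 0 := le_antisymm (by simpa using h0.2) (by simpa using hmb)
        subst hx
        have := htm b hb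
        rw [← Bool.not_eq_true] at this
        apply this
        simp only [lexB, List.any_eq_true, List.mem_range, List.all_eq_true, Bool.and_eq_true,
          oLt_iff]
        refine ⟨i, by simpa using hi, by simpa using h1, fun j hj => ?_⟩
        simpa using h2 (j+1) (by omega)

/-- The binary relation on `ℕ` coded by `w`. -/
def wlt (w : ℕ → Bool) (m n : ℕ) : Bool := w (2 * Nat.pair m n)

/-- The predicate on positions coded by `w`. -/
def wX (w : ℕ → Bool) (c : ℕ) (l : List ℕ) : Bool := w (2 * encode (c, l) + 1)

/-- A name for the `i`-th ordinal of the least winning move from `(c, l)` to code `c'`. -/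
def nm (i c c' : ℕ) (l : List ℕ) : ℕ := 2 * encode (i, c, c', l) + 1

/-- The list of the first `n` names attached to `(c, c', l)`. -/
def nms (n c c' : ℕ) (l : List ℕ) : List ℕ := (List.range n).map fun i => nm i c c' l

section
variable (nu : ℕ → ℕ) (St : List ℕ × ℕ × ℕ × List ℕ → Bool) (a : ℕ → ℕ)

/-- The coded version of: `b` is a winning move from `(c, l)` to code `c'`. -/
def winb (w : ℕ → Bool) (c c' : ℕ) (l b : List ℕ) : Bool :=
  decide (b.length = nu c') && St (pre a (nu c'), c, c', pat (wlt w) (l ++ b)) &&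
    !wX w c' (l ++ b)

/-- The matrix of the arithmetical part of goodness. -/
def matB (k : ℕ) (w : ℕ → Bool) (v : ℕ × ℕ × List ℕ × List ℕ × ℕ × ℕ × ℕ) (e : ℕ) : Bool :=
  match v with
  | (c, c', l, b, x, y, z) =>
    (!wlt w x x && (!(wlt w x y && wlt w y z) || wlt w x z) &&
      (!wlt w x z || (wlt w x y || wlt w y z))) &&
    (!wX w c l || winb nu St a w c e l (nms (nu e) c e l)) &&
    (!winb nu St a w c c' l b || (wX w c l && winb nu St a w c c' l (nms (nu c') c c' l) &&
      !lexB (wlt w) 0 b (nms (nu c') c c' l))) &&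
    ((winb nu St a w c c' l (nms (nu c') c c' l) && decide (x < nu c')) ||
      !wlt w y (nm x c c' l)) &&
    (decide (x < k) || !wlt w y (2 * x))

/-- `w` codes a hull of ordinals with `k` parameters together with the winning positions. -/
structure Good (k : ℕ) (w : ℕ → Bool) : Prop where
  mat : ∀ v, ∃ e, matB nu St a k w v e = true
  wf : ∀ z : ℕ → ℕ, ∃ i, wlt w (z (i + 1)) (z i) = false

end

section primrec
variable {α : Type*} [Primcodable α]

theorem Primrec.bnot' {f : α → Bool} (hf : Primrec f) : Primrec fun p => !f p :=
  Primrec.not.comp hf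

theorem Primrec.band' {f g : α → Bool} (hf : Primrec f) (hg : Primrec g) :
    Primrec fun p => f p && g p := Primrec.and.comp hf hg

theorem Primrec.bor' {f g : α → Bool} (hf : Primrec f) (hg : Primrec g) :
    Primrec fun p => f p || g p := Primrec.or.comp hf hg

theorem Primrec.any' {β : Type*} [Primcodable β] {f : α → List β} {g : α → β → Bool}
    (hf : Primrec f) (hg : Primrec₂ g) : Primrec fun p => (f p).any (g p) := by
  have : PrimrecPred fun p : α => ∃ b ∈ f p, g p b = true := by
    have h : PrimrecRel fun (b : β) (p : α) => g p b = true :=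
      (Primrec.eq.comp (hg.comp Primrec.snd Primrec.fst) (Primrec.const true))
    have := h.exists_mem_list
    exact PrimrecPred.of_eq (this.comp hf Primrec.id) (fun p => by simp)
  exact this.decide.of_eq fun p => by
    rw [Bool.eq_iff_iff]; simp

theorem Primrec.all' {β : Type*} [Primcodable β] {f : α → List β} {g : α → β → Bool}
    (hf : Primrec f) (hg : Primrec₂ g) : Primrec fun p => (f p).all (g p) := by
  refine (Primrec.bnot' (Primrec.any' hf (g := fun p b => !g p b) (Primrec.bnot' hg))).of_eq ?_
  intro p
  rw [List.any_eq_not_all_not]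
  simp

theorem Primrec.filter' {β : Type*} [Primcodable β] {f : α → List β} {g : α → β → Bool}
    (hf : Primrec f) (hg : Primrec₂ g) : Primrec fun p => (f p).filter (g p) := by
  have h : Primrec₂ fun (p : α) (b : β) => if g p b = true then [b] else [] :=
    Primrec.ite (Primrec.eq.comp hg (Primrec.const true))
      (Primrec.list_cons.comp Primrec.snd (Primrec.const [])) (Primrec.const [])
  refine (Primrec.list_flatMap hf h).of_eq fun p => ?_
  induction f p with
  | nil => rfl
  | cons x l ih =>
    rw [List.flatMap_cons, ih, List.filter_cons]
    split_ifs <;> rfl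

theorem Primrec.getD' {β : Type*} [Primcodable β] {f : α → List β} {g : α → ℕ} (d : β)
    (hf : Primrec f) (hg : Primrec g) : Primrec fun p => (f p).getD (g p) d :=
  (Primrec.list_getD d).comp hf hg

theorem Primrec.ltB {f g : α → ℕ} (hf : Primrec f) (hg : Primrec g) :
    Primrec fun p => decide (f p < g p) := (Primrec.nat_lt.comp hf hg).decide

theorem Primrec.eqB {β : Type*} [Primcodable β] [DecidableEq β] {f g : α → β}
    (hf : Primrec f) (hg : Primrec g) :
    Primrec fun p => decide (f p = g p) := (Primrec.eq.comp hf hg).decide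

theorem Primrec.pre' {f : α → ℕ} {as : α → List ℕ} (has : Primrec as) (hf : Primrec f) :
    Primrec fun p => pre (fun i => (as p).getD i 0) (f p) :=
  Primrec.list_map (Primrec.list_range.comp hf)
    (Primrec.getD' 0 (has.comp Primrec.fst) Primrec.snd)

theorem Primrec.pat' {β : Type*} [Primcodable β] {lt : α → β → β → Bool} {f : α → List β}
    (hlt : Primrec fun p : α × β × β => lt p.1 p.2.1 p.2.2) (hf : Primrec f) :
    Primrec fun p => pat (lt p) (f p) := by
  refine Primrec.list_map hf ?_
  refine Primrec.list_length.comp ?_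
  exact Primrec.filter' (hf.comp Primrec.fst)
    (hlt.comp (Primrec.pair (Primrec.fst.comp Primrec.fst)
      (Primrec.pair Primrec.snd (Primrec.snd.comp Primrec.fst))))

theorem Primrec.lexB' {β : Type*} [Primcodable β] {lt : α → β → β → Bool} {f g : α → List β}
    (d : β) (hlt : Primrec fun p : α × β × β => lt p.1 p.2.1 p.2.2) (hf : Primrec f)
    (hg : Primrec g) : Primrec fun p => lexB (lt p) d (f p) (g p) := by
  refine Primrec.any' (Primrec.list_range.comp (Primrec.list_length.comp hf)) ?_
  have h1 : ∀ {f g : α → List β}, Primrec f → Primrec g →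
      Primrec fun q : α × ℕ => lt q.1 ((f q.1).getD q.2 d) ((g q.1).getD q.2 d) := by
    intro f g hf hg
    exact hlt.comp (Primrec.pair Primrec.fst
      (Primrec.pair (Primrec.getD' d (hf.comp Primrec.fst) Primrec.snd)
        (Primrec.getD' d (hg.comp Primrec.fst) Primrec.snd)))
  refine Primrec.band' (h1 hf hg) ?_
  refine Primrec.all' (Primrec.list_range.comp Primrec.snd) ?_
  have h2 : Primrec fun q : (α × ℕ) × ℕ => (q.1.1, q.2) :=
    Primrec.pair (Primrec.fst.comp Primrec.fst) Primrec.snd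
  exact Primrec.band' (Primrec.bnot' ((h1 hf hg).comp h2)) (Primrec.bnot' ((h1 hg hf).comp h2))

/-- The function extending a list by a default value. -/
def listExt {β : Type*} (d : β) (l : List β) (i : ℕ) : β := l.getD i d

theorem Primrec.two_mul' {f : α → ℕ} (hf : Primrec f) : Primrec fun p => 2 * f p :=
  Primrec.nat_mul.comp (Primrec.const 2) hf

theorem Primrec.wlt' {xs : α → List Bool} {f g : α → ℕ} (hx : Primrec xs) (hf : Primrec f)
    (hg : Primrec g) : Primrec fun p => wlt (listExt false (xs p)) (f p) (g p) :=
  Primrec.getD' false hx (Primrec.two_mul' (Primrec₂.natPair.comp hf hg))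

theorem Primrec.wX' {xs : α → List Bool} {f : α → ℕ} {g : α → List ℕ} (hx : Primrec xs)
    (hf : Primrec f) (hg : Primrec g) : Primrec fun p => wX (listExt false (xs p)) (f p) (g p) :=
  Primrec.getD' false hx (Primrec.succ.comp (Primrec.two_mul'
    (Primrec.encode.comp (Primrec.pair hf hg))))

theorem Primrec.nm' {i c c' : α → ℕ} {l : α → List ℕ} (hi : Primrec i) (hc : Primrec c)
    (hc' : Primrec c') (hl : Primrec l) : Primrec fun p => nm (i p) (c p) (c' p) (l p) :=
  Primrec.succ.comp (Primrec.two_mul'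
    (Primrec.encode.comp (Primrec.pair hi (Primrec.pair hc (Primrec.pair hc' hl)))))

theorem Primrec.nms' {i c c' : α → ℕ} {l : α → List ℕ} (hi : Primrec i) (hc : Primrec c)
    (hc' : Primrec c') (hl : Primrec l) : Primrec fun p => nms (i p) (c p) (c' p) (l p) :=
  Primrec.list_map (Primrec.list_range.comp hi)
    (Primrec.nm' Primrec.snd (hc.comp Primrec.fst) (hc'.comp Primrec.fst) (hl.comp Primrec.fst))

variable {nu : ℕ → ℕ} {St : List ℕ × ℕ × ℕ × List ℕ → Bool}

theorem Primrec.winb' (hnu : Primrec nu) (hSt : Primrec St) {xs : α → List Bool}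
    {as : α → List ℕ} {c c' : α → ℕ}
    {l b : α → List ℕ} (hx : Primrec xs) (has : Primrec as) (hc : Primrec c) (hc' : Primrec c')
    (hl : Primrec l) (hb : Primrec b) :
    Primrec fun p => winb nu St (listExt 0 (as p)) (listExt false (xs p)) (c p) (c' p) (l p) (b p) := by
  have hlb := Primrec.list_append.comp hl hb
  refine Primrec.band' (Primrec.band' (Primrec.eqB (Primrec.list_length.comp hb) (hnu.comp hc'))
    (hSt.comp (Primrec.pair (Primrec.pre' has (hnu.comp hc')) (Primrec.pair hc
      (Primrec.pair hc' (Primrec.pat' ?_ hlb)))))) (Primrec.bnot' (Primrec.wX' hx hc' hlb))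
  exact Primrec.wlt' (hx.comp Primrec.fst) (Primrec.fst.comp Primrec.snd)
    (Primrec.snd.comp Primrec.snd)

theorem Primrec.matB' (hnu : Primrec nu) (hSt : Primrec St) (k : ℕ) {xs : α → List Bool}
    {as : α → List ℕ} {v : α → ℕ × ℕ × List ℕ × List ℕ × ℕ × ℕ × ℕ} {e : α → ℕ}
    (hx : Primrec xs) (has : Primrec as) (hv : Primrec v) (he : Primrec e) :
    Primrec fun p => matB nu St (listExt 0 (as p)) k (listExt false (xs p)) (v p) (e p) := by
  have hc := Primrec.fst.comp hv
  have hv := Primrec.snd.comp hv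
  have hc' := Primrec.fst.comp hv
  have hv := Primrec.snd.comp hv
  have hl := Primrec.fst.comp hv
  have hv := Primrec.snd.comp hv
  have hb := Primrec.fst.comp hv
  have hv := Primrec.snd.comp hv
  have h1 := Primrec.fst.comp hv
  have hv := Primrec.snd.comp hv
  have h2 := Primrec.fst.comp hv
  have h3 := Primrec.snd.comp hv
  have hnc' := Primrec.nms' (hnu.comp hc') hc hc' hl
  have hne := Primrec.nms' (hnu.comp he) hc he hl
  have hw := Primrec.winb' hnu hSt hx has hc hc' hl hnc'
  refine Primrec.band' (Primrec.band' (Primrec.band' (Primrec.band'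
    (Primrec.band' (Primrec.band' (Primrec.bnot' (Primrec.wlt' hx h1 h1))
    (Primrec.bor' (Primrec.bnot' (Primrec.band' (Primrec.wlt' hx h1 h2) (Primrec.wlt' hx h2 h3)))
      (Primrec.wlt' hx h1 h3)))
    (Primrec.bor' (Primrec.bnot' (Primrec.wlt' hx h1 h3))
      (Primrec.bor' (Primrec.wlt' hx h1 h2) (Primrec.wlt' hx h2 h3))))
    (Primrec.bor' (Primrec.bnot' (Primrec.wX' hx hc hl)) (Primrec.winb' hnu hSt hx has hc he hl hne)))
    (Primrec.bor' (Primrec.bnot' (Primrec.winb' hnu hSt hx has hc hc' hl hb))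
      (Primrec.band' (Primrec.band' (Primrec.wX' hx hc hl) hw)
        (Primrec.bnot' (Primrec.lexB' 0 ?_ hb hnc')))))
    (Primrec.bor' (Primrec.band' hw (Primrec.ltB h1 (hnu.comp hc')))
      (Primrec.bnot' (Primrec.wlt' hx h2 (Primrec.nm' h1 hc hc' hl)))))
    (Primrec.bor' (Primrec.ltB h1 (Primrec.const k))
      (Primrec.bnot' (Primrec.wlt' hx h2 (Primrec.two_mul' h1))))
  exact Primrec.wlt' (hx.comp Primrec.fst) (Primrec.fst.comp Primrec.snd)
    (Primrec.snd.comp Primrec.snd)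

end primrec

section
variable {nu : ℕ → ℕ} {St : List ℕ × ℕ × ℕ × List ℕ → Bool}

theorem wlt_congr {w w' : ℕ → Bool} {N x y : ℕ} (h : ∀ i < N, w i = w' i)
    (hN : 2 * Nat.pair x y < N) : wlt w x y = wlt w' x y := h _ hN

theorem wX_congr {w w' : ℕ → Bool} {N c : ℕ} {l : List ℕ} (h : ∀ i < N, w i = w' i)
    (hN : 2 * encode (c, l) + 1 < N) : wX w c l = wX w' c l := h _ hN

theorem pair_le_pair {x y B C : ℕ} (hx : x ≤ B) (hy : y ≤ C) :
    Nat.pair x y ≤ Nat.pair B C := by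
  have h1 : Nat.pair x y ≤ Nat.pair B y :=
    hx.eq_or_lt.elim (fun h => h ▸ le_rfl) fun h => (Nat.pair_lt_pair_left _ h).le
  exact h1.trans (hy.eq_or_lt.elim (fun h => h ▸ le_rfl) fun h => (Nat.pair_lt_pair_right _ h).le)

/-- A bound for the part of the oracles used by `winb`. -/
def useW (nu : ℕ → ℕ) (c' : ℕ) (l b : List ℕ) : ℕ :=
  nu c' + (2 * encode (c', l ++ b) + 2) + (2 * Nat.pair (l ++ b).sum (l ++ b).sum + 1)

theorem wlt_congr_list {w w' : ℕ → Bool} {N : ℕ} (h : ∀ i < N, w i = w' i) {L : List ℕ}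
    (hN : 2 * Nat.pair L.sum L.sum < N) : ∀ x ∈ L, ∀ y ∈ L, wlt w x y = wlt w' x y := by
  intro x hx y hy
  refine wlt_congr h (lt_of_le_of_lt ?_ hN)
  have := pair_le_pair (List.le_sum_of_mem hx) (List.le_sum_of_mem hy)
  omega

theorem winb_congr {w w' : ℕ → Bool} {a a' : ℕ → ℕ} {N c c' : ℕ} {l b : List ℕ}
    (h : ∀ i < N, w i = w' i) (ha : ∀ i < N, a i = a' i) (hN : useW nu c' l b ≤ N) :
    winb nu St a w c c' l b = winb nu St a' w' c c' l b := by
  unfold useW at hN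
  unfold winb
  rw [pre_congr (y := a') (fun i hi => ha i (by omega)),
    pat_congr (wlt_congr_list h (by omega)), wX_congr h (by omega)]

/-- A bound for the part of the oracles used by `matB`. -/
def useM (nu : ℕ → ℕ) (v : ℕ × ℕ × List ℕ × List ℕ × ℕ × ℕ × ℕ) (e : ℕ) : ℕ :=
  match v with
  | (c, c', l, b, x, y, z) =>
    let B := x + y + z + nm x c c' l + 2 * x
    2 * Nat.pair B B + 1 + (2 * encode (c, l) + 2) + useW nu e l (nms (nu e) c e l) +
      useW nu c' l b + useW nu c' l (nms (nu c') c c' l) +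
      (2 * Nat.pair (b ++ nms (nu c') c c' l).sum (b ++ nms (nu c') c c' l).sum + 1)

theorem matB_congr {w w' : ℕ → Bool} {a a' : ℕ → ℕ} {N k : ℕ} {v} {e : ℕ}
    (h : ∀ i < N, w i = w' i) (ha : ∀ i < N, a i = a' i) (hN : useM nu v e ≤ N) :
    matB nu St a k w v e = matB nu St a' k w' v e := by
  obtain ⟨c, c', l, b, x, y, z⟩ := v
  simp only [useM] at hN
  have hp : ∀ s t, s ≤ x + y + z + nm x c c' l + 2 * x → t ≤ x + y + z + nm x c c' l + 2 * x →
      wlt w s t = wlt w' s t := by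
    intro s t hs ht
    apply wlt_congr h
    have := pair_le_pair hs ht
    omega
  simp only [matB]
  rw [hp x x (by omega) (by omega), hp x y (by omega) (by omega), hp y z (by omega) (by omega),
    hp x z (by omega) (by omega), hp y (nm x c c' l) (by omega) (by omega),
    hp y (2 * x) (by omega) (by omega), wX_congr h (by omega),
    winb_congr (c' := e) h ha (by omega), winb_congr (c' := c') (b := b) h ha (by omega),
    winb_congr (c' := c') (b := nms (nu c') c c' l) h ha (by omega)]
  by_cases hb : winb nu St a' w' c c' l b = true
  · have hl : b.length = (nms (nu c') c c' l).length := by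
      simp only [winb, Bool.and_eq_true, decide_eq_true_eq] at hb
      simp [nms, hb.1.1]
    rw [lexB_congr hl (wlt_congr_list h (by omega))]
  · simp [hb]

theorem Primrec.list_sum' {α : Type*} [Primcodable α] {f : α → List ℕ} (hf : Primrec f) :
    Primrec fun p => (f p).sum := by
  have := Primrec.list_foldr hf (Primrec.const (0:ℕ)) (h := fun _ q => q.1 + q.2)
    (Primrec.nat_add.comp (Primrec.fst.comp Primrec.snd) (Primrec.snd.comp Primrec.snd))
  exact this.of_eq fun p => by rw [List.sum_eq_foldr]

theorem Primrec.useW' {α : Type*} [Primcodable α] (hnu : Primrec nu) {c' : α → ℕ}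
    {l b : α → List ℕ} (hc' : Primrec c')
    (hl : Primrec l) (hb : Primrec b) : Primrec fun p => useW nu (c' p) (l p) (b p) := by
  have hlb := Primrec.list_append.comp hl hb
  have hs := Primrec.list_sum' hlb
  exact Primrec.nat_add.comp (Primrec.nat_add.comp (hnu.comp hc')
    (Primrec.succ.comp (Primrec.succ.comp (Primrec.two_mul'
      (Primrec.encode.comp (Primrec.pair hc' hlb))))))
    (Primrec.succ.comp (Primrec.two_mul' (Primrec₂.natPair.comp hs hs)))

theorem Primrec.useM' {α : Type*} [Primcodable α] (hnu : Primrec nu)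
    {v : α → ℕ × ℕ × List ℕ × List ℕ × ℕ × ℕ × ℕ} {e : α → ℕ}
    (hv : Primrec v) (he : Primrec e) : Primrec fun p => useM nu (v p) (e p) := by
  have hc := Primrec.fst.comp hv
  have hv := Primrec.snd.comp hv
  have hc' := Primrec.fst.comp hv
  have hv := Primrec.snd.comp hv
  have hl := Primrec.fst.comp hv
  have hv := Primrec.snd.comp hv
  have hb := Primrec.fst.comp hv
  have hv := Primrec.snd.comp hv
  have h1 := Primrec.fst.comp hv
  have hv := Primrec.snd.comp hv
  have h2 := Primrec.fst.comp hv
  have h3 := Primrec.snd.comp hv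
  have hnc' := Primrec.nms' (hnu.comp hc') hc hc' hl
  have hne := Primrec.nms' (hnu.comp he) hc he hl
  have hB := Primrec.nat_add.comp (Primrec.nat_add.comp (Primrec.nat_add.comp
    (Primrec.nat_add.comp h1 h2) h3) (Primrec.nm' h1 hc hc' hl)) (Primrec.two_mul' h1)
  have hs := Primrec.list_sum' (Primrec.list_append.comp hb hnc')
  have hX := Primrec.succ.comp (Primrec.succ.comp (Primrec.two_mul'
      (Primrec.encode.comp (Primrec.pair hc hl))))
  exact Primrec.nat_add.comp (Primrec.nat_add.comp (Primrec.nat_add.comp (Primrec.nat_add.comp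
    (Primrec.nat_add.comp (Primrec.succ.comp (Primrec.two_mul' (Primrec₂.natPair.comp hB hB))) hX)
    (Primrec.useW' hnu he hl hne)) (Primrec.useW' hnu hc' hl hb)) (Primrec.useW' hnu hc' hl hnc'))
    (Primrec.succ.comp (Primrec.two_mul' (Primrec₂.natPair.comp hs hs)))

/-- The computable matrix witnessing that goodness is `Π¹₁`. -/
def matR (nu : ℕ → ℕ) (St : List ℕ × ℕ × ℕ × List ℕ → Bool) (k : ℕ)
    (p : List Bool × List ℕ × List ℕ) : Bool :=
  ((List.range p.2.1.length).any fun e =>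
    decide ((p.2.1.getD 0 0) % 2 = 0) &&
    (decide (useM nu (Denumerable.ofNat _ (p.2.1.getD 0 0 / 2)) e < p.2.1.length) &&
      matB nu St (listExt 0 p.2.2) k (listExt false p.1)
        (Denumerable.ofNat _ (p.2.1.getD 0 0 / 2)) e)) ||
  ((List.range p.2.1.length).any fun i =>
    decide ((p.2.1.getD 0 0) % 2 = 1) && (decide (i + 2 < p.2.1.length) &&
    (decide (2 * Nat.pair (p.2.1.getD (i + 2) 0) (p.2.1.getD (i + 1) 0) < p.2.1.length) &&
    !wlt (listExt false p.1) (p.2.1.getD (i + 2) 0) (p.2.1.getD (i + 1) 0))))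

theorem primrec_matR (hnu : Primrec nu) (hSt : Primrec St) (k : ℕ) :
    Primrec (matR nu St k) := by
  have hz : Primrec fun p : (List Bool × List ℕ × List ℕ) × ℕ => p.1.2.1 :=
    Primrec.fst.comp (Primrec.snd.comp Primrec.fst)
  have hx : Primrec fun p : (List Bool × List ℕ × List ℕ) × ℕ => p.1.1 :=
    Primrec.fst.comp Primrec.fst
  have ha : Primrec fun p : (List Bool × List ℕ × List ℕ) × ℕ => p.1.2.2 :=
    Primrec.snd.comp (Primrec.snd.comp Primrec.fst)
  have hl := Primrec.list_length.comp hz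
  have h0 := Primrec.getD' 0 hz (Primrec.const 0)
  have hv := (Primrec.ofNat (ℕ × ℕ × List ℕ × List ℕ × ℕ × ℕ × ℕ)).comp
    (Primrec.nat_div.comp h0 (Primrec.const 2))
  have hm := Primrec.nat_mod.comp h0 (Primrec.const 2)
  have hi : Primrec fun p : (List Bool × List ℕ × List ℕ) × ℕ => p.2 := Primrec.snd
  have h1 := Primrec.getD' 0 hz (Primrec.succ.comp hi)
  have h2 := Primrec.getD' 0 hz (Primrec.succ.comp (Primrec.succ.comp hi))
  refine Primrec.bor' (Primrec.any' (Primrec.list_range.comp (Primrec.list_length.comp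
    (Primrec.fst.comp Primrec.snd))) ?_) (Primrec.any' (Primrec.list_range.comp
    (Primrec.list_length.comp (Primrec.fst.comp Primrec.snd))) ?_)
  · exact Primrec.band' (Primrec.eqB hm (Primrec.const 0)) (Primrec.band'
      (Primrec.ltB (Primrec.useM' hnu hv hi) hl) (Primrec.matB' hnu hSt k hx ha hv hi))
  · exact Primrec.band' (Primrec.eqB hm (Primrec.const 1)) (Primrec.band'
      (Primrec.ltB (Primrec.succ.comp (Primrec.succ.comp hi)) hl) (Primrec.band'
      (Primrec.ltB (Primrec.two_mul' (Primrec₂.natPair.comp h2 h1)) hl)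
      (Primrec.bnot' (Primrec.wlt' hx h2 h1))))

theorem listExt_pre {β : Type*} (d : β) (x : ℕ → β) (n : ℕ) :
    ∀ i < n, listExt d (pre x n) i = x i := fun _ hi => pre_getD x d hi

theorem good_iff (a : ℕ → ℕ) (k : ℕ) (w : ℕ → Bool) : Good nu St a k w ↔
    ∀ z : ℕ → ℕ, ∃ n, matR nu St k (pre w n, pre z n, pre a n) = true := by
  constructor
  · intro h z
    rcases Nat.mod_two_eq_zero_or_one (z 0) with h0 | h0
    · obtain ⟨e, he⟩ := h.mat (Denumerable.ofNat _ (z 0 / 2))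
      set N := useM nu (Denumerable.ofNat _ (z 0 / 2)) e with hN
      refine ⟨N + e + 1, ?_⟩
      simp only [matR, length_pre, Bool.or_eq_true]
      left
      rw [pre_getD z 0 (by omega)]
      rw [List.any_eq_true]
      refine ⟨e, List.mem_range.2 (by omega), ?_⟩
      rw [matB_congr (w' := w) (a' := a) (N := N + e + 1) (listExt_pre _ _ _)
        (listExt_pre _ _ _) (by omega), he]
      rw [Bool.and_eq_true, Bool.and_eq_true, decide_eq_true_eq, decide_eq_true_eq]
      exact ⟨h0, by omega, rfl⟩
    · obtain ⟨i, hi⟩ := h.wf fun i => z (i + 1)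
      refine ⟨i + 3 + 2 * Nat.pair (z (i + 2)) (z (i + 1)), ?_⟩
      simp only [matR, length_pre, Bool.or_eq_true]
      right
      rw [List.any_eq_true]
      refine ⟨i, List.mem_range.2 (by omega), ?_⟩
      rw [pre_getD z 0 (by omega), pre_getD z 0 (by omega), pre_getD z 0 (by omega),
        wlt_congr (listExt_pre false w _) (by omega), hi]
      simp [h0]; omega
  · intro h
    constructor
    · intro v
      obtain ⟨n, hn⟩ := h fun _ => 2 * encode v
      simp only [matR, length_pre, Bool.or_eq_true, List.any_eq_true, List.mem_range,
        Bool.and_eq_true, decide_eq_true_eq] at hn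
      rcases hn with ⟨e, he, h1, h2, h3⟩ | ⟨i, hi, h1, _⟩
      · rw [pre_getD _ 0 (by omega)] at h2 h3
        simp only [Nat.mul_div_cancel_left _ (by norm_num : 0 < 2), Denumerable.ofNat_encode]
          at h2 h3
        exact ⟨e, by rwa [matB_congr (w' := w) (a' := a) (N := n) (listExt_pre _ _ _)
          (listExt_pre _ _ _) (by omega)] at h3⟩
      · rw [pre_getD _ 0 (by omega)] at h1
        omega
    · intro z
      obtain ⟨n, hn⟩ := h fun i => if i = 0 then 1 else z (i - 1)
      simp only [matR, length_pre, Bool.or_eq_true, List.any_eq_true, List.mem_range,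
        Bool.and_eq_true, decide_eq_true_eq] at hn
      rcases hn with ⟨e, he, h1, h2, h3⟩ | ⟨i, hi, h1, h2, h3, h4⟩
      · rw [pre_getD _ 0 (by omega)] at h1
        simp at h1
      · rw [pre_getD _ 0 (by omega), pre_getD _ 0 (by omega)] at h3 h4
        rw [wlt_congr (listExt_pre false w _) h3] at h4
        exact ⟨i, by simpa using h4⟩

end

section
variable (nu : ℕ → ℕ) (St : List ℕ × ℕ × ℕ × List ℕ → Bool) (a : ℕ → ℕ)

/-- The move relation (`p'` is a move from `p`) of the ordinal game. -/
def Mv (p' p : ℕ × List Ordinal.{0}) : Prop :=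
  ∃ b, p'.2 = p.2 ++ b ∧ b.length = nu p'.1 ∧
    St (pre a (nu p'.1), p.1, p'.1, pat oLt p'.2) = true

variable {nu St a}

/-- The winning positions of the game bounded by `θ`. -/
def Wn (hwf : WellFounded (Mv nu St a)) (θ : Ordinal.{0}) : ℕ × List Ordinal.{0} → Prop :=
  hwf.fix fun p ih => ∃ q, ∃ h : Mv nu St a q p, (∀ x ∈ q.2, x < θ) ∧ ¬ ih q h

/-- `b` is a winning move from `(c, L)` to code `c'`. -/
def Win (hwf : WellFounded (Mv nu St a)) (θ : Ordinal.{0}) (c c' : ℕ) (L b : List Ordinal.{0}) :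
    Prop :=
  b.length = nu c' ∧ (∀ x ∈ L ++ b, x < θ) ∧
    St (pre a (nu c'), c, c', pat oLt (L ++ b)) = true ∧ ¬ Wn hwf θ (c', L ++ b)

theorem Wn_iff (hwf : WellFounded (Mv nu St a)) (θ : Ordinal.{0}) (c : ℕ) (L : List Ordinal.{0}) :
    Wn hwf θ (c, L) ↔ ∃ c' b, Win hwf θ c c' L b := by
  unfold Wn
  rw [WellFounded.fix_eq]
  constructor
  · rintro ⟨⟨c', L'⟩, ⟨b, hb, h1, h2⟩, h3, h4⟩
    simp only at hb h1 h2 h3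
    subst hb
    exact ⟨c', b, h1, h3, h2, h4⟩
  · rintro ⟨c', b, h1, h2, h3, h4⟩
    exact ⟨(c', L ++ b), ⟨b, rfl, h1, h3⟩, h2, h4⟩

open Classical in
/-- The lexicographically least winning move, if any. -/
noncomputable def Wit (hwf : WellFounded (Mv nu St a)) (θ : Ordinal.{0}) (c c' : ℕ)
    (L : List Ordinal.{0}) : List Ordinal.{0} :=
  if h : {b | Win hwf θ c c' L b}.Nonempty then
    (exists_lexB_min (nu c') _ h fun _ hb => hb.1).choose else []

theorem Wit_spec (hwf : WellFounded (Mv nu St a)) {θ : Ordinal.{0}} {c c' : ℕ}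
    {L b : List Ordinal.{0}} (hb : Win hwf θ c c' L b) :
    Win hwf θ c c' L (Wit hwf θ c c' L) ∧ lexB oLt 0 b (Wit hwf θ c c' L) = false := by
  have h : {b | Win hwf θ c c' L b}.Nonempty := ⟨b, hb⟩
  rw [Wit, dif_pos h]
  have := (exists_lexB_min (nu c') _ h fun _ hb => hb.1).choose_spec
  exact ⟨this.1, this.2 b hb⟩

theorem Wit_eq (hwf : WellFounded (Mv nu St a)) {θ : Ordinal.{0}} {c c' : ℕ}
    {L t : List Ordinal.{0}} (ht : Win hwf θ c c' L t)
    (hm : ∀ b, Win hwf θ c c' L b → lexB oLt 0 b t = false) : Wit hwf θ c c' L = t := by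
  have h := Wit_spec hwf ht
  exact eq_of_not_lexB (h.1.1.trans ht.1.symm) (hm _ h.1) h.2

theorem Wit_eq_nil (hwf : WellFounded (Mv nu St a)) {θ : Ordinal.{0}} {c c' : ℕ}
    {L : List Ordinal.{0}} (h : ∀ b, ¬ Win hwf θ c c' L b) : Wit hwf θ c c' L = [] := by
  rw [Wit, dif_neg]
  rintro ⟨b, hb⟩
  exact h b hb

theorem Wit_getD_lt (hwf : WellFounded (Mv nu St a)) {θ : Ordinal.{0}} (hθ : 0 < θ) (c c' : ℕ)
    (L : List Ordinal.{0}) (i : ℕ) : (Wit hwf θ c c' L).getD i 0 < θ := by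
  by_cases h : ∃ b, Win hwf θ c c' L b
  · obtain ⟨b, hb⟩ := h
    have hw := (Wit_spec hwf hb).1
    by_cases hi : i < (Wit hwf θ c c' L).length
    · rw [List.getD_eq_getElem _ _ hi]
      exact hw.2.1 _ (by simp)
    · rw [List.getD_eq_default _ _ (by omega)]; exact hθ
  · rw [Wit_eq_nil hwf (by simpa using h)]; simpa

namespace Good
variable {k : ℕ} {w : ℕ → Bool}

theorem conds (h : Good nu St a k w) (c c' : ℕ) (l b : List ℕ) (x y z : ℕ) :
    ∃ e, (wlt w x x = false ∧ (wlt w x y = true → wlt w y z = true → wlt w x z = true) ∧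
      (wlt w x z = true → wlt w x y = true ∨ wlt w y z = true)) ∧
    (wX w c l = true → winb nu St a w c e l (nms (nu e) c e l) = true) ∧
    (winb nu St a w c c' l b = true → wX w c l = true ∧
      winb nu St a w c c' l (nms (nu c') c c' l) = true ∧
      lexB (wlt w) 0 b (nms (nu c') c c' l) = false) ∧
    (winb nu St a w c c' l (nms (nu c') c c' l) = true ∧ x < nu c' ∨
      wlt w y (nm x c c' l) = false) ∧ (x < k ∨ wlt w y (2 * x) = false) := by
  obtain ⟨e, he⟩ := h.mat (c, c', l, b, x, y, z)
  refine ⟨e, ?_⟩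
  simp only [matB, Bool.and_eq_true, Bool.or_eq_true, Bool.not_eq_true', decide_eq_true_eq] at he
  obtain ⟨⟨⟨⟨⟨⟨h1, h2⟩, h3⟩, h4⟩, h5⟩, h6⟩, h7⟩ := he
  refine ⟨⟨h1, ?_, ?_⟩, ?_, ?_, h6, h7⟩
  · intro hx hy
    rcases h2 with h2 | h2
    · simp [hx, hy] at h2
    · exact h2
  · intro hx
    rcases h3 with h3 | h3
    · simp [hx] at h3
    · exact h3
  · intro hx
    rcases h4 with h3 | h3
    · simp [hx] at h3
    · exact h3
  · intro hx
    rcases h5 with h3 | h3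
    · simp [hx] at h3
    · exact ⟨h3.1.1, h3.1.2, h3.2⟩

theorem lt_irrefl (h : Good nu St a k w) (x : ℕ) : wlt w x x = false :=
  (h.conds 0 0 [] [] x 0 0).choose_spec.1.1

theorem lt_trans (h : Good nu St a k w) {x y z : ℕ} (hx : wlt w x y = true)
    (hy : wlt w y z = true) : wlt w x z = true :=
  (h.conds 0 0 [] [] x y z).choose_spec.1.2.1 hx hy

theorem lt_or (h : Good nu St a k w) {x z : ℕ} (y : ℕ) (hx : wlt w x z = true) :
    wlt w x y = true ∨ wlt w y z = true :=
  (h.conds 0 0 [] [] x y z).choose_spec.1.2.2 hx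

theorem wX_imp (h : Good nu St a k w) {c : ℕ} {l : List ℕ} (hx : wX w c l = true) :
    ∃ c', winb nu St a w c c' l (nms (nu c') c c' l) = true :=
  ⟨_, (h.conds c 0 l [] 0 0 0).choose_spec.2.1 hx⟩

theorem winb_imp (h : Good nu St a k w) {c c' : ℕ} {l b : List ℕ}
    (hx : winb nu St a w c c' l b = true) : wX w c l = true ∧
      winb nu St a w c c' l (nms (nu c') c c' l) = true ∧
      lexB (wlt w) 0 b (nms (nu c') c c' l) = false :=
  (h.conds c c' l b 0 0 0).choose_spec.2.2.1 hx

theorem nm_zero (h : Good nu St a k w) (i c c' : ℕ) (l : List ℕ)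
    (hx : ¬ (winb nu St a w c c' l (nms (nu c') c c' l) = true ∧ i < nu c')) (m : ℕ) :
    wlt w m (nm i c c' l) = false :=
  (h.conds c c' l [] i m 0).choose_spec.2.2.2.1.resolve_left hx

theorem par_zero (h : Good nu St a k w) {i : ℕ} (hi : k ≤ i) (m : ℕ) :
    wlt w m (2 * i) = false :=
  (h.conds 0 0 [] [] i m 0).choose_spec.2.2.2.2.resolve_left (by omega)

theorem wellFounded (h : Good nu St a k w) : WellFounded fun m m' => wlt w m m' = true := by
  rw [wellFounded_iff_isEmpty_descending_chain]
  refine ⟨fun ⟨z, hz⟩ => ?_⟩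
  obtain ⟨i, hi⟩ := h.wf z
  have := hz i
  simp [hi] at this

/-- The ordinal named by `m`. -/
noncomputable def val (h : Good nu St a k w) (m : ℕ) : Ordinal.{0} :=
  @IsWellFounded.rank _ (fun m m' => wlt w m m' = true) ⟨h.wellFounded⟩ m

theorem val_eq (h : Good nu St a k w) (m : ℕ) :
    h.val m = ⨆ b : { b // wlt w b m = true }, Order.succ (h.val b) :=
  @IsWellFounded.rank_eq _ (fun m m' => wlt w m m' = true) ⟨h.wellFounded⟩ m

theorem val_lt (h : Good nu St a k w) {m m' : ℕ} : h.val m < h.val m' ↔ wlt w m m' = true := by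
  constructor
  · intro hlt
    by_contra hn
    apply not_le.2 hlt
    rw [h.val_eq m']
    apply Ordinal.iSup_le
    rintro ⟨b, hb⟩
    rw [Order.succ_le_iff]
    have : IsWellFounded ℕ fun m m' => wlt w m m' = true := ⟨h.wellFounded⟩
    exact IsWellFounded.rank_lt_of_rel (r := fun m m' => wlt w m m' = true)
      ((h.lt_or m hb).resolve_right hn)
  · have : IsWellFounded ℕ fun m m' => wlt w m m' = true := ⟨h.wellFounded⟩
    exact fun hm => IsWellFounded.rank_lt_of_rel (r := fun m m' => wlt w m m' = true) hm

theorem oLt_val (h : Good nu St a k w) : (fun m m' => oLt (h.val m) (h.val m')) = wlt w := by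
  funext m m'
  rw [Bool.eq_iff_iff, oLt_iff, h.val_lt]

/-- The supremum of the ordinals named. -/
noncomputable def tht (h : Good nu St a k w) : Ordinal.{0} := ⨆ m, Order.succ (h.val m)

theorem val_lt_tht (h : Good nu St a k w) (m : ℕ) : h.val m < h.tht :=
  Order.succ_le_iff.1 (Ordinal.le_iSup (fun m => Order.succ (h.val m)) m)

theorem exists_val (h : Good nu St a k w) {x : Ordinal.{0}} (hx : x < h.tht) :
    ∃ m, h.val m = x := by
  obtain ⟨m, hm⟩ := (Ordinal.lt_iSup_iff).1 hx
  rw [Order.lt_succ_iff] at hm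
  have : IsWellFounded ℕ fun m m' => wlt w m m' = true := ⟨h.wellFounded⟩
  exact IsWellFounded.mem_range_rank_of_le (r := fun m m' => wlt w m m' = true) hm

theorem exists_map_val (h : Good nu St a k w) {b : List Ordinal.{0}} (hb : ∀ x ∈ b, x < h.tht) :
    ∃ b' : List ℕ, b'.map h.val = b := by
  induction b with
  | nil => exact ⟨[], rfl⟩
  | cons x b ih =>
    obtain ⟨m, hm⟩ := h.exists_val (hb x (by simp))
    obtain ⟨b', hb'⟩ := ih fun y hy => hb y (by simp [hy])
    exact ⟨m :: b', by simp [hm, hb']⟩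

theorem winb_iff (h : Good nu St a k w) (hwf : WellFounded (Mv nu St a)) (c c' : ℕ)
    (l b : List ℕ) 
    (hX : wX w c' (l ++ b) = true ↔ Wn hwf h.tht (c', (l ++ b).map h.val)) :
    winb nu St a w c c' l b = true ↔ Win hwf h.tht c c' (l.map h.val) (b.map h.val) := by
  unfold winb Win
  rw [← List.map_append, pat_map, h.oLt_val, List.length_map, ← hX]
  simp only [Bool.and_eq_true, decide_eq_true_eq, Bool.not_eq_true', Bool.not_eq_true]
  constructor
  · rintro ⟨⟨h1, h2⟩, h3⟩
    refine ⟨h1, ?_, h2, h3⟩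
    intro x hx
    obtain ⟨m, -, rfl⟩ := List.mem_map.1 hx
    exact h.val_lt_tht m
  · rintro ⟨h1, -, h2, h3⟩
    exact ⟨⟨h1, h2⟩, h3⟩

theorem wX_iff (h : Good nu St a k w) (hwf : WellFounded (Mv nu St a)) :
    ∀ p : ℕ × List Ordinal.{0}, ∀ l : List ℕ, l.map h.val = p.2 →
      (wX w p.1 l = true ↔ Wn hwf h.tht p) := by
  intro p
  induction p using hwf.induction with
  | _ p ih =>
  obtain ⟨c, L⟩ := p
  rintro l rfl
  simp only at ih ⊢
  rw [Wn_iff]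
  constructor
  · intro hx
    obtain ⟨c', hc'⟩ := h.wX_imp hx
    refine ⟨c', _, (h.winb_iff hwf _ _ _ _ ?_).1 hc'⟩
    refine ih (c', _) ?_ _ rfl
    simp only [winb, Bool.and_eq_true, decide_eq_true_eq, Bool.not_eq_true'] at hc'
    refine ⟨_, List.map_append, by simpa using hc'.1.1, ?_⟩
    simp only [pat_map, h.oLt_val]
    exact hc'.1.2
  · rintro ⟨c', b, hb⟩
    obtain ⟨b', rfl⟩ := h.exists_map_val (b := b) fun x hx => hb.2.1 x (by simp [hx])
    refine (h.winb_imp ((h.winb_iff hwf c c' l b' ?_).2 hb)).1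
    refine ih (c', _) ?_ _ rfl
    exact ⟨_, List.map_append, hb.1, by simpa using hb.2.2.1⟩

theorem val_nm (h : Good nu St a k w) (hwf : WellFounded (Mv nu St a)) (i c c' : ℕ)
    (l : List ℕ) : h.val (nm i c c' l) = (Wit hwf h.tht c c' (l.map h.val)).getD i 0 := by
  have hw : ∀ b, winb nu St a w c c' l b = true ↔
      Win hwf h.tht c c' (l.map h.val) (b.map h.val) :=
    fun b => h.winb_iff hwf _ _ _ _ (h.wX_iff hwf (c', _) _ rfl)
  have hz : ∀ m, (∀ x, wlt w x m = false) → h.val m = 0 := by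
    intro m hm
    by_contra hne
    have : 0 < h.val m := pos_iff_ne_zero.2 hne
    obtain ⟨x, hx⟩ := h.exists_val (this.trans (h.val_lt_tht m))
    rw [← hx, h.val_lt, hm] at this
    simp at this
  by_cases hc : winb nu St a w c c' l (nms (nu c') c c' l) = true
  · have : Wit hwf h.tht c c' (l.map h.val) = (nms (nu c') c c' l).map h.val := by
      refine Wit_eq hwf ((hw _).1 hc) ?_
      intro b hb
      obtain ⟨b, rfl⟩ := h.exists_map_val (b := b) fun x hx => hb.2.1 x (by simp [hx])
      have h1 := (h.winb_imp ((hw b).2 hb)).2.2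
      rw [lexB_default _ _ (h.val 0), lexB_map, h.oLt_val]
      · exact h1
      · rw [hb.1]; simp [nms]
    rw [this]
    by_cases hi : i < nu c'
    · simp [nms, hi]
    · rw [hz _ (h.nm_zero i c c' l (by tauto))]
      simp [nms, hi]
  · rw [hz _ (h.nm_zero i c c' l (by tauto)), Wit_eq_nil]
    · simp
    · intro b hb
      obtain ⟨b, rfl⟩ := h.exists_map_val (b := b) fun x hx => hb.2.1 x (by simp [hx])
      exact hc (h.winb_imp ((hw b).2 hb)).2.1

end Good
end

theorem lt_encode_of_mem {x : ℕ} : ∀ {l : List ℕ}, x ∈ l → x < encode l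
  | y :: l, h => by
    rw [encode_list_cons, Nat.lt_succ_iff]
    rcases List.mem_cons.1 h with rfl | h
    · exact Nat.left_le_pair _ _
    · exact (lt_encode_of_mem h).le.trans (Nat.right_le_pair _ _)

theorem lt_nm_of_mem {x i c c' : ℕ} {l : List ℕ} (h : x ∈ l) : x < nm i c c' l := by
  have h1 := lt_encode_of_mem h
  have h2 := Nat.right_le_pair c' (encode l)
  have h3 := Nat.right_le_pair c (Nat.pair c' (encode l))
  have h4 := Nat.right_le_pair i (Nat.pair c (Nat.pair c' (encode l)))
  simp only [nm, encode_prod_val, encode_nat]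
  omega

theorem even_or_nm (n : ℕ) : (∃ i, n = 2 * i) ∨ ∃ i c c' l, n = nm i c c' l := by
  rcases Nat.even_or_odd' n with ⟨m, rfl | rfl⟩
  · exact Or.inl ⟨m, rfl⟩
  · right
    obtain ⟨⟨i, c, c', l⟩, hq⟩ : ∃ q : ℕ × ℕ × ℕ × List ℕ, encode q = m :=
      ⟨_, Denumerable.encode_ofNat m⟩
    exact ⟨i, c, c', l, by rw [nm, hq]⟩

theorem isClosed_pairwise_wlt : ∀ l : List ℕ,
    IsClosed {w : ℕ → Bool | l.Pairwise fun x y => wlt w x y = true}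
  | [] => by simp
  | x :: l => by
    simp only [List.pairwise_cons, Set.ofPred_and, Set.ofPred_forall]
    refine IsClosed.inter ?_ (isClosed_pairwise_wlt l)
    refine isClosed_iInter fun y => isClosed_iInter fun _ => ?_
    exact isClosed_eq (continuous_apply _) continuous_const

theorem Perfect.not_countable {C : Set (ℕ → Bool)} (hC : Perfect C) (hne : C.Nonempty) :
    ¬ C.Countable := by
  let := TopologicalSpace.upgradeIsCompletelyMetrizable (ℕ → Bool)
  obtain ⟨f, hf, -, hinj⟩ := hC.exists_nat_bool_injection hne
  intro hc
  have : (Set.range f).Countable := hc.mono hf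
  have h2 : Countable (ℕ → Bool) := by
    rw [Set.countable_iff_exists_injOn] at this
    obtain ⟨g, hg⟩ := this
    exact ⟨g ∘ f, fun x y hxy => hinj (hg ⟨x, rfl⟩ ⟨y, rfl⟩ hxy)⟩
  have h3 : Countable (Set ℕ) := by
    classical
    refine Function.Injective.countable (f := fun (s : Set ℕ) (n : ℕ) => decide (n ∈ s)) ?_
    intro s t h
    ext n
    have := congrFun h n
    simpa using this
  exact Function.cantor_surjective _ (exists_surjective_nat (Set ℕ)).choose_spec

section
variable {nu : ℕ → ℕ} {St : List ℕ × ℕ × ℕ × List ℕ → Bool} {a : ℕ → ℕ}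

namespace Good
variable {k : ℕ} {w w' : ℕ → Bool}

theorem val_eq_zero (h : Good nu St a k w) {m : ℕ} (hm : ∀ x, wlt w x m = false) :
    h.val m = 0 := by
  by_contra hne
  have : 0 < h.val m := pos_iff_ne_zero.2 hne
  obtain ⟨x, hx⟩ := h.exists_val (this.trans (h.val_lt_tht m))
  rw [← hx, h.val_lt, hm] at this
  simp at this

theorem val_unique (h : Good nu St a k w) (h' : Good nu St a k w')
    (hwf : WellFounded (Mv nu St a)) (ht : h.tht = h'.tht)
    (hp : ∀ i < k, h.val (2 * i) = h'.val (2 * i)) (m : ℕ) : h.val m = h'.val m := by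
  induction m using Nat.strong_induction_on with
  | _ m ih =>
  rcases even_or_nm m with ⟨i, rfl⟩ | ⟨i, c, c', l, rfl⟩
  · by_cases hi : i < k
    · exact hp i hi
    · rw [h.val_eq_zero (h.par_zero (by omega)), h'.val_eq_zero (h'.par_zero (by omega))]
  · rw [h.val_nm hwf, h'.val_nm hwf, ht,
      List.map_congr_left fun x hx => ih x (lt_nm_of_mem hx)]

theorem eq_of_val (h : Good nu St a k w) (h' : Good nu St a k w')
    (hwf : WellFounded (Mv nu St a)) (ht : h.tht = h'.tht)
    (hp : ∀ i < k, h.val (2 * i) = h'.val (2 * i)) : w = w' := by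
  have hv := h.val_unique h' hwf ht hp
  funext n
  rcases Nat.even_or_odd' n with ⟨m, rfl | rfl⟩
  · have : wlt w m.unpair.1 m.unpair.2 = wlt w' m.unpair.1 m.unpair.2 := by
      rw [Bool.eq_iff_iff, ← h.val_lt, ← h'.val_lt, hv, hv]
    simpa [wlt] using this
  · have : ∀ p : ℕ × List ℕ, wX w p.1 p.2 = wX w' p.1 p.2 := by
      intro p
      rw [Bool.eq_iff_iff, h.wX_iff hwf (p.1, _) p.2 rfl, h'.wX_iff hwf (p.1, _) p.2 rfl, ht,
        List.map_congr_left fun x _ => hv x]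
    obtain ⟨⟨c, l⟩, rfl⟩ : ∃ q : ℕ × List ℕ, encode q = m := ⟨_, Denumerable.encode_ofNat m⟩
    exact this (c, l)

end Good

/-- Extension of finite chains descending in the order coded by some `w ∈ C`. -/
def chainExt (C : Set (ℕ → Bool)) (s' s : List ℕ) : Prop :=
  (∃ m, s' = m :: s) ∧ ∃ w ∈ C, s'.Pairwise fun x y => wlt w x y = true

theorem chainExt_wf {k : ℕ} {C : Set (ℕ → Bool)} (hC : IsClosed C)
    (hG : ∀ w ∈ C, Good nu St a k w) : WellFounded (chainExt C) := by
  rw [wellFounded_iff_isEmpty_descending_chain]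
  refine ⟨fun ⟨f, hf⟩ => ?_⟩
  choose z hz using fun n => (hf n).1
  have hne := IsCompact.nonempty_iInter_of_sequence_nonempty_isCompact_isClosed
    (fun n => C ∩ {w : ℕ → Bool | (f (n + 1)).Pairwise fun x y => wlt w x y = true})
    (fun n w hw => ⟨hw.1, by
      have := hw.2
      rw [Set.mem_ofPred_eq, hz (n + 1), List.pairwise_cons] at this
      exact this.2⟩)
    (fun n => by
      obtain ⟨w, hw, h⟩ := (hf n).2
      exact ⟨w, hw, h⟩)
    ((hC.inter (isClosed_pairwise_wlt _)).isCompact)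
    (fun n => hC.inter (isClosed_pairwise_wlt _))
  obtain ⟨w, hw⟩ := hne
  rw [Set.mem_iInter] at hw
  obtain ⟨i, hi⟩ := (hG w (hw 0).1).wf z
  have := (hw (i + 1)).2
  rw [Set.mem_ofPred_eq, hz (i + 1), List.pairwise_cons] at this
  have := this.1 (z i) (by rw [hz i]; simp)
  simp [hi] at this

theorem countable_good (hnu : Primrec nu) (hSt : Primrec St) (hsmall : Aleph1OfLaCountable a)
    (hwf : WellFounded (Mv nu St a)) (k : ℕ) : {w | Good nu St a k w}.Countable := by
  have hpi : Pi11In a {w | Good nu St a k w} := by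
    refine ⟨matR nu St k, (primrec_matR hnu hSt k).to_comp, ?_⟩
    ext w
    simp only [Set.mem_ofPred_eq, ofFn_eq_pre, good_iff]
  rcases hsmall _ hpi with h | ⟨C, hCS, hC, hne⟩
  · exact h
  exfalso
  refine hC.not_countable hne ?_
  have hG : ∀ w ∈ C, Good nu St a k w := fun w hw => hCS hw
  have : IsWellFounded _ (chainExt C) := ⟨chainExt_wf hC.closed hG⟩
  have hb : ∀ w (hw : w ∈ C) m s, (m :: s).Pairwise (fun x y => wlt w x y = true) →
      (hG w hw).val m ≤ IsWellFounded.rank (chainExt C) (m :: s) := by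
    intro w hw m
    have hg := hG w hw
    induction m using hg.wellFounded.induction with
    | _ m ih =>
    intro s hs
    rw [hg.val_eq]
    apply Ordinal.iSup_le
    rintro ⟨b, hb⟩
    rw [Order.succ_le_iff]
    have hp : (b :: m :: s).Pairwise (fun x y => wlt w x y = true) := by
      rw [List.pairwise_cons]
      refine ⟨?_, hs⟩
      intro y hy
      rcases List.mem_cons.1 hy with rfl | hy
      · exact hb
      · exact hg.lt_trans hb ((List.pairwise_cons.1 hs).1 y hy)
    exact (ih b hb (m :: s) hp).trans_lt (IsWellFounded.rank_lt_of_rel (r := chainExt C)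
      ⟨⟨b, rfl⟩, w, hw, hp⟩)
  set δ := IsWellFounded.rank (chainExt C) [] with hδ
  have hv : ∀ w (hw : w ∈ C) m, (hG w hw).val m < δ := fun w hw m =>
    (hb w hw m [] (by simp)).trans_lt
      (IsWellFounded.rank_lt_of_rel (r := chainExt C) ⟨⟨m, rfl⟩, w, hw, by simp⟩)
  have hth : ∀ w (hw : w ∈ C), (hG w hw).tht ≤ δ := fun w hw =>
    Ordinal.iSup_le fun m => Order.succ_le_iff.2 (hv w hw m)
  have hcount : (Set.Iic δ).Countable :=
    (Set.countable_range (IsWellFounded.rank (chainExt C))).mono fun x hx =>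
      IsWellFounded.mem_range_rank_of_le (r := chainExt C) hx
  have : Countable (Set.Iic δ) := hcount
  rw [← Set.countable_coe_iff]
  refine Function.Injective.countable (β := Set.Iic δ × (Fin k → Set.Iic δ)) (f := fun w : C =>
    (⟨(hG w w.2).tht, hth w w.2⟩, fun i => ⟨(hG w w.2).val (2 * i), (hv w w.2 _).le⟩)) ?_
  intro w w' h
  have h1 := congrArg Subtype.val (congrArg Prod.fst h)
  have h2 := fun i => congrArg Subtype.val (congrFun (congrArg Prod.snd h) i)
  exact Subtype.ext ((hG w w.2).eq_of_val (hG w' w'.2) hwf h1 fun i hi => h2 ⟨i, hi⟩)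

/-- The ordinals named in the hull of the parameters `p`. -/
noncomputable def hullVal (hwf : WellFounded (Mv nu St a)) (θ : Ordinal.{0})
    (p : ℕ → Ordinal.{0}) (n : ℕ) : Ordinal.{0} :=
  if h : n % 2 = 0 then p (n / 2) else
    let q := Denumerable.ofNat (ℕ × ℕ × ℕ × List ℕ) (n / 2)
    (Wit hwf θ q.2.1 q.2.2.1 (q.2.2.2.attach.map fun x => hullVal hwf θ p x.1)).getD q.1 0
termination_by n
decreasing_by
  have h1 := lt_nm_of_mem (i := q.1) (c := q.2.1) (c' := q.2.2.1) x.2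
  have h2 : nm q.1 q.2.1 q.2.2.1 q.2.2.2 = 2 * (n / 2) + 1 := by
    simp only [nm, q, Prod.mk.eta, Denumerable.encode_ofNat]
  omega

theorem hullVal_even (hwf : WellFounded (Mv nu St a)) (θ : Ordinal.{0})
    (p : ℕ → Ordinal.{0}) (i : ℕ) : hullVal hwf θ p (2 * i) = p i := by
  rw [hullVal, dif_pos (by omega)]
  congr 1
  omega

theorem hullVal_nm (hwf : WellFounded (Mv nu St a)) (θ : Ordinal.{0})
    (p : ℕ → Ordinal.{0}) (i c c' : ℕ) (l : List ℕ) : hullVal hwf θ p (nm i c c' l) =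
      (Wit hwf θ c c' (l.map (hullVal hwf θ p))).getD i 0 := by
  have : nm i c c' l / 2 = encode (i, c, c', l) := by simp only [nm]; omega
  rw [hullVal, dif_neg (by simp only [nm]; omega), this]
  simp only [Denumerable.ofNat_encode]
  have key : ∀ l' : List ℕ,
      (l'.attach.map fun x => hullVal hwf θ p x.1) = l'.map (hullVal hwf θ p) := by simp
  rw [key, Denumerable.ofNat_encode]

open Classical in
/-- The real coding the hull of the parameters `p`. -/
noncomputable def hullW (hwf : WellFounded (Mv nu St a)) (θ : Ordinal.{0})
    (p : ℕ → Ordinal.{0}) (n : ℕ) : Bool :=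
  if n % 2 = 0 then
    oLt (hullVal hwf θ p (n / 2).unpair.1) (hullVal hwf θ p (n / 2).unpair.2)
  else decide (Wn hwf θ ((Denumerable.ofNat (ℕ × List ℕ) (n / 2)).1,
    (Denumerable.ofNat (ℕ × List ℕ) (n / 2)).2.map (hullVal hwf θ p)))

theorem wlt_hullW (hwf : WellFounded (Mv nu St a)) (θ : Ordinal.{0}) (p : ℕ → Ordinal.{0}) :
    wlt (hullW hwf θ p) = fun x y => oLt (hullVal hwf θ p x) (hullVal hwf θ p y) := by
  funext x y
  simp only [wlt, hullW, Nat.mul_mod_right, if_true]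
  rw [Nat.mul_div_cancel_left _ (by norm_num)]
  simp

theorem wX_hullW (hwf : WellFounded (Mv nu St a)) (θ : Ordinal.{0}) (p : ℕ → Ordinal.{0})
    (c : ℕ) (l : List ℕ) : wX (hullW hwf θ p) c l = true ↔
      Wn hwf θ (c, l.map (hullVal hwf θ p)) := by
  simp only [wX, hullW]
  rw [if_neg (by omega), show (2 * encode (c, l) + 1) / 2 = encode (c, l) by omega]
  simp only [Denumerable.ofNat_encode, decide_eq_true_eq]

theorem hullVal_lt (hwf : WellFounded (Mv nu St a)) {θ : Ordinal.{0}} {p : ℕ → Ordinal.{0}}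
    (hp : ∀ i, p i < θ) (n : ℕ) : hullVal hwf θ p n < θ := by
  rcases even_or_nm n with ⟨i, rfl⟩ | ⟨i, c, c', l, rfl⟩
  · rw [hullVal_even]; exact hp i
  · rw [hullVal_nm]
    exact Wit_getD_lt hwf (zero_le.trans_lt (hp 0)) _ _ _ _

theorem winb_hullW (hwf : WellFounded (Mv nu St a)) {θ : Ordinal.{0}} {p : ℕ → Ordinal.{0}}
    (hp : ∀ i, p i < θ) (c c' : ℕ) (l b : List ℕ) :
    winb nu St a (hullW hwf θ p) c c' l b = true ↔
      Win hwf θ c c' (l.map (hullVal hwf θ p)) (b.map (hullVal hwf θ p)) := by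
  unfold winb Win
  rw [← List.map_append, pat_map, wlt_hullW, List.length_map, ← wX_hullW]
  simp only [Bool.and_eq_true, decide_eq_true_eq, Bool.not_eq_true', Bool.not_eq_true]
  constructor
  · rintro ⟨⟨h1, h2⟩, h3⟩
    refine ⟨h1, ?_, h2, h3⟩
    intro x hx
    obtain ⟨m, -, rfl⟩ := List.mem_map.1 hx
    exact hullVal_lt hwf hp m
  · rintro ⟨h1, -, h2, h3⟩
    exact ⟨⟨h1, h2⟩, h3⟩

theorem map_nms_hull (hwf : WellFounded (Mv nu St a)) {θ : Ordinal.{0}} (p : ℕ → Ordinal.{0})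
    (c c' : ℕ) (l : List ℕ) {b : List Ordinal.{0}}
    (hb : Win hwf θ c c' (l.map (hullVal hwf θ p)) b) :
    (nms (nu c') c c' l).map (hullVal hwf θ p) =
      Wit hwf θ c c' (l.map (hullVal hwf θ p)) := by
  have hlen := (Wit_spec hwf hb).1.1
  apply List.ext_getElem
  · simp [nms, hlen]
  · intro i h1 h2
    simp only [nms, List.map_map, List.getElem_map, Function.comp, List.getElem_range, hullVal_nm]
    rw [List.getD_eq_getElem _ _ h2]

theorem good_hullW (hwf : WellFounded (Mv nu St a)) {θ : Ordinal.{0}} {p : ℕ → Ordinal.{0}}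
    (hp : ∀ i, p i < θ) {k : ℕ} (hk : ∀ i, k ≤ i → p i = 0) :
    Good nu St a k (hullW hwf θ p) := by
  have hlt : ∀ x y, wlt (hullW hwf θ p) x y = true ↔ hullVal hwf θ p x < hullVal hwf θ p y := by
    intro x y; rw [wlt_hullW, oLt_iff]
  have hlt' : ∀ x y, wlt (hullW hwf θ p) x y = false ↔
      hullVal hwf θ p y ≤ hullVal hwf θ p x := by
    intro x y; rw [← Bool.not_eq_true, hlt, not_lt]
  constructor
  · rintro ⟨c, c', l, b, x, y, z⟩
    have hbase : ∀ e, (wX (hullW hwf θ p) c l = true →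
        winb nu St a (hullW hwf θ p) c e l (nms (nu e) c e l) = true) →
        matB nu St a k (hullW hwf θ p) (c, c', l, b, x, y, z) e = true := by
      intro e he
      simp only [matB, Bool.and_eq_true, Bool.or_eq_true, Bool.not_eq_true', decide_eq_true_eq,
        Bool.and_eq_false_iff]
      refine ⟨⟨⟨⟨⟨⟨?_, ?_⟩, ?_⟩, ?_⟩, ?_⟩, ?_⟩, ?_⟩
      · rw [hlt']
      · simp only [hlt, hlt']
        by_contra! h
        exact absurd (h.1.1.trans h.1.2) (not_lt.2 h.2)
      · simp only [hlt, hlt']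
        by_contra! h
        exact absurd (h.2.2.trans h.2.1) (not_le.2 h.1)
      · by_cases h : wX (hullW hwf θ p) c l = true
        · exact Or.inr (he h)
        · exact Or.inl (by simpa using h)
      · by_cases h : winb nu St a (hullW hwf θ p) c c' l b = true
        · right
          have hw := (winb_hullW hwf hp _ _ _ _).1 h
          refine ⟨⟨(wX_hullW hwf θ p c l).2 ((Wn_iff _ _ _ _).2 ⟨c', _, hw⟩), ?_⟩, ?_⟩
          · rw [winb_hullW hwf hp, map_nms_hull hwf p c c' l hw]
            exact (Wit_spec hwf hw).1
          · have h2 := (Wit_spec hwf hw).2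
            rw [← map_nms_hull hwf p c c' l hw, lexB_default _ _ (hullVal hwf θ p 0), lexB_map,
              ← wlt_hullW] at h2
            · exact h2
            · simp [hw.1.symm, nms]
        · exact Or.inl (by simpa using h)
      · rw [hlt', hullVal_nm]
        by_cases hex : ∃ b, Win hwf θ c c' (l.map (hullVal hwf θ p)) b
        · obtain ⟨b, hb⟩ := hex
          have hs := (Wit_spec hwf hb).1
          by_cases hx : x < nu c'
          · left
            refine ⟨?_, hx⟩
            rw [winb_hullW hwf hp, map_nms_hull hwf p c c' l hb]
            exact hs
          · right
            rw [List.getD_eq_default _ _ (by rw [hs.1]; omega)]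
            exact zero_le
        · right
          rw [Wit_eq_nil hwf (by simpa using hex)]
          exact zero_le
      · rw [hlt', hullVal_even]
        by_cases hx : x < k
        · exact Or.inl hx
        · right
          rw [hk x (by omega)]
          exact zero_le
    by_cases hx : wX (hullW hwf θ p) c l = true
    · obtain ⟨e, b, hb⟩ := (Wn_iff _ _ _ _).1 ((wX_hullW hwf θ p c l).1 hx)
      refine ⟨e, hbase e fun _ => ?_⟩
      rw [winb_hullW hwf hp, map_nms_hull hwf p c e l hb]
      exact (Wit_spec hwf hb).1
    · exact ⟨0, hbase 0 fun h => absurd h hx⟩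
  · intro z
    by_contra! h
    refine (RelEmbedding.natGT (r := ((· < ·) : Ordinal.{0} → Ordinal → Prop))
      (fun i => hullVal hwf θ p (z i)) ?_).not_wellFounded Ordinal.lt_wf
    intro i
    have := h i
    rw [Bool.ne_false_iff, hlt] at this
    exact this

/-- There are only countably many sets of the form `{j | (c j, L) is winning}`. -/
theorem countable_Wn_sets (hnu : Primrec nu) (hSt : Primrec St) (hsmall : Aleph1OfLaCountable a)
    (hwf : WellFounded (Mv nu St a)) {θ : Ordinal.{0}} (hθ : 0 < θ) (k : ℕ) (c : ℕ → ℕ) :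
    {S : Set ℕ | ∃ L : List Ordinal.{0}, L.length = k ∧ (∀ x ∈ L, x < θ) ∧
      S = {j | Wn hwf θ (c j, L)}}.Countable := by
  refine ((countable_good hnu hSt hsmall hwf k).image fun w =>
    {j | wX w (c j) ((List.range k).map (2 * ·)) = true}).mono ?_
  rintro S ⟨L, hL, hlt, rfl⟩
  refine ⟨hullW hwf θ fun i => L.getD i 0, good_hullW hwf ?_ ?_, ?_⟩
  · intro i
    by_cases hi : i < L.length
    · rw [List.getD_eq_getElem _ _ hi]
      exact hlt _ (by simp)
    · rwa [List.getD_eq_default _ _ (by omega)]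
  · intro i hi
    exact List.getD_eq_default _ _ (by omega)
  · ext j
    simp only [Set.mem_ofPred_eq, wX_hullW, List.map_map]
    have : (List.range k).map ((hullVal hwf θ fun i => L.getD i 0) ∘ (2 * ·)) = L := by
      apply List.ext_getElem
      · simp [hL]
      · intro i h1 h2
        simp [Function.comp, hullVal_even, h2]
    rw [this]

end

theorem take_pre {β : Type*} (x : ℕ → β) {k n : ℕ} (h : k ≤ n) : (pre x n).take k = pre x k := by
  simp [pre, ← List.map_take, List.take_range, h]

/-- A computable predicate on four sequences can be replaced by a monotone primitive recursive
one without changing which sequences eventually satisfy it. -/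
theorem exists_primrec_mono {R : List Bool × List ℕ × List ℕ × List ℕ → Bool}
    (hR : Computable R) : ∃ R' : List Bool × List ℕ × List ℕ × List ℕ → Bool, Primrec R' ∧
      (∀ x y z a, (∃ n, R (pre x n, pre y n, pre z n, pre a n) = true) ↔
        ∃ n, R' (pre x n, pre y n, pre z n, pre a n) = true) ∧
      ∀ x y z a m n, m ≤ n → R' (pre x m, pre y m, pre z m, pre a m) = true →
        R' (pre x n, pre y n, pre z n, pre a n) = true := by
  obtain ⟨c, hc⟩ := Nat.Partrec.Code.exists_code.1 (show Nat.Partrec _ from hR)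
  have hev : ∀ p, R p = true ↔ ∃ k, Nat.Partrec.Code.evaln k c (encode p) = some 1 := by
    intro p
    have h1 : (∃ k, Nat.Partrec.Code.evaln k c (encode p) = some 1) ↔
        1 ∈ Nat.Partrec.Code.eval c (encode p) := by
      rw [Nat.Partrec.Code.evaln_complete]; rfl
    rw [h1, hc]
    simp
    cases R p <;> simp
  refine ⟨fun p => (List.range (p.1.length + 1)).any fun k => decide
    (Nat.Partrec.Code.evaln p.1.length c
      (encode (p.1.take k, p.2.1.take k, p.2.2.1.take k, p.2.2.2.take k)) = some 1), ?_, ?_, ?_⟩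
  · refine Primrec.any' (Primrec.list_range.comp (Primrec.succ.comp
      (Primrec.list_length.comp Primrec.fst))) ?_
    refine Primrec.eqB ?_ (Primrec.const _)
    have hk : Primrec fun q : (List Bool × List ℕ × List ℕ × List ℕ) × ℕ => q.2 := Primrec.snd
    refine Nat.Partrec.Code.primrec_evaln.comp (Primrec.pair (Primrec.pair
      (Primrec.list_length.comp (Primrec.fst.comp Primrec.fst)) (Primrec.const c)) ?_)
    refine Primrec.encode.comp (Primrec.pair (Primrec.list_take.comp hk (Primrec.fst.comp Primrec.fst))
      (Primrec.pair (Primrec.list_take.comp hk (Primrec.fst.comp (Primrec.snd.comp Primrec.fst)))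
      (Primrec.pair (Primrec.list_take.comp hk (Primrec.fst.comp (Primrec.snd.comp (Primrec.snd.comp Primrec.fst))))
      (Primrec.list_take.comp hk (Primrec.snd.comp (Primrec.snd.comp (Primrec.snd.comp Primrec.fst)))))))
  · intro x y z a
    simp only [List.any_eq_true, List.mem_range, length_pre, decide_eq_true_eq]
    constructor
    · rintro ⟨n, hn⟩
      obtain ⟨k, hk⟩ := (hev _).1 hn
      refine ⟨max n k, n, by omega, ?_⟩
      simp only [take_pre _ (le_max_left n k)]
      exact Nat.Partrec.Code.evaln_mono (le_max_right n k) hk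
    · rintro ⟨N, n, hn, h⟩
      simp only [take_pre _ (Nat.lt_succ_iff.1 hn)] at h
      exact ⟨n, (hev _).2 ⟨N, h⟩⟩
  · intro x y z a m n hmn
    simp only [List.any_eq_true, List.mem_range, length_pre, decide_eq_true_eq]
    rintro ⟨k, hk, h⟩
    refine ⟨k, by omega, ?_⟩
    simp only [take_pre _ (Nat.lt_succ_iff.1 hk), take_pre _ ((Nat.lt_succ_iff.1 hk).trans hmn)]
      at h ⊢
    exact Nat.Partrec.Code.evaln_mono hmn h

/-- The bit recorded by an entry of a node. -/
def bit {α : Type*} (e : ℕ × α) : Bool := decide (e.1.unpair.1 = 1)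

section
variable {α : Type*} (lt : α → α → Bool) (R : List Bool × List ℕ × List ℕ × List ℕ → Bool)

/-- The Boolean membership test of the Shoenfield tree, relative to a finite part `A` of the
parameter. -/
def treeB (A : List ℕ) (κ : α) (s : List (ℕ × α)) : Bool :=
  decide (s.length < A.length + 1) && s.all (fun e => lt e.2 κ) &&
    (List.range s.length).all fun k => decide (k = 0) ||
      (R ((s.map bit).take (Denumerable.ofNat (List ℕ) k).length,
        (s.map fun e => e.1.unpair.2).take (Denumerable.ofNat (List ℕ) k).length,
        (Denumerable.ofNat (List ℕ) k).reverse, A.take (Denumerable.ofNat (List ℕ) k).length) ||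
      lt (s.getD k (0, κ)).2 (s.getD (k - 1).unpair.2 (0, κ)).2)

end

theorem length_ofNat_le (k : ℕ) : (Denumerable.ofNat (List ℕ) k).length ≤ k := by
  have := Encodable.length_le_encode (Denumerable.ofNat (List ℕ) k)
  rwa [Denumerable.encode_ofNat] at this

section
variable (R : List Bool × List ℕ × List ℕ × List ℕ → Bool) (a : ℕ → ℕ)

/-- The Shoenfield tree. -/
def STree (κ : Ordinal.{0}) (s : List (ℕ × Ordinal.{0})) : Prop :=
  treeB oLt R (pre a s.length) κ s = true

variable {R a} {κ : Ordinal.{0}}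

theorem treeB_pre_iff {N : ℕ} {s : List (ℕ × Ordinal.{0})} :
    treeB oLt R (pre a N) κ s = true ↔ s.length ≤ N ∧ (∀ e ∈ s, e.2 < κ) ∧
      ∀ k < s.length, k ≠ 0 →
      R ((s.map bit).take (Denumerable.ofNat (List ℕ) k).length,
        (s.map fun e => e.1.unpair.2).take (Denumerable.ofNat (List ℕ) k).length,
        (Denumerable.ofNat (List ℕ) k).reverse,
        pre a (Denumerable.ofNat (List ℕ) k).length) = false →
      (s.getD k (0, κ)).2 < (s.getD (k - 1).unpair.2 (0, κ)).2 := by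
  simp only [treeB, Bool.and_eq_true, Bool.or_eq_true, decide_eq_true_eq, List.all_eq_true,
    oLt_iff, List.mem_range, length_pre, Nat.lt_succ_iff, and_assoc]
  refine and_congr_right fun hN => and_congr_right fun _ => forall_congr' fun k =>
    forall_congr' fun hk => ?_
  rw [take_pre a (by have := length_ofNat_le k; omega)]
  rw [← Bool.not_eq_true]
  tauto

theorem tree_iff {s : List (ℕ × Ordinal.{0})} :
    STree R a κ s ↔ (∀ e ∈ s, e.2 < κ) ∧ ∀ k < s.length, k ≠ 0 →
      R ((s.map bit).take (Denumerable.ofNat (List ℕ) k).length,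
        (s.map fun e => e.1.unpair.2).take (Denumerable.ofNat (List ℕ) k).length,
        (Denumerable.ofNat (List ℕ) k).reverse,
        pre a (Denumerable.ofNat (List ℕ) k).length) = false →
      (s.getD k (0, κ)).2 < (s.getD (k - 1).unpair.2 (0, κ)).2 := by
  rw [STree, treeB_pre_iff]
  simp

theorem treeB_iff_tree {N : ℕ} {s : List (ℕ × Ordinal.{0})} :
    treeB oLt R (pre a N) κ s = true ↔ s.length ≤ N ∧ STree R a κ s := by
  rw [treeB_pre_iff, tree_iff]

theorem unpair_pred_lt {k : ℕ} (h : k ≠ 0) : (k - 1).unpair.2 < k := by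
  have := Nat.unpair_right_le (k - 1)
  omega

theorem STree.of_isPrefix {s t : List (ℕ × Ordinal.{0})} (h : STree R a κ s) (hp : t <+: s) :
    STree R a κ t := by
  rw [tree_iff] at h ⊢
  obtain ⟨u, rfl⟩ := hp
  refine ⟨fun e he => h.1 e (by simp [he]), fun k hk hk0 hR => ?_⟩
  have hd := length_ofNat_le k
  have hkp := unpair_pred_lt hk0
  have := h.2 k (by simp; omega) hk0
  rw [List.map_append, List.map_append, List.take_append_of_le_length (by simp; omega),
    List.take_append_of_le_length (by simp; omega), List.getD_append _ _ _ _ hk,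
    List.getD_append _ _ _ _ (by omega)] at this
  exact this hR

end

theorem rank_lt_omega_one {β : Type} [Countable β] (r : β → β → Prop) [IsWellFounded β r] (b : β) :
    IsWellFounded.rank r b < Ordinal.omega 1 := by
  induction b using IsWellFounded.induction r with
  | _ b ih =>
  rw [IsWellFounded.rank_eq]
  apply Ordinal.iSup_lt_omega_one
  rintro ⟨c, hc⟩
  exact (Cardinal.isSuccLimit_omega 1).succ_lt (ih c hc)

section
variable {R : List Bool × List ℕ × List ℕ × List ℕ → Bool} {a : ℕ → ℕ}

/-- The secant relation of the tree searching for a counterexample `z`. -/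
def searchRel (R : List Bool × List ℕ × List ℕ × List ℕ → Bool) (x : ℕ → Bool) (y a : ℕ → ℕ)
    (l' l : List ℕ) : Prop :=
  ∃ m, l' = m :: l ∧ R (pre x l'.length, pre y l'.length, l'.reverse, pre a l'.length) = false

theorem searchRel_wf (hmono : ∀ x y z a m n, m ≤ n → R (pre x m, pre y m, pre z m, pre a m) = true →
        R (pre x n, pre y n, pre z n, pre a n) = true) {x : ℕ → Bool} {y : ℕ → ℕ}
    (h : ∀ z : ℕ → ℕ, ∃ n, R (pre x n, pre y n, pre z n, pre a n) = true) :
    WellFounded (searchRel R x y a) := by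
  rw [wellFounded_iff_isEmpty_descending_chain]
  refine ⟨fun ⟨f, hf⟩ => ?_⟩
  choose g hg hR using hf
  have hlen : ∀ n, n ≤ (f n).length := by
    intro n
    induction n with
    | zero => omega
    | succ n ih => rw [hg]; simp; omega
  have hpre : ∀ n i, i < (f n).length → ∀ j, (f (n + j)).reverse.getD i 0 =
      (f n).reverse.getD i 0 := by
    intro n i hi j
    induction j with
    | zero => rfl
    | succ j ih =>
      rw [← add_assoc, hg, List.reverse_cons, List.getD_append, ih]
      have : ∀ j, (f n).length ≤ (f (n + j)).length := by
        intro j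
        induction j with
        | zero => rfl
        | succ j ih => rw [← add_assoc, hg]; simp; omega
      have := this j
      simp; omega
  let z : ℕ → ℕ := fun i => (f (i + 1)).reverse.getD i 0
  have hz : ∀ n, (f n).reverse = pre z (f n).length := by
    intro n
    apply List.ext_getElem
    · simp
    · intro i h1 h2
      have h3 : i < (f n).length := by simpa using h1
      rw [← List.getD_eq_getElem _ 0 h1, ← List.getD_eq_getElem _ 0 h2, pre_getD _ _ h3]
      simp only [z]
      rcases le_total n (i + 1) with hn | hn
      · obtain ⟨j, hj⟩ := Nat.exists_eq_add_of_le hn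
        rw [hj, hpre n i h3]
      · obtain ⟨j, hj⟩ := Nat.exists_eq_add_of_le hn
        rw [hj, hpre (i + 1) i (by have := hlen (i + 1); omega)]
  obtain ⟨n, hn⟩ := h z
  have := hR n
  rw [hz (n + 1)] at this
  rw [hmono x y z a n _ (by have := hlen (n + 1); omega) hn] at this
  simp at this

theorem map_pre {β γ : Type*} (f : ℕ → β) (g : β → γ) (n : ℕ) :
    (pre f n).map g = pre (fun i => g (f i)) n := by simp [pre]

theorem exists_branch_iff (hmono : ∀ x y z a m n, m ≤ n →
      R (pre x m, pre y m, pre z m, pre a m) = true →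
      R (pre x n, pre y n, pre z n, pre a n) = true) (x : ℕ → Bool) :
    (∃ y : ℕ → ℕ, ∀ z : ℕ → ℕ, ∃ n, R (pre x n, pre y n, pre z n, pre a n) = true) ↔
    ∃ f : ℕ → ℕ × Ordinal.{0}, (∀ n, STree R a (Ordinal.omega 1) (pre f n)) ∧
      ∀ i, bit (f i) = x i := by
  constructor
  · rintro ⟨y, hy⟩
    have : IsWellFounded _ (searchRel R x y a) := ⟨searchRel_wf hmono hy⟩
    let f : ℕ → ℕ × Ordinal.{0} := fun n => (Nat.pair (if x n then 1 else 0) (y n),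
      IsWellFounded.rank (searchRel R x y a) (Denumerable.ofNat _ n))
    have hbit : ∀ i, bit (f i) = x i := by
      intro i
      simp only [bit, f, Nat.unpair_pair]
      cases x i <;> simp
    refine ⟨f, fun n => ?_, hbit⟩
    rw [tree_iff]
    constructor
    · intro e he
      obtain ⟨i, -, rfl⟩ := List.mem_map.1 he
      exact rank_lt_omega_one _ _
    · intro k hk hk0 hR
      have hkp := unpair_pred_lt hk0
      have hd := length_ofNat_le k
      rw [length_pre] at hk
      rw [pre_getD f _ hk, pre_getD f _ (by omega)]
      rw [map_pre, map_pre, take_pre _ (by omega), take_pre _ (by omega)] at hR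
      simp only [hbit] at hR
      have hy2 : (fun i => (f i).1.unpair.2) = y := by
        funext i; simp [f]
      rw [hy2] at hR
      apply IsWellFounded.rank_lt_of_rel (r := searchRel R x y a)
      refine ⟨(k - 1).unpair.1, ?_, hR⟩
      obtain ⟨k, rfl⟩ := Nat.exists_eq_succ_of_ne_zero hk0
      rw [Denumerable.list_ofNat_succ]
      simp
  · rintro ⟨f, hf, hx⟩
    refine ⟨fun i => (f i).1.unpair.2, fun z => ?_⟩
    by_contra! hz
    let q : ℕ → ℕ := fun n => encode (pre z n).reverse
    have hq : ∀ n, q (n + 1) = Nat.pair (z n) (q n) + 1 := by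
      intro n
      simp [q, pre, List.range_succ]
    refine (RelEmbedding.natGT (r := ((· < ·) : Ordinal.{0} → Ordinal → Prop))
      (fun i => (f (q i)).2) ?_).not_wellFounded Ordinal.lt_wf
    intro n
    have h1 := (tree_iff.1 (hf (q (n + 1) + 1))).2 (q (n + 1)) (by simp) (by rw [hq]; simp)
    have h2 : Denumerable.ofNat (List ℕ) (q (n + 1)) = (pre z (n + 1)).reverse := by
      simp only [q, Denumerable.ofNat_encode]
    have h3 : n + 1 ≤ q (n + 1) := by
      have := Encodable.length_le_encode (pre z (n + 1)).reverse
      simpa using this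
    rw [h2, List.reverse_reverse, List.length_reverse, length_pre, map_pre, map_pre,
      take_pre _ (by omega), take_pre _ (by omega), pre_getD f _ (by omega),
      show (q (n + 1) - 1).unpair.2 = q n by rw [hq]; simp,
      pre_getD f _ (by have := Nat.right_le_pair (z n) (q n); rw [hq]; omega)] at h1
    refine h1 ?_
    simp only [hx]
    simpa using hz (n + 1)

end

/-- A node of the Shoenfield tree over `α`. -/
abbrev Node (α : Type*) := List (ℕ × α)

/-- An item: a flag, a stage, a pass, and a node. -/
abbrev Item (α : Type*) := ℕ × α × α × Node α

/-- A position: a tag, a natural number, and a list of items. -/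
abbrev Pos (α : Type*) := ℕ × ℕ × List (Item α)

section
variable {α β : Type*}

/-- Apply a function to the labels of a node. -/
def mapNode (g : α → β) (s : Node α) : Node β := s.map fun e => (e.1, g e.2)

/-- Apply a function to the labels of an item. -/
def mapItem (g : α → β) (σ : Item α) : Item β := (σ.1, g σ.2.1, g σ.2.2.1, mapNode g σ.2.2.2)

/-- Apply a function to the labels of a position. -/
def mapPos (g : α → β) (P : Pos α) : Pos β := (P.1, P.2.1, P.2.2.map (mapItem g))

variable (lt : α → α → Bool)

/-- A well-ordering of nodes. -/
def nodeLt (d : α) (s t : Node α) : Bool :=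
  decide (encode (s.map Prod.fst) < encode (t.map Prod.fst)) ||
    (decide (encode (s.map Prod.fst) = encode (t.map Prod.fst)) &&
      lexB lt d (s.map Prod.snd) (t.map Prod.snd))

/-- The item `τ` precedes the pair `(γ, s)` strictly fails: `(γ, s)` comes before `τ`. -/
def bef [DecidableEq α] (d : α) (τ : Item α) (γ : α) (s : Node α) : Bool :=
  !decide (τ.1 = 0) || (lt γ τ.2.2.1 || (decide (γ = τ.2.2.1) && nodeLt lt d s τ.2.2.2))

/-- The item `τ` is admissible for (strictly earlier than) `σ`. -/
def adm [DecidableEq α] (d : α) (τ σ : Item α) : Bool :=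
  (!decide (τ.1 = 0) && lt τ.2.1 σ.2.1) || (decide (τ.1 = 0) && (decide (τ.2.1 = σ.2.1) &&
    (lt τ.2.2.1 σ.2.2.1 ||
      (decide (τ.2.2.1 = σ.2.2.1) && nodeLt lt d τ.2.2.2 σ.2.2.2))))

/-- The `i`-th item of a position. -/
def item (d : α) (P : Pos α) (i : ℕ) : Item α := P.2.2.getD i (0, d, d, [])

/-- The move relation of the game analysing the recursive family. -/
def stepB [DecidableEq α] (Tr : Node α → Bool) (d : α) (P P' : Pos α) : Bool :=
  (decide (P.1 = 0) && (decide (P'.1 = 1) && decide (item d P' 0 = item d P 0))) ||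
  ((decide (P.1 = 1) && (decide (P'.1 = 2) && (decide ((item d P' 0).1 = 0) &&
    (adm lt d (item d P' 0) (item d P 0) &&
      P.2.2.tail.any fun τ => decide (τ = item d P' 0))))) ||
  ((decide (P.1 = 1) && (decide (P'.1 = 3) && (decide (P'.2.2 = P.2.2) &&
    decide (P.2.1 < P'.2.1 + 1)))) ||
  ((decide (P.1 = 2) && (decide (P'.1 = 0) && decide (item d P' 0 = item d P 0))) ||
  ((decide (P.1 = 3) && (decide (P'.1 = 4) &&
    ((decide (item d P' 0 = item d P 0) || (adm lt d (item d P' 0) (item d P 0) &&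
      P.2.2.tail.any fun τ => decide (τ = item d P' 0))) &&
    (decide ((item d P' 1).2.2.2.take (item d P' 0).2.2.2.length = (item d P' 0).2.2.2) &&
    (((item d P' 1).2.2.2.map bit).getD P.2.1 false && Tr (item d P' 1).2.2.2))))) ||
  (decide (P.1 = 4) && (decide (P'.1 = 0) && (decide ((item d P' 0).1 = 0) &&
    (decide ((item d P' 0).2.1 = (item d P 0).2.1) &&
    (decide ((item d P' 0).2.2.2 = (item d P 1).2.2.2) &&
    bef lt d (item d P 0) (item d P' 0).2.2.1 (item d P' 0).2.2.2)))))))))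

theorem mapNode_comp {γ : Type*} (h : β → γ) (g : α → β) (s : Node α) :
    mapNode h (mapNode g s) = mapNode (fun x => h (g x)) s := by simp [mapNode]

theorem mapItem_comp {γ : Type*} (h : β → γ) (g : α → β) (σ : Item α) :
    mapItem h (mapItem g σ) = mapItem (fun x => h (g x)) σ := by simp [mapItem, mapNode_comp]

theorem mapPos_comp {γ : Type*} (h : β → γ) (g : α → β) (P : Pos α) :
    mapPos h (mapPos g P) = mapPos (fun x => h (g x)) P := by simp [mapPos, mapItem_comp]

theorem item_mapPos (g : α → β) (d : α) (P : Pos α) (i : ℕ) :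
    item (g d) (mapPos g P) i = mapItem g (item d P i) := by
  have : ((0, g d, g d, []) : Item β) = mapItem g (0, d, d, []) := rfl
  simp only [item, mapPos, this]
  simp [List.getD_eq_getElem?_getD]

theorem nodeLt_map (g : β → α) (d : β) (s t : Node β) :
    nodeLt lt (g d) (mapNode g s) (mapNode g t) = nodeLt (fun x y => lt (g x) (g y)) d s t := by
  have h1 : ∀ s : Node β, (mapNode g s).map Prod.fst = s.map Prod.fst := by simp [mapNode]
  have h2 : ∀ s : Node β, (mapNode g s).map Prod.snd = (s.map Prod.snd).map g := by simp [mapNode]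
  simp only [nodeLt, h1, h2, lexB_map]

theorem treeB_map (R : List Bool × List ℕ × List ℕ × List ℕ → Bool) (A : List ℕ) (g : β → α)
    (d : β) (s : Node β) :
    treeB lt R A (g d) (mapNode g s) = treeB (fun x y => lt (g x) (g y)) R A d s := by
  have h1 : (mapNode g s).map bit = s.map bit := by simp [mapNode, bit]
  have h2 : (mapNode g s).map (fun e => e.1.unpair.2) = s.map fun e => e.1.unpair.2 := by
    simp [mapNode]
  have h3 : ∀ i, ((mapNode g s).getD i (0, g d)).2 = g (s.getD i (0, d)).2 := by
    intro i
    simp only [mapNode, List.getD_eq_getElem?_getD, List.getElem?_map]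
    cases s[i]? <;> rfl
  have h4 : (mapNode g s).length = s.length := by simp [mapNode]
  have h5 : (mapNode g s).all (fun e => lt e.2 (g d)) = s.all fun e => lt (g e.2) (g d) := by
    simp [mapNode, List.all_map, Function.comp_def]
  simp only [treeB, h1, h2, h3, h4, h5]

theorem nodeLt_default {d d' : α} {s t : Node α} : nodeLt lt d s t = nodeLt lt d' s t := by
  unfold nodeLt
  by_cases h : encode (s.map Prod.fst) = encode (t.map Prod.fst)
  · have h1 := congrArg List.length (encode_injective h)
    simp only [List.length_map] at h1
    rw [lexB_default lt d d' (by simpa using h1)]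
  · simp [h]

end

section
variable {α β ι : Type*} {g : ι → α} {g' : ι → β}

theorem exists_factor [Nonempty β] (h : ∀ i j, g i = g j → g' i = g' j) :
    ∃ G : α → β, g' = fun i => G (g i) := by
  classical
  refine ⟨fun x => if hx : ∃ i, g i = x then g' hx.choose else Classical.arbitrary β, ?_⟩
  funext i
  have hx : ∃ j, g j = g i := ⟨i, rfl⟩
  simp only [dif_pos hx]
  exact (h _ _ hx.choose_spec).symm

theorem mapItem_eq_iff [Nonempty α] [Nonempty β] (h : ∀ i j, g i = g j ↔ g' i = g' j)
    {σ τ : Item ι} : mapItem g σ = mapItem g τ ↔ mapItem g' σ = mapItem g' τ := by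
  obtain ⟨G, hG⟩ := exists_factor fun i j => (h i j).1
  obtain ⟨G', hG'⟩ := exists_factor fun i j => (h i j).2
  constructor
  · intro e
    rw [hG, ← mapItem_comp G g, ← mapItem_comp G g, e]
  · intro e
    rw [hG', ← mapItem_comp G' g', ← mapItem_comp G' g', e]

theorem mapNode_eq_iff [Nonempty α] [Nonempty β] (h : ∀ i j, g i = g j ↔ g' i = g' j)
    {s t : Node ι} : mapNode g s = mapNode g t ↔ mapNode g' s = mapNode g' t := by
  obtain ⟨G, hG⟩ := exists_factor fun i j => (h i j).1
  obtain ⟨G', hG'⟩ := exists_factor fun i j => (h i j).2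
  constructor
  · intro e
    rw [hG, ← mapNode_comp G g, ← mapNode_comp G g, e]
  · intro e
    rw [hG', ← mapNode_comp G' g', ← mapNode_comp G' g', e]

theorem mapItems_eq_iff [Nonempty α] [Nonempty β] (h : ∀ i j, g i = g j ↔ g' i = g' j)
    {l m : List (Item ι)} :
    l.map (mapItem g) = m.map (mapItem g) ↔ l.map (mapItem g') = m.map (mapItem g') := by
  induction l generalizing m with
  | nil => simp
  | cons x l ih => cases m with
    | nil => simp
    | cons y m => simp only [List.map_cons, List.cons.injEq, ih, mapItem_eq_iff h]

theorem stepB_congr [Nonempty α] [Nonempty β] [DecidableEq α] [DecidableEq β]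
    {lt : α → α → Bool} {lt' : β → β → Bool}
    (hlt : ∀ i j, lt (g i) (g j) = lt' (g' i) (g' j)) (h : ∀ i j, g i = g j ↔ g' i = g' j)
    {Tr : Node α → Bool} {Tr' : Node β → Bool}
    (hT : ∀ s, Tr (mapNode g s) = Tr' (mapNode g' s)) (d : ι) (P P' : Pos ι) :
    stepB lt Tr (g d) (mapPos g P) (mapPos g P') =
      stepB lt' Tr' (g' d) (mapPos g' P) (mapPos g' P') := by
  have hn : ∀ s t, nodeLt lt (g d) (mapNode g s) (mapNode g t) =
      nodeLt lt' (g' d) (mapNode g' s) (mapNode g' t) := by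
    intro s t
    rw [nodeLt_map, nodeLt_map]
    simp only [hlt]
  have hd : ∀ i j, decide (g i = g j) = decide (g' i = g' j) := fun i j => decide_eq_decide.2 (h i j)
  have hdi : ∀ σ τ : Item ι, decide (mapItem g σ = mapItem g τ) =
      decide (mapItem g' σ = mapItem g' τ) := fun σ τ => decide_eq_decide.2 (mapItem_eq_iff h)
  have hdn : ∀ s t : Node ι, decide (mapNode g s = mapNode g t) =
      decide (mapNode g' s = mapNode g' t) := fun s t => decide_eq_decide.2 (mapNode_eq_iff h)
  have hds : ∀ l m : List (Item ι), decide (l.map (mapItem g) = m.map (mapItem g)) =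
      decide (l.map (mapItem g') = m.map (mapItem g')) :=
    fun l m => decide_eq_decide.2 (mapItems_eq_iff h)
  have f1 : ∀ (g : ι → α) σ, (mapItem g σ).1 = σ.1 := fun _ _ => rfl
  have f1' : ∀ (g : ι → β) σ, (mapItem g σ).1 = σ.1 := fun _ _ => rfl
  have f2 : ∀ σ, (mapItem g σ).2.1 = g σ.2.1 := fun _ => rfl
  have f2' : ∀ σ, (mapItem g' σ).2.1 = g' σ.2.1 := fun _ => rfl
  have f3 : ∀ σ, (mapItem g σ).2.2.1 = g σ.2.2.1 := fun _ => rfl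
  have f3' : ∀ σ, (mapItem g' σ).2.2.1 = g' σ.2.2.1 := fun _ => rfl
  have f4 : ∀ σ, (mapItem g σ).2.2.2 = mapNode g σ.2.2.2 := fun _ => rfl
  have f4' : ∀ σ, (mapItem g' σ).2.2.2 = mapNode g' σ.2.2.2 := fun _ => rfl
  have hb : ∀ τ γ s, bef lt (g d) (mapItem g τ) (g γ) (mapNode g s) =
      bef lt' (g' d) (mapItem g' τ) (g' γ) (mapNode g' s) := by
    intro τ γ s
    simp only [bef, f1, f1', f3, f3', f4, f4', hn, hlt, hd]
  have ha : ∀ τ σ, adm lt (g d) (mapItem g τ) (mapItem g σ) =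
      adm lt' (g' d) (mapItem g' τ) (mapItem g' σ) := by
    intro τ σ
    simp only [adm, f1, f1', f2, f2', f3, f3', f4, f4', hn, hlt, hd]
  have hbit : ∀ s : Node ι, (mapNode g s).map bit = (mapNode g' s).map bit := by
    intro s; simp [mapNode, bit]
  have hm : ∀ (l : List (Item ι)) σ,
      ((l.map (mapItem g)).tail.any fun τ => decide (τ = mapItem g σ)) =
      ((l.map (mapItem g')).tail.any fun τ => decide (τ = mapItem g' σ)) := by
    intro l σ
    simp only [← List.map_tail, List.any_map, Function.comp_def, hdi]
  have ht : ∀ (s t : Node ι), decide ((mapNode g s).take (mapNode g t).length = mapNode g t) =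
      decide ((mapNode g' s).take (mapNode g' t).length = mapNode g' t) := by
    intro s t
    have h1 : ∀ n, (mapNode g s).take n = mapNode g (s.take n) := by simp [mapNode, List.map_take]
    have h2 : ∀ n, (mapNode g' s).take n = mapNode g' (s.take n) := by
      simp [mapNode, List.map_take]
    have h3 : (mapNode g t).length = (mapNode g' t).length := by simp [mapNode]
    simp only [h1, h2, hdn, h3]
  have p1 : ∀ (P : Pos ι), (mapPos g P).1 = P.1 := fun _ => rfl
  have p1' : ∀ (P : Pos ι), (mapPos g' P).1 = P.1 := fun _ => rfl
  have p2 : ∀ (P : Pos ι), (mapPos g P).2.1 = P.2.1 := fun _ => rfl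
  have p2' : ∀ (P : Pos ι), (mapPos g' P).2.1 = P.2.1 := fun _ => rfl
  have p3 : ∀ (P : Pos ι), (mapPos g P).2.2 = P.2.2.map (mapItem g) := fun _ => rfl
  have p3' : ∀ (P : Pos ι), (mapPos g' P).2.2 = P.2.2.map (mapItem g') := fun _ => rfl
  simp only [stepB, item_mapPos, p1, p1', p2, p2', p3, p3', hdi, hds, hm, ha, f1, f1', f2, f2', f3,
    f3', f4, f4', hb, hd, hdn, ht, hbit, hT]

end

section
variable {α : Type*} [Primcodable α]

theorem Primrec.getDv {β : Type*} [Primcodable β] {f : α → List β} {g : α → ℕ} {d : α → β}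
    (hf : Primrec f) (hg : Primrec g) (hd : Primrec d) :
    Primrec fun p => (f p).getD (g p) (d p) :=
  (Primrec.option_getD.comp (Primrec.list_getElem?.comp hf hg) hd).of_eq fun p => by
    rw [List.getD_eq_getElem?_getD]

theorem Primrec.nodeLt' {d : α → ℕ} {s t : α → Node ℕ} (hs : Primrec s) (ht : Primrec t) :
    Primrec fun p => nodeLt (fun x y => decide (x < y)) (d p) (s p) (t p) := by
  have h1 : ∀ {s : α → Node ℕ}, Primrec s → Primrec fun p => (s p).map Prod.fst := fun hs =>
    Primrec.list_map hs (Primrec.fst.comp Primrec.snd)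
  have h2 : ∀ {s : α → Node ℕ}, Primrec s → Primrec fun p => (s p).map Prod.snd := fun hs =>
    Primrec.list_map hs (Primrec.snd.comp Primrec.snd)
  have : Primrec fun p => nodeLt (fun x y => decide (x < y)) 0 (s p) (t p) := by
    refine Primrec.bor' (Primrec.ltB (Primrec.encode.comp (h1 hs)) (Primrec.encode.comp (h1 ht)))
      (Primrec.band' (Primrec.eqB (Primrec.encode.comp (h1 hs)) (Primrec.encode.comp (h1 ht))) ?_)
    exact Primrec.lexB' (lt := fun _ x y => decide (x < y)) 0
      (Primrec.ltB (Primrec.fst.comp Primrec.snd) (Primrec.snd.comp Primrec.snd)) (h2 hs) (h2 ht)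
  exact this.of_eq fun p => nodeLt_default _

theorem Primrec.bit' : Primrec (bit : ℕ × ℕ → Bool) :=
  Primrec.eqB (Primrec.fst.comp (Primrec.unpair.comp Primrec.fst)) (Primrec.const 1)

theorem Primrec.treeB' {R : List Bool × List ℕ × List ℕ × List ℕ → Bool} (hR : Primrec R)
    {A : α → List ℕ} {κ : α → ℕ} {s : α → Node ℕ} (hA : Primrec A) (hκ : Primrec κ)
    (hs : Primrec s) :
    Primrec fun p => treeB (fun x y => decide (x < y)) R (A p) (κ p) (s p) := by
  refine Primrec.band' (Primrec.band' (Primrec.ltB (Primrec.list_length.comp hs)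
    (Primrec.succ.comp (Primrec.list_length.comp hA))) ?_) ?_
  · exact Primrec.all' hs (Primrec.ltB (Primrec.snd.comp Primrec.snd) (hκ.comp Primrec.fst))
  · refine Primrec.all' (Primrec.list_range.comp (Primrec.list_length.comp hs)) ?_
    have hk : Primrec fun q : α × ℕ => q.2 := Primrec.snd
    have hl : Primrec fun q : α × ℕ => Denumerable.ofNat (List ℕ) q.2 :=
      (Primrec.ofNat (List ℕ)).comp hk
    have hn := Primrec.list_length.comp hl
    have hs' : Primrec fun q : α × ℕ => s q.1 := hs.comp Primrec.fst
    refine Primrec.bor' (Primrec.eqB hk (Primrec.const 0)) (Primrec.bor' (hR.comp ?_) ?_)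
    · refine Primrec.pair (Primrec.list_take.comp hn
        (Primrec.list_map hs' (Primrec.bit'.comp Primrec.snd))) (Primrec.pair
        (Primrec.list_take.comp hn (Primrec.list_map hs'
          (Primrec.snd.comp (Primrec.unpair.comp (Primrec.fst.comp Primrec.snd)))))
        (Primrec.pair (Primrec.list_reverse.comp hl)
          (Primrec.list_take.comp hn (hA.comp Primrec.fst))))
    · have hd : Primrec fun q : α × ℕ => ((0, κ q.1) : ℕ × ℕ) :=
        Primrec.pair (Primrec.const 0) (hκ.comp Primrec.fst)
      refine Primrec.ltB (Primrec.snd.comp (Primrec.getDv hs' hk hd))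
        (Primrec.snd.comp (Primrec.getDv hs' ?_ hd))
      exact Primrec.snd.comp (Primrec.unpair.comp (Primrec.nat_sub.comp hk (Primrec.const 1)))

theorem Primrec.bef' {d : α → ℕ} {τ : α → Item ℕ} {γ : α → ℕ} {s : α → Node ℕ}
    (hτ : Primrec τ) (hγ : Primrec γ) (hs : Primrec s) :
    Primrec fun p => bef (fun x y => decide (x < y)) (d p) (τ p) (γ p) (s p) := by
  have h3 : Primrec fun p => (τ p).2.2.1 :=
    Primrec.fst.comp (Primrec.snd.comp (Primrec.snd.comp hτ))
  refine Primrec.bor' (Primrec.bnot' (Primrec.eqB (Primrec.fst.comp hτ) (Primrec.const 0)))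
    (Primrec.bor' (Primrec.ltB hγ h3) (Primrec.band' (Primrec.eqB hγ h3) (Primrec.nodeLt' hs ?_)))
  exact Primrec.snd.comp (Primrec.snd.comp (Primrec.snd.comp hτ))

theorem Primrec.adm' {d : α → ℕ} {τ σ : α → Item ℕ} (hτ : Primrec τ) (hσ : Primrec σ) :
    Primrec fun p => adm (fun x y => decide (x < y)) (d p) (τ p) (σ p) := by
  have h2 : ∀ {τ : α → Item ℕ}, Primrec τ → Primrec fun p => (τ p).2.1 := fun hτ =>
    Primrec.fst.comp (Primrec.snd.comp hτ)
  have h3 : ∀ {τ : α → Item ℕ}, Primrec τ → Primrec fun p => (τ p).2.2.1 := fun hτ =>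
    Primrec.fst.comp (Primrec.snd.comp (Primrec.snd.comp hτ))
  have h4 : ∀ {τ : α → Item ℕ}, Primrec τ → Primrec fun p => (τ p).2.2.2 := fun hτ =>
    Primrec.snd.comp (Primrec.snd.comp (Primrec.snd.comp hτ))
  have h1 : Primrec fun p => decide ((τ p).1 = 0) :=
    Primrec.eqB (Primrec.fst.comp hτ) (Primrec.const 0)
  exact Primrec.bor' (Primrec.band' (Primrec.bnot' h1) (Primrec.ltB (h2 hτ) (h2 hσ)))
    (Primrec.band' h1 (Primrec.band' (Primrec.eqB (h2 hτ) (h2 hσ)) (Primrec.bor'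
      (Primrec.ltB (h3 hτ) (h3 hσ)) (Primrec.band' (Primrec.eqB (h3 hτ) (h3 hσ))
        (Primrec.nodeLt' (h4 hτ) (h4 hσ))))))

theorem Primrec.item' {d : α → ℕ} {P : α → Pos ℕ} (i : ℕ) (hd : Primrec d) (hP : Primrec P) :
    Primrec fun p => item (d p) (P p) i :=
  Primrec.getDv (Primrec.snd.comp (Primrec.snd.comp hP)) (Primrec.const i)
    (Primrec.pair (Primrec.const 0) (Primrec.pair hd (Primrec.pair hd (Primrec.const []))))

set_option synthInstance.maxSize 1000 in
theorem Primrec.stepB' {Tr : α → Node ℕ → Bool} {d : α → ℕ} {P P' : α → Pos ℕ}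
    (hT : ∀ {s : α → Node ℕ}, Primrec s → Primrec fun p => Tr p (s p))
    (hd : Primrec d) (hP : Primrec P) (hP' : Primrec P') :
    Primrec fun p => stepB (fun x y => decide (x < y)) (Tr p) (d p) (P p) (P' p) := by
  have tag : ∀ {P : α → Pos ℕ} (_ : Primrec P) (i : ℕ), Primrec fun p => decide ((P p).1 = i) :=
    fun hP i => Primrec.eqB (Primrec.fst.comp hP) (Primrec.const i)
  have h0 := Primrec.item' 0 hd hP
  have h1 := Primrec.item' 1 hd hP
  have h0' := Primrec.item' 0 hd hP'
  have h1' := Primrec.item' 1 hd hP'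
  have he := Primrec.eqB h0' h0
  have hf : Primrec fun p => decide ((item (d p) (P' p) 0).1 = 0) :=
    Primrec.eqB (Primrec.fst.comp h0') (Primrec.const 0)
  have ha := Primrec.adm' (d := d) h0' h0
  have hnode : ∀ {τ : α → Item ℕ}, Primrec τ → Primrec fun p => (τ p).2.2.2 := fun hτ =>
    Primrec.snd.comp (Primrec.snd.comp (Primrec.snd.comp hτ))
  have htl : Primrec fun p => (P p).2.2.tail.any fun τ => decide (τ = item (d p) (P' p) 0) :=
    Primrec.any' (g := fun p τ => decide (τ = item (d p) (P' p) 0))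
      (Primrec.list_tail.comp (Primrec.snd.comp (Primrec.snd.comp hP)))
      (Primrec.eqB Primrec.snd (h0'.comp Primrec.fst))
  have hj : ∀ {P : α → Pos ℕ}, Primrec P → Primrec fun p => (P p).2.1 := fun hP =>
    Primrec.fst.comp (Primrec.snd.comp hP)
  refine Primrec.bor' (Primrec.band' (tag hP 0) (Primrec.band' (tag hP' 1) he)) ?_
  refine Primrec.bor' (Primrec.band' (tag hP 1) (Primrec.band' (tag hP' 2) (Primrec.band' hf
    (Primrec.band' ha htl)))) ?_
  refine Primrec.bor' (Primrec.band' (tag hP 1) (Primrec.band' (tag hP' 3) (Primrec.band'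
    (Primrec.eqB (Primrec.snd.comp (Primrec.snd.comp hP')) (Primrec.snd.comp (Primrec.snd.comp hP)))
    (Primrec.ltB (hj hP) (Primrec.succ.comp (hj hP')))))) ?_
  refine Primrec.bor' (Primrec.band' (tag hP 2) (Primrec.band' (tag hP' 0) he)) ?_
  refine Primrec.bor' (Primrec.band' (tag hP 3) (Primrec.band' (tag hP' 4) (Primrec.band'
    (Primrec.bor' he (Primrec.band' ha htl)) (Primrec.band' ?_ (Primrec.band' ?_
      (hT (hnode h1'))))))) ?_
  · exact Primrec.eqB (Primrec.list_take.comp (Primrec.list_length.comp (hnode h0')) (hnode h1'))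
      (hnode h0')
  · exact Primrec.getD' false (Primrec.list_map (hnode h1') (Primrec.bit'.comp Primrec.snd)) (hj hP)
  · refine Primrec.band' (tag hP 4) (Primrec.band' (tag hP' 0) (Primrec.band' hf (Primrec.band'
      ?_ (Primrec.band' (Primrec.eqB (hnode h0') (hnode h1)) (Primrec.bef' h0 ?_ (hnode h0'))))))
    · exact Primrec.eqB (Primrec.fst.comp (Primrec.snd.comp h0'))
        (Primrec.fst.comp (Primrec.snd.comp h0))
    · exact Primrec.fst.comp (Primrec.snd.comp (Primrec.snd.comp h0'))

theorem Primrec.mapPos' {g : α → ℕ → ℕ} {P : α → Pos ℕ} (hg : Primrec₂ g) (hP : Primrec P) :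
    Primrec fun p => mapPos (g p) (P p) := by
  refine Primrec.pair (Primrec.fst.comp hP) (Primrec.pair (Primrec.fst.comp (Primrec.snd.comp hP))
    (Primrec.list_map (Primrec.snd.comp (Primrec.snd.comp hP)) ?_))
  have hs : Primrec fun q : α × Item ℕ => q.2 := Primrec.snd
  have hg' : ∀ {f : α × Item ℕ → ℕ}, Primrec f → Primrec fun q => g q.1 (f q) := fun hf =>
    hg.comp Primrec.fst hf
  refine Primrec.pair (Primrec.fst.comp hs) (Primrec.pair (hg' (Primrec.fst.comp
    (Primrec.snd.comp hs))) (Primrec.pair (hg' (Primrec.fst.comp (Primrec.snd.comp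
      (Primrec.snd.comp hs)))) (Primrec.list_map (Primrec.snd.comp (Primrec.snd.comp
      (Primrec.snd.comp hs))) ?_)))
  exact Primrec.pair (Primrec.fst.comp Primrec.snd)
    (hg.comp (Primrec.fst.comp Primrec.fst) (Primrec.snd.comp Primrec.snd))

end

/-- The well-ordering of nodes with ordinal labels. -/
def nlt (s t : Node Ordinal.{0}) : Prop := nodeLt oLt 0 s t = true

theorem nlt_iff {s t : Node Ordinal.{0}} : nlt s t ↔
    encode (s.map Prod.fst) < encode (t.map Prod.fst) ∨
      (s.map Prod.fst = t.map Prod.fst ∧ lexB oLt 0 (s.map Prod.snd) (t.map Prod.snd) = true) := by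
  simp [nlt, nodeLt]

theorem eq_of_map_fst_snd {s t : Node Ordinal.{0}} (h1 : s.map Prod.fst = t.map Prod.fst)
    (h2 : s.map Prod.snd = t.map Prod.snd) : s = t := by
  have := congrArg₂ List.zip h1 h2
  rwa [List.zip_map', List.zip_map', List.map_id', List.map_id'] at this

theorem nlt_trichotomous {s t : Node Ordinal.{0}} (h1 : ¬ nlt s t) (h2 : ¬ nlt t s) : s = t := by
  rw [nlt_iff, not_or, not_and, not_lt] at h1 h2
  have he : s.map Prod.fst = t.map Prod.fst := encode_injective (le_antisymm h2.1 h1.1)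
  have hl : (s.map Prod.snd).length = (t.map Prod.snd).length := by
    simpa using congrArg List.length he
  exact eq_of_map_fst_snd he (eq_of_not_lexB hl (Bool.not_eq_true _ ▸ h1.2 he)
    (Bool.not_eq_true _ ▸ h2.2 he.symm))

theorem nlt_wf : WellFounded nlt := by
  rw [WellFounded.wellFounded_iff_has_min]
  intro W ⟨s₀, hs₀⟩
  obtain ⟨s₁, hs₁, hm⟩ := WellFounded.has_min
    (measure fun s : Node Ordinal.{0} => encode (s.map Prod.fst)).wf W ⟨s₀, hs₀⟩
  let W' : Set (List Ordinal.{0}) :=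
    {b | ∃ s ∈ W, s.map Prod.fst = s₁.map Prod.fst ∧ s.map Prod.snd = b}
  obtain ⟨t, ⟨s, hs, he, rfl⟩, ht⟩ := exists_lexB_min s₁.length W' ⟨_, s₁, hs₁, rfl, rfl⟩ (by
    rintro b ⟨s, -, he, rfl⟩
    simpa using congrArg List.length he)
  refine ⟨s, hs, fun u hu hlt => ?_⟩
  rcases nlt_iff.1 hlt with h | ⟨h, hb⟩
  · rw [he] at h
    exact hm u hu h
  · rw [ht _ ⟨u, hu, h.trans he, rfl⟩] at hb
    exact Bool.false_ne_true hb

/-- The lexicographic order on pairs of a pass and a node. -/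
def PLt (γ : Ordinal.{0}) (s : Node Ordinal.{0}) (γ' : Ordinal.{0}) (s' : Node Ordinal.{0}) : Prop :=
  γ < γ' ∨ γ = γ' ∧ nlt s s'

theorem bef_iff {d γ : Ordinal.{0}} {τ : Item Ordinal.{0}} {s : Node Ordinal.{0}} :
    bef oLt d τ γ s = true ↔ τ.1 ≠ 0 ∨ PLt γ s τ.2.2.1 τ.2.2.2 := by
  simp [bef, PLt, nlt, nodeLt_default oLt (d := d) (d' := 0)]

theorem adm_iff {d : Ordinal.{0}} {τ σ : Item Ordinal.{0}} :
    adm oLt d τ σ = true ↔ (τ.1 ≠ 0 ∧ τ.2.1 < σ.2.1) ∨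
      (τ.1 = 0 ∧ τ.2.1 = σ.2.1 ∧ PLt τ.2.2.1 τ.2.2.2 σ.2.2.1 σ.2.2.2) := by
  simp [adm, PLt, nlt, nodeLt_default oLt (d := d) (d' := 0)]

theorem stepB_iff {α : Type*} [DecidableEq α] {lt : α → α → Bool} {Tr : Node α → Bool} {d : α}
    {P P' : Pos α} :
    stepB lt Tr d P P' = true ↔
      (P.1 = 0 ∧ P'.1 = 1 ∧ item d P' 0 = item d P 0) ∨
      (P.1 = 1 ∧ P'.1 = 2 ∧ (item d P' 0).1 = 0 ∧ adm lt d (item d P' 0) (item d P 0) = true ∧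
        item d P' 0 ∈ P.2.2.tail) ∨
      (P.1 = 1 ∧ P'.1 = 3 ∧ P'.2.2 = P.2.2 ∧ P.2.1 ≤ P'.2.1) ∨
      (P.1 = 2 ∧ P'.1 = 0 ∧ item d P' 0 = item d P 0) ∨
      (P.1 = 3 ∧ P'.1 = 4 ∧ (item d P' 0 = item d P 0 ∨
        (adm lt d (item d P' 0) (item d P 0) = true ∧ item d P' 0 ∈ P.2.2.tail)) ∧
        (item d P' 0).2.2.2 <+: (item d P' 1).2.2.2 ∧
        ((item d P' 1).2.2.2.map bit).getD P.2.1 false = true ∧ Tr (item d P' 1).2.2.2 = true) ∨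
      (P.1 = 4 ∧ P'.1 = 0 ∧ (item d P' 0).1 = 0 ∧ (item d P' 0).2.1 = (item d P 0).2.1 ∧
        (item d P' 0).2.2.2 = (item d P 1).2.2.2 ∧
        bef lt d (item d P 0) (item d P' 0).2.2.1 (item d P' 0).2.2.2 = true) := by
  have h1 : ∀ (l : List (Item α)) σ, (l.any fun τ => decide (τ = σ)) = true ↔ σ ∈ l := by
    simp
  have h2 : ∀ s t : Node α, s.take t.length = t ↔ t <+: s := fun s t => by
    rw [List.prefix_iff_eq_take, eq_comm]
  rw [stepB]
  simp only [Bool.or_eq_true, Bool.and_eq_true, decide_eq_true_eq, h1, h2, Nat.lt_succ_iff]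

theorem stepB_mono {Tr Tr' : Node Ordinal.{0} → Bool} {d : Ordinal.{0}} {P P' : Pos Ordinal.{0}}
    (hT : Tr (item d P' 1).2.2.2 = true → Tr' (item d P' 1).2.2.2 = true)
    (h : stepB oLt Tr d P P' = true) : stepB oLt Tr' d P P' = true := by
  rw [stepB_iff] at h ⊢
  exact h.imp_right (Or.imp_right (Or.imp_right (Or.imp_right (Or.imp_left
    fun ⟨h1, h2, h3, h4, h5, h6⟩ => ⟨h1, h2, h3, h4, h5, hT h6⟩))))

/-- The rank of a tag in the termination order. -/
def tagRank (t : ℕ) : ℕ := if t = 2 then 4 else if t = 0 then 3 else if t = 1 then 2 else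
  if t = 3 then 1 else 0

theorem step_wf (Tr : Node Ordinal.{0} → Bool) (d : Ordinal.{0}) :
    WellFounded fun P' P : Pos Ordinal.{0} => stepB oLt Tr d P P' = true := by
  let m : Pos Ordinal.{0} → Ordinal.{0} × ℕ × Ordinal.{0} × Node Ordinal.{0} × ℕ := fun P =>
    ((item d P 0).2.1, (item d P 0).1, (item d P 0).2.2.1, (item d P 0).2.2.2, tagRank P.1)
  let r := Prod.Lex (fun x y : Ordinal.{0} => x < y) (Prod.Lex (fun x y : ℕ => x < y)
    (Prod.Lex (fun x y : Ordinal.{0} => x < y) (Prod.Lex nlt (fun x y : ℕ => x < y))))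
  have hr : WellFounded r := wellFounded_lt.prod_lex (wellFounded_lt.prod_lex
    (wellFounded_lt.prod_lex (nlt_wf.prod_lex wellFounded_lt)))
  refine Subrelation.wf (r := InvImage r m) ?_ (InvImage.wf m hr)
  intro P' P h
  have key1 : item d P' 0 = item d P 0 → tagRank P'.1 < tagRank P.1 → r (m P') (m P) := by
    intro h1 h2
    simp only [r, m, h1, Prod.lex_def, lt_irrefl, true_and, false_or]
    exact Or.inr h2
  have key2 : (item d P' 0).2.1 = (item d P 0).2.1 → (item d P' 0).1 = 0 →
      ((item d P 0).1 ≠ 0 ∨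
        PLt (item d P' 0).2.2.1 (item d P' 0).2.2.2 (item d P 0).2.2.1 (item d P 0).2.2.2) →
      r (m P') (m P) := by
    intro h1 h2 h3
    simp only [r, m, h1, Prod.lex_def, lt_irrefl, true_and, false_or, h2]
    unfold PLt at h3
    rcases Nat.eq_zero_or_pos (item d P 0).1 with h0 | h0
    · rw [h0]
      refine Or.inr ⟨rfl, ?_⟩
      rcases h3 with h3 | h3 | h3
      · exact absurd h0 h3
      · exact Or.inl h3
      · exact Or.inr ⟨h3.1, Or.inl h3.2⟩
    · exact Or.inl h0
  have key3 : adm oLt d (item d P' 0) (item d P 0) = true → r (m P') (m P) := by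
    intro h1
    rcases adm_iff.1 h1 with ⟨-, h1⟩ | ⟨h1, h2, h3⟩
    · exact Prod.Lex.left _ _ h1
    · exact key2 h2 h1 (Or.inr h3)
  rcases stepB_iff.1 h with ⟨h1, h2, h3⟩ | ⟨h1, h2, h3, h4, -⟩ | ⟨h1, h2, h3, -⟩ | ⟨h1, h2, h3⟩ |
    ⟨h1, h2, h3, -⟩ | ⟨h1, h2, h3, h4, -, h5⟩
  · exact key1 h3 (by simp [h1, h2, tagRank])
  · exact key3 h4
  · exact key1 (by simp [item, h3]) (by simp [h1, h2, tagRank])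
  · exact key1 h3 (by simp [h1, h2, tagRank])
  · rcases h3 with h3 | ⟨h3, -⟩
    · exact key1 h3 (by simp [h1, h2, tagRank])
    · exact key3 h3
  · exact key2 h4 h3 (bef_iff.1 h5)

/-- The labels occurring in a position. -/
def labels {α : Type*} (P : Pos α) : List α :=
  P.2.2.flatMap fun σ => σ.2.1 :: σ.2.2.1 :: σ.2.2.2.map Prod.snd

theorem labels_mapPos {α β : Type*} (g : α → β) (P : Pos α) :
    labels (mapPos g P) = (labels P).map g := by
  simp [labels, mapPos, mapItem, mapNode, List.flatMap_map, List.map_flatMap, Function.comp_def]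

theorem mapPos_eq_self {α : Type*} {g : α → α} {P : Pos α} (h : ∀ x ∈ labels P, g x = x) :
    mapPos g P = P := by
  obtain ⟨t, j, l⟩ := P
  simp only [labels, List.mem_flatMap, List.mem_cons, List.mem_map, forall_exists_index, and_imp]
    at h
  simp only [mapPos, Prod.mk.injEq, true_and]
  refine (List.map_congr_left (g := id) fun σ hσ => ?_).trans (List.map_id _)
  obtain ⟨f, ξ, γ, s⟩ := σ
  simp only [mapItem, mapNode, id, Prod.mk.injEq, true_and]
  refine ⟨h _ _ hσ (Or.inl rfl), h _ _ hσ (Or.inr (Or.inl rfl)), ?_⟩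
  refine (List.map_congr_left (g := id) fun e he => ?_).trans (List.map_id _)
  exact Prod.ext rfl (h _ _ hσ (Or.inr (Or.inr ⟨e, he, rfl⟩)))

section
variable {R : List Bool × List ℕ × List ℕ × List ℕ → Bool} {a : ℕ → ℕ}

/-- The moves of the abstract game. -/
def Step (R : List Bool × List ℕ × List ℕ × List ℕ → Bool) (a : ℕ → ℕ) (κ : Ordinal.{0})
    (P P' : Pos Ordinal.{0}) : Prop :=
  stepB oLt (fun s => treeB oLt R (pre a s.length) κ s) κ P P' = true

/-- The positions won by the player to move in the abstract game on ordinals below `θ`. -/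
def Vw (R : List Bool × List ℕ × List ℕ × List ℕ → Bool) (a : ℕ → ℕ) (κ θ : Ordinal.{0}) :
    Pos Ordinal.{0} → Prop :=
  (step_wf (fun s => treeB oLt R (pre a s.length) κ s) κ).fix fun P ih =>
    ∃ P', ∃ h : Step R a κ P P', (∀ x ∈ labels P', x < θ) ∧ ¬ ih P' h

theorem Vw_iff {κ θ : Ordinal.{0}} {P : Pos Ordinal.{0}} : Vw R a κ θ P ↔
    ∃ P', Step R a κ P P' ∧ (∀ x ∈ labels P', x < θ) ∧ ¬ Vw R a κ θ P' := by
  unfold Vw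
  rw [WellFounded.fix_eq]
  constructor
  · rintro ⟨P', h, h1, h2⟩
    exact ⟨P', h, h1, h2⟩
  · rintro ⟨P', h, h1, h2⟩
    exact ⟨P', h, h1, h2⟩

end

/-- Look up an index in a stack; out of range indices refer to the bottom of the stack. -/
def look {α : Type*} [Inhabited α] (L : List α) (i : ℕ) : α := L.getD i (L.headD default)

theorem look_mem {α : Type*} [Inhabited α] {L : List α} (hL : L ≠ []) (i : ℕ) : look L i ∈ L := by
  unfold look
  by_cases h : i < L.length
  · rw [List.getD_eq_getElem _ _ h]; simp
  · rw [List.getD_eq_default _ _ (not_lt.1 h)]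
    cases L with
    | nil => exact absurd rfl hL
    | cons x l => simp

theorem look_map {α β : Type*} [Inhabited α] [Inhabited β] (f : α → β) {L : List α} (hL : L ≠ [])
    (i : ℕ) : look (L.map f) i = f (look L i) := by
  cases L with
  | nil => exact absurd rfl hL
  | cons x l =>
    simp only [look, List.map_cons, List.headD_cons]
    rw [← List.map_cons]
    simp only [List.getD_eq_getElem?_getD, List.getElem?_map]
    cases (x :: l)[i]? <;> rfl

theorem look_zero {α : Type*} [Inhabited α] (L : List α) : look L 0 = L.headD default := by
  cases L <;> simp [look]

theorem look_idxOf {α : Type*} [Inhabited α] [DecidableEq α] {L : List α} {x : α} (h : x ∈ L) :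
    look L (L.idxOf x) = x := by
  have := List.idxOf_lt_length_iff.2 h
  rw [look, List.getD_eq_getElem _ _ this]
  simp

/-- Replace an out of range index by `0`. -/
def clip (m i : ℕ) : ℕ := if i < m then i else 0

theorem look_clip {α : Type*} [Inhabited α] {l : List α} (hl : l ≠ []) (b : List α) (i : ℕ) :
    look (l ++ b) (clip l.length i) = look l i := by
  unfold clip
  split_ifs with h
  · rw [look, look, List.getD_append _ _ _ _ h, List.getD_eq_getElem _ _ h,
      List.getD_eq_getElem _ _ h]
  · rw [look_zero, look, List.getD_eq_default _ _ (not_lt.1 h)]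
    cases l with
    | nil => exact absurd rfl hl
    | cons x l => simp

theorem pat_lt_iff {L : List Ordinal.{0}} {x y : Ordinal.{0}} (hx : x ∈ L) :
    (L.filter fun z => oLt z x).length < (L.filter fun z => oLt z y).length ↔ x < y := by
  have mono : ∀ {x y : Ordinal.{0}}, x ≤ y →
      (L.filter fun z => oLt z x).Sublist (L.filter fun z => oLt z y) := by
    intro x y h
    apply List.monotone_filter_right
    intro z hz
    rw [oLt_iff] at hz ⊢
    exact hz.trans_le h
  constructor
  · intro h
    by_contra hn
    exact absurd (mono (not_lt.1 hn)).length_le (not_le.2 h)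
  · intro h
    refine lt_of_le_of_ne (mono h.le).length_le fun he => ?_
    have := (mono h.le).eq_of_length he
    have hm : x ∈ L.filter fun z => oLt z y := by simp [hx, h]
    rw [← this] at hm
    simp at hm

/-- The number of ordinals pushed on the stack by a move to a code. -/
def nuC (c : ℕ) : ℕ := c.unpair.1

/-- The position on indices coded by a number. -/
def posC (c : ℕ) : Pos ℕ := Denumerable.ofNat (Pos ℕ) c.unpair.2

/-- The primitive recursive move relation of the ordinal game. -/
def stC (R : List Bool × List ℕ × List ℕ × List ℕ → Bool) (q : List ℕ × ℕ × ℕ × List ℕ) : Bool :=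
  decide (nuC q.2.2.1 < q.2.2.2.length) &&
    stepB (fun x y => decide (x < y))
      (fun s => treeB (fun x y => decide (x < y)) R q.1 (look q.2.2.2 0) s) (look q.2.2.2 0)
      (mapPos (look q.2.2.2) (mapPos (clip (q.2.2.2.length - nuC q.2.2.1)) (posC q.2.1)))
      (mapPos (look q.2.2.2) (posC q.2.2.1))

theorem primrec_nuC : Primrec nuC := Primrec.fst.comp Primrec.unpair

theorem primrec_posC : Primrec posC :=
  (Primrec.ofNat (Pos ℕ)).comp (Primrec.snd.comp Primrec.unpair)

theorem primrec_stC {R : List Bool × List ℕ × List ℕ × List ℕ → Bool} (hR : Primrec R) :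
    Primrec (stC R) := by
  have hr : Primrec fun q : List ℕ × ℕ × ℕ × List ℕ => q.2.2.2 :=
    Primrec.snd.comp (Primrec.snd.comp Primrec.snd)
  have hc' : Primrec fun q : List ℕ × ℕ × ℕ × List ℕ => q.2.2.1 :=
    Primrec.fst.comp (Primrec.snd.comp Primrec.snd)
  have hc : Primrec fun q : List ℕ × ℕ × ℕ × List ℕ => q.2.1 := Primrec.fst.comp Primrec.snd
  have hlook : Primrec₂ fun (q : List ℕ × ℕ × ℕ × List ℕ) (i : ℕ) => look q.2.2.2 i := by
    have hr' : Primrec fun q : (List ℕ × ℕ × ℕ × List ℕ) × ℕ => q.1.2.2.2 := hr.comp Primrec.fst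
    refine (Primrec.getDv hr' Primrec.snd (Primrec.getD' 0 hr' (Primrec.const 0))).of_eq ?_
    rintro ⟨⟨_, _, _, r⟩, i⟩
    cases r <;> simp [look]
  have h0 : Primrec fun q : List ℕ × ℕ × ℕ × List ℕ => look q.2.2.2 0 :=
    hlook.comp Primrec.id (Primrec.const 0)
  have hn := primrec_nuC.comp hc'
  refine Primrec.band' (Primrec.ltB hn (Primrec.list_length.comp hr)) (Primrec.stepB'
    (fun hs => Primrec.treeB' hR Primrec.fst h0 hs) h0 (Primrec.mapPos' hlook (Primrec.mapPos' ?_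
      (primrec_posC.comp hc))) (Primrec.mapPos' hlook (primrec_posC.comp hc')))
  have hm : Primrec fun q : (List ℕ × ℕ × ℕ × List ℕ) × ℕ => q.1.2.2.2.length - nuC q.1.2.2.1 :=
    Primrec.nat_sub.comp (Primrec.list_length.comp (hr.comp Primrec.fst)) (hn.comp Primrec.fst)
  exact Primrec.ite (Primrec.nat_lt.comp Primrec.snd hm) Primrec.snd (Primrec.const 0)

section
variable {R : List Bool × List ℕ × List ℕ × List ℕ → Bool} {a : ℕ → ℕ}

theorem stC_iff {c c' : ℕ} {l b : List Ordinal.{0}} (hb : b.length = nuC c') :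
    stC R (pre a (nuC c'), c, c', pat oLt (l ++ b)) = true ↔ l ≠ [] ∧
      stepB oLt (fun s => treeB oLt R (pre a (nuC c')) (look l 0) s) (look l 0)
        (mapPos (look l) (posC c)) (mapPos (look (l ++ b)) (posC c')) = true := by
  simp only [stC, Bool.and_eq_true, decide_eq_true_eq, length_pat, List.length_append, hb]
  have hpos : nuC c' < l.length + nuC c' ↔ l ≠ [] := by rw [← List.length_pos_iff]; omega
  rw [hpos]
  refine and_congr_right fun hl => ?_
  have hlb : l ++ b ≠ [] := by simp [hl]
  have hp : ∀ i, look (pat oLt (l ++ b)) i =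
      ((l ++ b).filter fun z => oLt z (look (l ++ b) i)).length := fun i => look_map _ hlb i
  have hlt : ∀ i j, decide (look (pat oLt (l ++ b)) i < look (pat oLt (l ++ b)) j) =
      oLt (look (l ++ b) i) (look (l ++ b) j) := by
    intro i j
    rw [hp, hp, Bool.eq_iff_iff, decide_eq_true_eq, pat_lt_iff (look_mem hlb i), oLt_iff]
  have heq : ∀ i j, look (pat oLt (l ++ b)) i = look (pat oLt (l ++ b)) j ↔
      look (l ++ b) i = look (l ++ b) j := by
    intro i j
    have h1 := hlt i j
    have h2 := hlt j i
    simp only [oLt, decide_eq_decide] at h1 h2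
    rw [le_antisymm_iff, le_antisymm_iff, ← not_lt, ← not_lt, h1, h2, not_lt, not_lt]
  have hc : (fun i => look (l ++ b) (clip l.length i)) = look l := funext (look_clip hl b)
  have h0 : look (l ++ b) 0 = look l 0 := by
    have := look_clip hl b 0
    rwa [clip, if_pos (List.length_pos_iff.2 hl)] at this
  rw [stepB_congr (g := look (pat oLt (l ++ b))) (g' := look (l ++ b)) hlt heq
    (Tr' := fun s => treeB oLt R (pre a (nuC c')) (look (l ++ b) 0) s) ?_ 0, mapPos_comp,
    Nat.add_sub_cancel, hc, h0]
  intro s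
  rw [treeB_map, treeB_map]
  simp only [hlt]

theorem labels_mapPos_look {L : List Ordinal.{0}} (hL : L ≠ []) {P : Pos ℕ} {x : Ordinal.{0}}
    (hx : x ∈ labels (mapPos (look L) P)) : x ∈ L := by
  rw [labels_mapPos, List.mem_map] at hx
  obtain ⟨i, -, rfl⟩ := hx
  exact look_mem hL i

theorem step_of_mv {c c' : ℕ} {l b : List Ordinal.{0}} (hb : b.length = nuC c')
    (h : stC R (pre a (nuC c'), c, c', pat oLt (l ++ b)) = true) :
    l ≠ [] ∧ Step R a (look l 0) (mapPos (look l) (posC c)) (mapPos (look (l ++ b)) (posC c')) := by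
  obtain ⟨hl, h⟩ := (stC_iff hb).1 h
  exact ⟨hl, stepB_mono (fun h => (treeB_iff_tree.1 h).2) h⟩

theorem look_append_zero {α : Type*} [Inhabited α] {l : List α} (hl : l ≠ []) (b : List α) :
    look (l ++ b) 0 = look l 0 := by
  cases l with
  | nil => exact absurd rfl hl
  | cons x l => simp [look]

theorem mv_wf : WellFounded (Mv nuC (stC R) a) := by
  rw [wellFounded_iff_isEmpty_descending_chain]
  refine ⟨fun ⟨z, hz⟩ => ?_⟩
  choose b hb1 hb2 hb3 using hz
  have h : ∀ n, (z n).2 ≠ [] ∧ Step R a (look (z n).2 0) (mapPos (look (z n).2) (posC (z n).1))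
      (mapPos (look (z (n + 1)).2) (posC (z (n + 1)).1)) := by
    intro n
    have := hb3 n
    rw [hb1 n] at this
    rw [hb1 n]
    exact step_of_mv (hb2 n) this
  have hκ : ∀ n, look (z n).2 0 = look (z 0).2 0 := by
    intro n
    induction n with
    | zero => rfl
    | succ n ih => rw [hb1, look_append_zero (h n).1, ih]
  have hw := step_wf (fun s => treeB oLt R (pre a s.length) (look (z 0).2 0) s) (look (z 0).2 0)
  rw [wellFounded_iff_isEmpty_descending_chain] at hw
  refine hw.elim ⟨fun n => mapPos (look (z n).2) (posC (z n).1), fun n => ?_⟩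
  have := (h n).2
  rw [hκ] at this
  exact this

theorem Wn_iff_Vw {κ θ : Ordinal.{0}} (p : ℕ × List Ordinal.{0}) (hp : p.2 ≠ [])
    (hκ : look p.2 0 = κ) (hθ : ∀ x ∈ p.2, x < θ) :
    Wn (mv_wf (R := R) (a := a)) θ p ↔ Vw R a κ θ (mapPos (look p.2) (posC p.1)) := by
  induction p using (mv_wf (R := R) (a := a)).induction with
  | _ p ih =>
  obtain ⟨c, l⟩ := p
  subst hκ
  rw [Wn_iff, Vw_iff]
  constructor
  · rintro ⟨c', b, hlen, hlt, hst, hnw⟩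
    have hlb : l ++ b ≠ [] := by simpa using fun h => absurd h hp
    refine ⟨_, (step_of_mv hlen hst).2, fun x hx => hlt x (labels_mapPos_look hlb hx), ?_⟩
    rwa [← ih (c', l ++ b) ⟨b, rfl, hlen, hst⟩ hlb (look_append_zero hp b) hlt]
  · rintro ⟨P', hst, hlt, hnv⟩
    dsimp only at *
    set s := (item (look l 0) P' 1).2.2.2 with hs
    set b := labels P' ++ List.replicate s.length (look l 0) with hbdef
    set L := l ++ b with hL
    have hLlt : ∀ x ∈ L, x < θ := by
      intro x hx
      simp only [hL, hbdef, List.mem_append, List.mem_replicate] at hx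
      rcases hx with hx | hx | ⟨-, rfl⟩
      · exact hθ x hx
      · exact hlt x hx
      · exact hθ _ (look_mem hp 0)
    have hLne : L ≠ [] := by simpa [hL] using fun h => absurd h hp
    set c' := Nat.pair b.length (encode (mapPos L.idxOf P')) with hc'
    have hnu : nuC c' = b.length := by simp [nuC, hc']
    have hP : mapPos (look L) (posC c') = P' := by
      simp only [posC, hc', Nat.unpair_pair, Denumerable.ofNat_encode, mapPos_comp]
      refine mapPos_eq_self fun x hx => look_idxOf ?_
      simp [hL, hbdef, hx]
    have hst' : stC R (pre a (nuC c'), c, c', pat oLt (l ++ b)) = true := by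
      rw [stC_iff hnu.symm, ← hL, hP]
      refine ⟨hp, stepB_mono (fun h => ?_) hst⟩
      rw [hnu]
      refine treeB_iff_tree.2 ⟨?_, h⟩
      simp [hbdef, hs]
    refine ⟨c', b, hnu.symm, hLlt, hst', ?_⟩
    rwa [ih (c', l ++ b) ⟨b, rfl, hnu.symm, hst'⟩ hLne (look_append_zero hp b) hLlt, ← hL, hP]

end

/-- All ordinals occurring in an item are below `θ`. -/
def IBd (θ : Ordinal.{0}) (σ : Item Ordinal.{0}) : Prop :=
  σ.2.1 < θ ∧ σ.2.2.1 < θ ∧ ∀ e ∈ σ.2.2.2, e.2 < θ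

theorem labels_lt_iff {θ : Ordinal.{0}} {P : Pos Ordinal.{0}} :
    (∀ x ∈ labels P, x < θ) ↔ ∀ σ ∈ P.2.2, IBd θ σ := by
  simp only [labels, List.mem_flatMap, IBd]
  constructor
  · intro h σ hσ
    exact ⟨h _ ⟨σ, hσ, by simp⟩, h _ ⟨σ, hσ, by simp⟩,
      fun e he => h _ ⟨σ, hσ, by simp only [List.mem_cons, List.mem_map]; exact .inr (.inr ⟨e, he, rfl⟩)⟩⟩
  · rintro h x ⟨σ, hσ, hx⟩
    simp only [List.mem_cons, List.mem_map] at hx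
    obtain ⟨h1, h2, h3⟩ := h σ hσ
    rcases hx with rfl | rfl | ⟨e, he, rfl⟩
    exacts [h1, h2, h3 e he]

theorem IBd_item {κ θ : Ordinal.{0}} (hκ : κ < θ) {P : Pos Ordinal.{0}}
    (h : ∀ σ ∈ P.2.2, IBd θ σ) (i : ℕ) : IBd θ (item κ P i) := by
  unfold item
  by_cases hi : i < P.2.2.length
  · rw [List.getD_eq_getElem _ _ hi]
    exact h _ (List.getElem_mem _)
  · rw [List.getD_eq_default _ _ (not_lt.1 hi)]
    exact ⟨hκ, hκ, by simp⟩

section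
variable (R : List Bool × List ℕ × List ℕ × List ℕ → Bool) (a : ℕ → ℕ) (κ θ : Ordinal.{0})

/-- The item `σ` survives its stage of the derivative. -/
def Bad (σ : Item Ordinal.{0}) : Prop := Vw R a κ θ (0, 0, [σ])

/-- The set of naturals whose bit is set by an extension of the node of `τ` present at `τ`. -/
def GSet (τ : Item Ordinal.{0}) : Set ℕ :=
  {j | ∃ s : Node Ordinal.{0}, τ.2.2.2 <+: s ∧ (s.map bit).getD j false = true ∧ STree R a κ s ∧
    ∀ γ < θ, bef oLt κ τ γ s = true → Bad R a κ θ (0, τ.2.1, γ, s)}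

variable {R a κ θ}

theorem step_zero {P P' : Pos Ordinal.{0}} (h : P.1 = 0) :
    Step R a κ P P' ↔ P'.1 = 1 ∧ item κ P' 0 = item κ P 0 := by
  rw [Step, stepB_iff]; simp [h]

theorem step_one {P P' : Pos Ordinal.{0}} (h : P.1 = 1) :
    Step R a κ P P' ↔ (P'.1 = 2 ∧ (item κ P' 0).1 = 0 ∧
      adm oLt κ (item κ P' 0) (item κ P 0) = true ∧ item κ P' 0 ∈ P.2.2.tail) ∨
      (P'.1 = 3 ∧ P'.2.2 = P.2.2 ∧ P.2.1 ≤ P'.2.1) := by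
  rw [Step, stepB_iff]; simp only [h]; simp

theorem step_two {P P' : Pos Ordinal.{0}} (h : P.1 = 2) :
    Step R a κ P P' ↔ P'.1 = 0 ∧ item κ P' 0 = item κ P 0 := by
  rw [Step, stepB_iff]; simp [h]

theorem step_three {P P' : Pos Ordinal.{0}} (h : P.1 = 3) :
    Step R a κ P P' ↔ P'.1 = 4 ∧ (item κ P' 0 = item κ P 0 ∨
        (adm oLt κ (item κ P' 0) (item κ P 0) = true ∧ item κ P' 0 ∈ P.2.2.tail)) ∧
        (item κ P' 0).2.2.2 <+: (item κ P' 1).2.2.2 ∧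
        ((item κ P' 1).2.2.2.map bit).getD P.2.1 false = true ∧
        STree R a κ (item κ P' 1).2.2.2 := by
  rw [Step, stepB_iff]; simp only [h, STree]; simp

theorem step_four {P P' : Pos Ordinal.{0}} (h : P.1 = 4) :
    Step R a κ P P' ↔ P'.1 = 0 ∧ (item κ P' 0).1 = 0 ∧ (item κ P' 0).2.1 = (item κ P 0).2.1 ∧
        (item κ P' 0).2.2.2 = (item κ P 1).2.2.2 ∧
        bef oLt κ (item κ P 0) (item κ P' 0).2.2.1 (item κ P' 0).2.2.2 = true := by
  rw [Step, stepB_iff]; simp [h]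

theorem Vw_zero {P : Pos Ordinal.{0}} (h : P.1 = 0) :
    Vw R a κ θ P ↔ Bad R a κ θ (item κ P 0) := by
  rw [Bad, Vw_iff, Vw_iff]
  simp only [step_zero h, step_zero (P := (0, 0, [item κ P 0])) rfl]
  rfl

theorem Vw_two (hκ : κ < θ) {P : Pos Ordinal.{0}} (h : P.1 = 2) (hb : ∀ σ ∈ P.2.2, IBd θ σ) :
    Vw R a κ θ P ↔ ¬ Bad R a κ θ (item κ P 0) := by
  rw [Vw_iff]
  simp only [step_two h]
  constructor
  · rintro ⟨P', ⟨h1, h2⟩, -, h3⟩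
    rwa [Vw_zero h1, h2] at h3
  · intro hB
    refine ⟨(0, 0, [item κ P 0]), ⟨rfl, rfl⟩, ?_, hB⟩
    rw [labels_lt_iff]
    simpa using IBd_item hκ hb 0

theorem Vw_four (hκ : κ < θ) {P : Pos Ordinal.{0}} (h : P.1 = 4) (hb : ∀ σ ∈ P.2.2, IBd θ σ) :
    Vw R a κ θ P ↔ ∃ γ < θ, bef oLt κ (item κ P 0) γ (item κ P 1).2.2.2 = true ∧
      ¬ Bad R a κ θ (0, (item κ P 0).2.1, γ, (item κ P 1).2.2.2) := by
  rw [Vw_iff]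
  simp only [step_four h]
  constructor
  · rintro ⟨P', ⟨h1, h2, h3, h4, h5⟩, h6, h7⟩
    refine ⟨(item κ P' 0).2.2.1, (IBd_item hκ (labels_lt_iff.1 h6) 0).2.1, ?_, ?_⟩
    · rwa [← h4]
    · rw [Vw_zero h1] at h7
      rw [← h3, ← h4]
      have he : (0, (item κ P' 0).2.1, (item κ P' 0).2.2.1, (item κ P' 0).2.2.2) = item κ P' 0 :=
        Prod.ext h2.symm rfl
      rwa [he]
  · rintro ⟨γ, hγ, h1, h2⟩
    refine ⟨(0, 0, [(0, (item κ P 0).2.1, γ, (item κ P 1).2.2.2)]), ⟨rfl, rfl, rfl, rfl, h1⟩, ?_, h2⟩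
    rw [labels_lt_iff]
    simpa using ⟨(IBd_item hκ hb 0).1, hγ, (IBd_item hκ hb 1).2.2⟩

theorem Vw_three (hκ : κ < θ) {P : Pos Ordinal.{0}} (h : P.1 = 3) (hb : ∀ σ ∈ P.2.2, IBd θ σ) :
    Vw R a κ θ P ↔ P.2.1 ∈ GSet R a κ θ (item κ P 0) ∨ ∃ τ ∈ P.2.2.tail,
      adm oLt κ τ (item κ P 0) = true ∧ P.2.1 ∈ GSet R a κ θ τ := by
  have key : Vw R a κ θ P ↔ ∃ τ, (τ = item κ P 0 ∨ (adm oLt κ τ (item κ P 0) = true ∧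
      τ ∈ P.2.2.tail)) ∧ P.2.1 ∈ GSet R a κ θ τ := by
    rw [Vw_iff]
    simp only [step_three h]
    constructor
    · rintro ⟨P', ⟨h1, h2, h3, h4, h5⟩, h6, h7⟩
      refine ⟨_, h2, _, h3, h4, h5, ?_⟩
      rw [Vw_four hκ h1 (labels_lt_iff.1 h6)] at h7
      push Not at h7
      exact h7
    · rintro ⟨τ, h2, s, h3, h4, h5, h6⟩
      have hs : IBd θ (0, κ, κ, s) := ⟨hκ, hκ, fun e he => ((tree_iff.1 h5).1 e he).trans hκ⟩
      have hτ : IBd θ τ := by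
        rcases h2 with rfl | h2
        · exact IBd_item hκ hb 0
        · exact hb _ (List.mem_of_mem_tail h2.2)
      have hb' : ∀ σ ∈ [τ, (0, κ, κ, s)], IBd θ σ := by
        intro σ hσ
        simp only [List.mem_cons, List.not_mem_nil, or_false] at hσ
        rcases hσ with rfl | rfl
        exacts [hτ, hs]
      refine ⟨(4, 0, [τ, (0, κ, κ, s)]), ⟨rfl, h2, h3, h4, h5⟩, labels_lt_iff.2 hb', ?_⟩
      rw [Vw_four hκ rfl hb']
      push Not
      exact h6
  rw [key]
  constructor
  · rintro ⟨τ, rfl | ⟨h1, h2⟩, h3⟩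
    · exact Or.inl h3
    · exact Or.inr ⟨τ, h2, h1, h3⟩
  · rintro (h1 | ⟨τ, h1, h2, h3⟩)
    · exact ⟨_, Or.inl rfl, h1⟩
    · exact ⟨τ, Or.inr ⟨h2, h1⟩, h3⟩

theorem not_Vw_one (hκ : κ < θ) {P : Pos Ordinal.{0}} (h : P.1 = 1) (hb : ∀ σ ∈ P.2.2, IBd θ σ) :
    ¬ Vw R a κ θ P ↔ (∀ τ ∈ P.2.2.tail, τ.1 = 0 → adm oLt κ τ (item κ P 0) = true →
        ¬ Bad R a κ θ τ) ∧ ∀ j ≥ P.2.1, j ∈ GSet R a κ θ (item κ P 0) ∨ ∃ τ ∈ P.2.2.tail,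
      adm oLt κ τ (item κ P 0) = true ∧ j ∈ GSet R a κ θ τ := by
  rw [Vw_iff]
  simp only [step_one h]
  constructor
  · intro hn
    push Not at hn
    constructor
    · intro τ hτ h0 ha
      have hb' : ∀ σ ∈ [τ], IBd θ σ := by
        simpa using hb _ (List.mem_of_mem_tail hτ)
      have := hn (2, 0, [τ]) (Or.inl ⟨rfl, h0, ha, hτ⟩) (labels_lt_iff.2 hb')
      rwa [Vw_two hκ rfl hb'] at this
    · intro j hj
      have := hn (3, j, P.2.2) (Or.inr ⟨rfl, rfl, hj⟩) (labels_lt_iff.2 hb)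
      exact (Vw_three (P := (3, j, P.2.2)) hκ rfl hb).1 this
  · rintro ⟨h1, h2⟩ ⟨P', ⟨h3, h4, h5, h6⟩ | ⟨h3, h4, h5⟩, h7, h8⟩
    · rw [Vw_two hκ h3 (labels_lt_iff.1 h7)] at h8
      exact h8 (h1 _ h6 h4 h5)
    · apply h8
      rw [Vw_three hκ h3 (labels_lt_iff.1 h7)]
      have : item κ P' 0 = item κ P 0 := by simp [item, h4]
      rw [this, h4]
      exact h2 _ h5

theorem Bad_iff (hκ : κ < θ) {σ : Item Ordinal.{0}} (hσ : IBd θ σ) : Bad R a κ θ σ ↔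
    ∃ (m : ℕ) (T : List (Item Ordinal.{0})), (∀ τ ∈ T, IBd θ τ) ∧
      (∀ τ ∈ T, τ.1 = 0 → adm oLt κ τ σ = true → ¬ Bad R a κ θ τ) ∧
      ∀ j ≥ m, j ∈ GSet R a κ θ σ ∨ ∃ τ ∈ T, adm oLt κ τ σ = true ∧ j ∈ GSet R a κ θ τ := by
  rw [Bad, Vw_iff]
  simp only [step_zero (P := (0, 0, [σ])) rfl]
  constructor
  · rintro ⟨P', ⟨h1, h2⟩, h3, h4⟩
    have h2 : item κ P' 0 = σ := h2
    rw [not_Vw_one hκ h1 (labels_lt_iff.1 h3), h2] at h4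
    exact ⟨P'.2.1, P'.2.2.tail, fun τ hτ => labels_lt_iff.1 h3 _ (List.mem_of_mem_tail hτ), h4⟩
  · rintro ⟨m, T, h1, h2, h3⟩
    have hb : ∀ τ ∈ σ :: T, IBd θ τ := by simpa using ⟨hσ, fun a b c d => h1 (a, b, c, d)⟩
    refine ⟨(1, m, σ :: T), ⟨rfl, rfl⟩, labels_lt_iff.2 hb, ?_⟩
    rw [not_Vw_one hκ rfl hb]
    exact ⟨h2, h3⟩

theorem map_look_zipIdx (L : List Ordinal.{0}) (s : Node Ordinal.{0}) :
    mapNode (look (L ++ s.map Prod.snd)) ((s.map Prod.fst).zipIdx L.length) = s := by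
  apply List.ext_getElem
  · simp [mapNode]
  · intro i h1 h2
    simp [mapNode, look, h2]

theorem countable_GSet (hR : Primrec R) (hsmall : Aleph1OfLaCountable a) (hκ : κ < θ) :
    {S | ∃ τ, IBd θ τ ∧ S = GSet R a κ θ τ}.Countable := by
  let c : ℕ × List ℕ → ℕ → ℕ := fun q j =>
    Nat.pair 0 (encode ((3, j, [(q.1, 1, 2, q.2.zipIdx 3)]) : Pos ℕ))
  refine (Set.countable_iUnion fun q : ℕ × List ℕ => countable_Wn_sets primrec_nuC (primrec_stC hR)
    hsmall mv_wf ((zero_le (a := κ)).trans_lt hκ) (3 + q.2.length) (c q)).mono ?_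
  rintro S ⟨τ, hτ, rfl⟩
  obtain ⟨f, ξ, γ, s⟩ := τ
  refine Set.mem_iUnion.2 ⟨(f, s.map Prod.fst), [κ, ξ, γ] ++ s.map Prod.snd, by simp; omega, ?_, ?_⟩
  · intro x hx
    simp only [List.cons_append, List.nil_append, List.mem_cons, List.mem_map] at hx
    rcases hx with rfl | rfl | rfl | ⟨e, he, rfl⟩
    exacts [hκ, hτ.1, hτ.2.1, hτ.2.2 e he]
  · ext j
    rw [Set.mem_ofPred_eq, Wn_iff_Vw (κ := κ) _ (by simp) (by simp [look])]
    · have h1 : mapPos (look ([κ, ξ, γ] ++ s.map Prod.snd)) (posC (c (f, s.map Prod.fst) j)) =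
          (3, j, [(f, ξ, γ, s)]) := by
        simp only [posC, c, Nat.unpair_pair, Denumerable.ofNat_encode, mapPos, mapItem,
          List.map_cons, List.map_nil]
        rw [show (3 : ℕ) = [κ, ξ, γ].length from rfl, map_look_zipIdx]
        simp [look]
      rw [h1, Vw_three hκ rfl (by simpa using hτ)]
      simp [item]
    · intro x hx
      simp only [List.cons_append, List.nil_append, List.mem_cons, List.mem_map] at hx
      rcases hx with rfl | rfl | rfl | ⟨e, he, rfl⟩
      exacts [hκ, hτ.1, hτ.2.1, hτ.2.2 e he]

end

section
variable (R : List Bool × List ℕ × List ℕ × List ℕ → Bool) (a : ℕ → ℕ) (κ θ : Ordinal.{0})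

/-- The kernel of the `ξ`-th derivative. -/
def Ker (ξ : Ordinal.{0}) : Set (Node Ordinal.{0}) :=
  {s | STree R a κ s ∧ ∀ γ < θ, Bad R a κ θ (0, ξ, γ, s)}

/-- The naturals whose bit is set by an extension of `s` in the kernel. -/
def HSet (ξ : Ordinal.{0}) (s : Node Ordinal.{0}) : Set ℕ :=
  {j | ∃ t ∈ Ker R a κ θ ξ, s <+: t ∧ (t.map bit).getD j false = true}

/-- The items generating the `ξ`-th ideal. -/
def JSet (ξ : Ordinal.{0}) : Set (Item Ordinal.{0}) :=
  {τ | IBd θ τ ∧ ((τ.1 ≠ 0 ∧ τ.2.1 < ξ) ∨ (τ.1 = 0 ∧ τ.2.1 = ξ ∧ ¬ Bad R a κ θ τ))}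

/-- The `ξ`-th ideal. -/
def Idl (ξ : Ordinal.{0}) : Set (Set ℕ) :=
  {X | ∃ (m : ℕ) (L : List (Item Ordinal.{0})), (∀ τ ∈ L, τ ∈ JSet R a κ θ ξ) ∧
    ∀ j ∈ X, m ≤ j → ∃ τ ∈ L, j ∈ GSet R a κ θ τ}

variable {R a κ θ} {ξ : Ordinal.{0}}

theorem Idl_mono {X Y : Set ℕ} (hX : X ∈ Idl R a κ θ ξ) (h : Y ⊆ X) : Y ∈ Idl R a κ θ ξ := by
  obtain ⟨m, L, h1, h2⟩ := hX
  exact ⟨m, L, h1, fun j hj => h2 j (h hj)⟩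

theorem Idl_union {X Y : Set ℕ} (hX : X ∈ Idl R a κ θ ξ) (hY : Y ∈ Idl R a κ θ ξ) :
    X ∪ Y ∈ Idl R a κ θ ξ := by
  obtain ⟨m, L, h1, h2⟩ := hX
  obtain ⟨m', L', h1', h2'⟩ := hY
  refine ⟨max m m', L ++ L', ?_, ?_⟩
  · intro τ hτ
    rcases List.mem_append.1 hτ with h | h
    exacts [h1 τ h, h1' τ h]
  · rintro j (hj | hj) hm
    · obtain ⟨τ, hτ, h⟩ := h2 j hj ((le_max_left _ _).trans hm)
      exact ⟨τ, List.mem_append_left _ hτ, h⟩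
    · obtain ⟨τ, hτ, h⟩ := h2' j hj ((le_max_right _ _).trans hm)
      exact ⟨τ, List.mem_append_right _ hτ, h⟩

theorem Idl_finite {X : Set ℕ} (hX : X.Finite) : X ∈ Idl R a κ θ ξ := by
  obtain ⟨m, hm⟩ := hX.bddAbove
  exact ⟨m + 1, [], by simp, fun j hj hmj => absurd (hm hj) (by omega)⟩

theorem GSet_mem_Idl {τ : Item Ordinal.{0}} (hτ : τ ∈ JSet R a κ θ ξ) :
    GSet R a κ θ τ ∈ Idl R a κ θ ξ :=
  ⟨0, [τ], by simpa using hτ, fun j hj _ => ⟨τ, by simp, hj⟩⟩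

theorem HSet_anti {s t : Node Ordinal.{0}} (h : s <+: t) : HSet R a κ θ ξ t ⊆ HSet R a κ θ ξ s := by
  rintro j ⟨u, hu, htu, hj⟩
  exact ⟨u, hu, h.trans htu, hj⟩

theorem GSet_flag {τ : Item Ordinal.{0}} (h : τ.1 ≠ 0) :
    GSet R a κ θ τ = HSet R a κ θ τ.2.1 τ.2.2.2 := by
  ext j
  constructor
  · rintro ⟨s, h1, h2, h3, h4⟩
    exact ⟨s, ⟨h3, fun γ hγ => h4 γ hγ (bef_iff.2 (Or.inl h))⟩, h1, h2⟩
  · rintro ⟨s, ⟨h3, h4⟩, h1, h2⟩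
    exact ⟨s, h1, h2, h3, fun γ hγ _ => h4 γ hγ⟩

theorem HSet_subset_GSet {γ : Ordinal.{0}} {s : Node Ordinal.{0}} {n : ℕ} :
    HSet R a κ θ ξ s ⊆ GSet R a κ θ (n, ξ, γ, s) := by
  rintro j ⟨s, ⟨h3, h4⟩, h1, h2⟩
  exact ⟨s, h1, h2, h3, fun γ hγ _ => h4 γ hγ⟩

/-- The order `PLt` as a relation on pairs. -/
def PRel (p q : Ordinal.{0} × Node Ordinal.{0}) : Prop := PLt p.1 p.2 q.1 q.2

theorem PRel_wf : WellFounded PRel := by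
  refine Subrelation.wf (r := Prod.Lex (fun x y : Ordinal.{0} => x < y) nlt) ?_
    (wellFounded_lt.prod_lex nlt_wf)
  intro p q h
  rw [Prod.lex_def]
  exact h

theorem PRel_trichotomous {p q : Ordinal.{0} × Node Ordinal.{0}} (h1 : ¬ PRel p q)
    (h2 : ¬ PRel q p) : p = q := by
  unfold PRel PLt at h1 h2
  push Not at h1 h2
  have h : p.1 = q.1 := le_antisymm h2.1 h1.1
  exact Prod.ext h (nlt_trichotomous (h1.2 h) (h2.2 h.symm))

theorem exists_PRel_max {L : List (Item Ordinal.{0})} (hL : ∃ τ ∈ L, τ.1 = 0) :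
    ∃ σ ∈ L, σ.1 = 0 ∧ ∀ τ ∈ L, τ.1 = 0 → PRel τ.2.2 σ.2.2 ∨ τ.2.2 = σ.2.2 := by
  have : IsWellFounded _ PRel := ⟨PRel_wf⟩
  obtain ⟨σ, ⟨hσ, h0⟩, hm⟩ := Set.exists_max_image {τ | τ ∈ L ∧ τ.1 = 0}
    (fun τ => IsWellFounded.rank PRel τ.2.2)
    ((List.finite_toSet L).subset fun τ hτ => hτ.1) hL
  refine ⟨σ, hσ, h0, fun τ hτ hτ0 => ?_⟩
  by_contra hn
  rw [not_or] at hn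
  apply hn.2
  refine PRel_trichotomous hn.1 fun h => ?_
  exact absurd (hm τ ⟨hτ, hτ0⟩) (not_le.2 (IsWellFounded.rank_lt_of_rel h))

variable {𝒜 : Set (Set ℕ)}

theorem not_cofinite_cover (hinf : 𝒜.Infinite) (hmem : ∀ y ∈ 𝒜, y.Infinite)
    (had : AlmostDisjointFam 𝒜) {F : Set (Set ℕ)} (hF : F.Finite) (hF𝒜 : F ⊆ 𝒜) (m : ℕ) :
    ¬ ∀ j ≥ m, ∃ B ∈ F, j ∈ B := by
  intro h
  obtain ⟨A, hA, hAF⟩ := hinf.exists_notMem_finite hF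
  apply hmem A hA
  refine ((Set.finite_lt_nat m).union (hF.biUnion (t := fun B => A ∩ B) fun B hB =>
    (had A hA B (hF𝒜 hB)).resolve_left ?_)).subset ?_
  · rintro rfl
    exact hAF hB
  · intro j hj
    by_cases hm : j < m
    · exact Or.inl hm
    · obtain ⟨B, hB, hjB⟩ := h j (not_lt.1 hm)
      exact Or.inr (Set.mem_biUnion hB ⟨hj, hjB⟩)

theorem univ_notMem_Idl (hκ : κ < θ) (hinf : 𝒜.Infinite) (hmem : ∀ y ∈ 𝒜, y.Infinite)
    (had : AlmostDisjointFam 𝒜) (hprev : ∀ η < ξ, HSet R a κ θ η [] ∈ 𝒜) :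
    Set.univ ∉ Idl R a κ θ ξ := by
  rintro ⟨m, L, hL, hm⟩
  by_cases h : ∃ τ ∈ L, τ.1 = 0
  · obtain ⟨σ, hσ, h0, hmax⟩ := exists_PRel_max h
    obtain ⟨hσb, h1 | ⟨-, hσξ, hσB⟩⟩ := hL σ hσ
    · exact h1.1 h0
    apply hσB
    have key : ∀ τ ∈ L, τ = σ ∨ adm oLt κ τ σ = true := by
      intro τ hτ
      rcases (hL τ hτ).2 with h1 | ⟨h1, h2, -⟩
      · exact Or.inr (adm_iff.2 (Or.inl (hσξ ▸ h1)))
      · rcases hmax τ hτ h1 with h3 | h3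
        · exact Or.inr (adm_iff.2 (Or.inr ⟨h1, h2.trans hσξ.symm, h3⟩))
        · exact Or.inl (Prod.ext (h1.trans h0.symm) (Prod.ext (h2.trans hσξ.symm) h3))
    rw [Bad_iff hκ hσb]
    refine ⟨m, L, fun τ hτ => (hL τ hτ).1, fun τ hτ h1 _ => ?_, fun j hj => ?_⟩
    · rcases (hL τ hτ).2 with h2 | h2
      · exact absurd h1 h2.1
      · exact h2.2.2
    · obtain ⟨τ, hτ, hjτ⟩ := hm j trivial hj
      rcases key τ hτ with rfl | h1
      · exact Or.inl hjτ
      · exact Or.inr ⟨τ, hτ, h1, hjτ⟩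
  · push Not at h
    have hlt : ∀ τ ∈ L, τ.2.1 < ξ := by
      intro τ hτ
      rcases (hL τ hτ).2 with h1 | h1
      · exact h1.2
      · exact absurd h1.1 (h τ hτ)
    refine not_cofinite_cover hinf hmem had (F := (fun τ : Item Ordinal.{0} =>
      HSet R a κ θ τ.2.1 []) '' {τ | τ ∈ L}) ((List.finite_toSet L).image _) ?_ m ?_
    · rintro _ ⟨τ, hτ, rfl⟩
      exact hprev _ (hlt τ hτ)
    · intro j hj
      obtain ⟨τ, hτ, hjτ⟩ := hm j trivial hj
      rw [GSet_flag (h τ hτ)] at hjτ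
      exact ⟨_, ⟨τ, hτ, rfl⟩, HSet_anti ⟨_, rfl⟩ hjτ⟩

section
variable (hκ : κ < θ) (hU : Set.univ ∉ Idl R a κ θ ξ) (hξ : ξ < θ)
  (hcof : ∀ F : Node Ordinal.{0} → Ordinal.{0}, (∀ s, F s < θ) →
    ∃ γ < θ, ∀ s, (∀ e ∈ s, e.2 < κ) → F s < γ)

include hκ hcof in
theorem exists_stable_pass : ∃ γ < θ, ∀ s, STree R a κ s → s ∉ Ker R a κ θ ξ →
    ∃ δ < γ, ¬ Bad R a κ θ (0, ξ, δ, s) := by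
  classical
  obtain ⟨γ, hγ, h⟩ := hcof (fun s => if h : ∃ δ < θ, ¬ Bad R a κ θ (0, ξ, δ, s) then h.choose
    else 0) (by
      intro s
      split_ifs with h
      · exact h.choose_spec.1
      · exact (zero_le (a := κ)).trans_lt hκ)
  refine ⟨γ, hγ, fun s hs hK => ?_⟩
  have hex : ∃ δ < θ, ¬ Bad R a κ θ (0, ξ, δ, s) := by
    by_contra! hn
    exact hK ⟨hs, hn⟩
  have h1 := h s (tree_iff.1 hs).1
  simp only [dif_pos hex] at h1
  exact ⟨_, h1, hex.choose_spec.2⟩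

include hκ hξ hcof in
theorem compl_HSet_mem_Idl {s : Node Ordinal.{0}} (hs : s ∈ Ker R a κ θ ξ) :
    (HSet R a κ θ ξ s)ᶜ ∈ Idl R a κ θ ξ := by
  obtain ⟨γ, hγ, hst⟩ := exists_stable_pass (R := R) (a := a) (ξ := ξ) hκ hcof
  have hb : IBd θ (0, ξ, γ, s) := ⟨hξ, hγ, fun e he => ((tree_iff.1 hs.1).1 e he).trans hκ⟩
  obtain ⟨m, T, h1, h2, h3⟩ := (Bad_iff hκ hb).1 (hs.2 γ hγ)
  have hG : GSet R a κ θ (0, ξ, γ, s) ⊆ HSet R a κ θ ξ s := by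
    rintro j ⟨t, ht1, ht2, ht3, ht4⟩
    refine ⟨t, ?_, ht1, ht2⟩
    by_contra hK
    obtain ⟨δ, hδ, hB⟩ := hst t ht3 hK
    exact hB (ht4 δ (hδ.trans hγ) (bef_iff.2 (Or.inr (Or.inl hδ))))
  classical
  refine ⟨m, T.filter fun τ => adm oLt κ τ (0, ξ, γ, s), ?_, ?_⟩
  · intro τ hτ
    rw [List.mem_filter] at hτ
    refine ⟨h1 τ hτ.1, ?_⟩
    rcases adm_iff.1 hτ.2 with h | h
    · exact Or.inl h
    · exact Or.inr ⟨h.1, h.2.1, h2 τ hτ.1 h.1 hτ.2⟩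
  · intro j hj hm
    rcases h3 j hm with h | ⟨τ, hτ, h4, h5⟩
    · exact absurd (hG h) hj
    · exact ⟨τ, List.mem_filter.2 ⟨hτ, h4⟩, h5⟩

include hκ hU hξ hcof in
theorem HSet_inter_notMem_Idl {s t : Node Ordinal.{0}} (hs : s ∈ Ker R a κ θ ξ)
    (ht : t ∈ Ker R a κ θ ξ) : HSet R a κ θ ξ s ∩ HSet R a κ θ ξ t ∉ Idl R a κ θ ξ := by
  intro h
  apply hU
  refine Idl_mono (Idl_union h (Idl_union (compl_HSet_mem_Idl hκ hξ hcof hs)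
    (compl_HSet_mem_Idl hκ hξ hcof ht))) fun j _ => ?_
  by_cases h1 : j ∈ HSet R a κ θ ξ s
  · by_cases h2 : j ∈ HSet R a κ θ ξ t
    · exact Or.inl ⟨h1, h2⟩
    · exact Or.inr (Or.inr h2)
  · exact Or.inr (Or.inl h1)

include hκ hU hξ hcof in
theorem Ker_of_isPrefix {s t : Node Ordinal.{0}} (hs : s ∈ Ker R a κ θ ξ) (h : t <+: s) :
    t ∈ Ker R a κ θ ξ := by
  have hT := hs.1.of_isPrefix h
  refine ⟨hT, fun γ hγ => ?_⟩
  by_contra hB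
  have hJ : ((0, ξ, γ, t) : Item Ordinal.{0}) ∈ JSet R a κ θ ξ :=
    ⟨⟨hξ, hγ, fun e he => ((tree_iff.1 hT).1 e he).trans hκ⟩, Or.inr ⟨rfl, rfl, hB⟩⟩
  refine HSet_inter_notMem_Idl hκ hU hξ hcof hs hs (Idl_mono (GSet_mem_Idl hJ) ?_)
  exact Set.inter_subset_left.trans ((HSet_anti h).trans HSet_subset_GSet)

end

end

theorem pre_isPrefix_pre {β : Type*} (x : ℕ → β) {m n : ℕ} (h : m ≤ n) : pre x m <+: pre x n := by
  rw [List.prefix_iff_eq_take, length_pre, take_pre x h]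

theorem getD_map_bit_pre {α : Type*} (f : ℕ → ℕ × α) {i n : ℕ} (h : i < n) :
    ((pre f n).map bit).getD i false = bit (f i) := by
  rw [map_pre, pre_getD _ _ h]

theorem lt_length_of_getD {l : List Bool} {j : ℕ} (h : l.getD j false = true) : j < l.length := by
  by_contra hn
  rw [List.getD_eq_default _ _ (not_lt.1 hn)] at h
  exact Bool.false_ne_true h

theorem exists_limit {β : Type*} [Inhabited β] {s : ℕ → List β} (h : ∀ n, s n <+: s (n + 1))
    (hlen : ∀ n, n ≤ (s n).length) : ∃ f : ℕ → β, ∀ n, pre f (s n).length = s n := by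
  have hmono : ∀ m n, m ≤ n → s m <+: s n := by
    intro m n hmn
    induction hmn with
    | refl => exact List.prefix_rfl
    | step _ ih => exact ih.trans (h _)
  refine ⟨fun i => (s (i + 1)).getD i default, fun n => ?_⟩
  apply List.ext_getElem (by simp)
  intro i h1 h2
  have h3 : i < (s (i + 1)).length := hlen (i + 1)
  simp only [pre, List.getElem_map, List.getElem_range]
  rw [List.getD_eq_getElem _ _ h3]
  rcases le_total n (i + 1) with hn | hn
  · exact ((hmono _ _ hn).getElem h2).symm
  · exact (hmono _ _ hn).getElem h3

section
variable {R : List Bool × List ℕ × List ℕ × List ℕ → Bool} {a : ℕ → ℕ} {κ θ ξ : Ordinal.{0}}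
  {𝒜 : Set (Set ℕ)}
  (hκ : κ < θ) (hU : Set.univ ∉ Idl R a κ θ ξ) (hξ : ξ < θ)
  (hcof : ∀ F : Node Ordinal.{0} → Ordinal.{0}, (∀ s, F s < θ) →
    ∃ γ < θ, ∀ s, (∀ e ∈ s, e.2 < κ) → F s < γ)
  (h𝒜 : ∀ A, A ∈ 𝒜 ↔ ∃ f : ℕ → ℕ × Ordinal.{0}, (∀ n, STree R a κ (pre f n)) ∧
    A = {i | bit (f i) = true})

include hκ hU hξ hcof in
theorem exists_two_branches {s t : Node Ordinal.{0}} (hs : s ∈ Ker R a κ θ ξ)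
    (ht : t ∈ Ker R a κ θ ξ) : ∃ f g : ℕ → ℕ × Ordinal.{0},
      (∀ n, pre f n ∈ Ker R a κ θ ξ) ∧ (∀ n, pre g n ∈ Ker R a κ θ ξ) ∧
      pre f s.length = s ∧ pre g t.length = t ∧
      {i | bit (f i) = true ∧ bit (g i) = true}.Infinite := by
  let W := {p : Node Ordinal.{0} × Node Ordinal.{0} // p.1 ∈ Ker R a κ θ ξ ∧ p.2 ∈ Ker R a κ θ ξ}
  have step : ∀ (n : ℕ) (p : W), ∃ q : W, p.1.1 <+: q.1.1 ∧ p.1.2 <+: q.1.2 ∧ ∃ j ≥ n,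
      (q.1.1.map bit).getD j false = true ∧ (q.1.2.map bit).getD j false = true := by
    rintro n ⟨⟨u, v⟩, hu, hv⟩
    have hinf : (HSet R a κ θ ξ u ∩ HSet R a κ θ ξ v).Infinite := fun hfin =>
      HSet_inter_notMem_Idl hκ hU hξ hcof hu hv (Idl_finite hfin)
    obtain ⟨j, ⟨⟨u', hu', h1, h2⟩, ⟨v', hv', h3, h4⟩⟩, hj⟩ := hinf.exists_gt n
    exact ⟨⟨(u', v'), hu', hv'⟩, h1, h3, j, hj.le, h2, h4⟩
  choose nxt hn1 hn2 j hj hj1 hj2 using step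
  let p : ℕ → W := fun n => Nat.rec ⟨(s, t), hs, ht⟩ (fun n q => nxt n q) n
  have hlen : ∀ n, n ≤ (p n).1.1.length ∧ n ≤ (p n).1.2.length := by
    intro n
    induction n with
    | zero => simp
    | succ n _ =>
      have h1 := lt_length_of_getD (hj1 n (p n))
      have h2 := lt_length_of_getD (hj2 n (p n))
      have h3 := hj n (p n)
      rw [List.length_map] at h1 h2
      exact ⟨h3.trans_lt h1, h3.trans_lt h2⟩
  obtain ⟨f, hf⟩ := exists_limit (s := fun n => (p n).1.1) (fun n => hn1 n (p n))
    fun n => (hlen n).1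
  obtain ⟨g, hg⟩ := exists_limit (s := fun n => (p n).1.2) (fun n => hn2 n (p n))
    fun n => (hlen n).2
  refine ⟨f, g, fun n => ?_, fun n => ?_, hf 0, hg 0, ?_⟩
  · refine Ker_of_isPrefix hκ hU hξ hcof (p n).2.1 ?_
    rw [← hf n]
    exact pre_isPrefix_pre f (hlen n).1
  · refine Ker_of_isPrefix hκ hU hξ hcof (p n).2.2 ?_
    rw [← hg n]
    exact pre_isPrefix_pre g (hlen n).2
  · refine Set.infinite_of_not_bddAbove fun ⟨b, hb⟩ => ?_
    have h1 := hj1 (b + 1) (p (b + 1))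
    have h2 := hj2 (b + 1) (p (b + 1))
    have l1 := lt_length_of_getD h1
    have l2 := lt_length_of_getD h2
    rw [List.length_map] at l1 l2
    have e1 := hf (b + 2)
    have e2 := hg (b + 2)
    have h1' : bit (f (j (b + 1) (p (b + 1)))) = true := by
      rw [← getD_map_bit_pre f l1]
      change ((pre f (p (b + 2)).1.1.length).map bit).getD _ false = true
      rw [e1]
      exact h1
    have h2' : bit (g (j (b + 1) (p (b + 1)))) = true := by
      rw [← getD_map_bit_pre g l2]
      change ((pre g (p (b + 2)).1.2.length).map bit).getD _ false = true
      rw [e2]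
      exact h2
    have := hb ⟨h1', h2'⟩
    have := hj (b + 1) (p (b + 1))
    omega

include hκ hU hξ hcof h𝒜 in
theorem bits_compatible (had : AlmostDisjointFam 𝒜) {s t : Node Ordinal.{0}}
    (hs : s ∈ Ker R a κ θ ξ) (ht : t ∈ Ker R a κ θ ξ) {i : ℕ} (h1 : i < s.length)
    (h2 : i < t.length) : (s.map bit).getD i false = (t.map bit).getD i false := by
  obtain ⟨f, g, hf, hg, hfs, hgt, hinf⟩ := exists_two_branches hκ hU hξ hcof hs ht
  rcases had _ ((h𝒜 _).2 ⟨f, fun n => (hf n).1, rfl⟩) _ ((h𝒜 _).2 ⟨g, fun n => (hg n).1, rfl⟩)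
    with h | h
  · rw [← hfs, ← hgt, getD_map_bit_pre f h1, getD_map_bit_pre g h2, Bool.eq_iff_iff]
    exact Set.ext_iff.1 h i
  · exact absurd h hinf

include hκ hU hξ hcof h𝒜 in
theorem HSet_nil_mem (had : AlmostDisjointFam 𝒜) (hne : (Ker R a κ θ ξ).Nonempty) :
    HSet R a κ θ ξ [] ∈ 𝒜 := by
  obtain ⟨s, hs⟩ := hne
  obtain ⟨f, -, hf, -, -, -, -⟩ := exists_two_branches hκ hU hξ hcof hs hs
  refine (h𝒜 _).2 ⟨f, fun n => (hf n).1, ?_⟩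
  ext i
  constructor
  · rintro ⟨t, ht, -, hi⟩
    have hl := lt_length_of_getD hi
    rw [List.length_map] at hl
    rw [bits_compatible hκ hU hξ hcof h𝒜 had ht (hf (i + 1)) hl (by simp),
      getD_map_bit_pre f (Nat.lt_succ_self i)] at hi
    exact hi
  · intro hi
    exact ⟨_, hf (i + 1), ⟨_, rfl⟩, (getD_map_bit_pre f (Nat.lt_succ_self i)).trans hi⟩

include hκ hU hξ hcof in
theorem HSet_nil_notMem_Idl (hne : (Ker R a κ θ ξ).Nonempty) :
    HSet R a κ θ ξ [] ∉ Idl R a κ θ ξ := by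
  obtain ⟨s, hs⟩ := hne
  have h := Ker_of_isPrefix hκ hU hξ hcof hs (t := []) ⟨s, rfl⟩
  have := HSet_inter_notMem_Idl hκ hU hξ hcof h h
  rwa [Set.inter_self] at this

omit hU in
include hκ hcof h𝒜 in
/-- Some derivative with all earlier kernels inducing members of the family has empty kernel. -/
theorem exists_Ker_empty (hinf : 𝒜.Infinite) (hmem : ∀ y ∈ 𝒜, y.Infinite)
    (had : AlmostDisjointFam 𝒜)
    (hinj : ∀ F : Ordinal.{0} → Set ℕ, ∃ η ξ, η < ξ ∧ ξ < θ ∧ F η = F ξ) :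
    ∃ ξ < θ, Ker R a κ θ ξ = ∅ ∧ ∀ η < ξ, HSet R a κ θ η [] ∈ 𝒜 := by
  by_contra! hn
  have hne : ∀ ξ < θ, (∀ η < ξ, HSet R a κ θ η [] ∈ 𝒜) → (Ker R a κ θ ξ).Nonempty := by
    intro ξ hξ h
    by_contra he
    obtain ⟨η, hη, h'⟩ := hn ξ hξ (Set.not_nonempty_iff_eq_empty.1 he)
    exact h' (h η hη)
  have hall : ∀ ξ < θ, HSet R a κ θ ξ [] ∈ 𝒜 := by
    intro ξ
    induction ξ using WellFoundedLT.induction with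
    | _ ξ ih =>
    intro hξ
    have hp : ∀ η < ξ, HSet R a κ θ η [] ∈ 𝒜 := fun η hη => ih η hη (hη.trans hξ)
    exact HSet_nil_mem hκ (univ_notMem_Idl hκ hinf hmem had hp) hξ hcof h𝒜 had (hne ξ hξ hp)
  obtain ⟨η, ξ, hηξ, hξ, he⟩ := hinj fun ξ => HSet R a κ θ ξ []
  have hp : ∀ η < ξ, HSet R a κ θ η [] ∈ 𝒜 := fun η hη => hall η (hη.trans hξ)
  refine HSet_nil_notMem_Idl hκ (univ_notMem_Idl hκ hinf hmem had hp) hξ hcof (hne ξ hξ hp) ?_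
  have hJ : ((1, η, κ, []) : Item Ordinal.{0}) ∈ JSet R a κ θ ξ :=
    ⟨⟨hηξ.trans hξ, hκ, by simp⟩, Or.inl ⟨one_ne_zero, hηξ⟩⟩
  have := GSet_mem_Idl hJ
  rw [GSet_flag one_ne_zero] at this
  rw [← he]
  exact this

omit hU hcof in
include h𝒜 hξ hκ in
theorem subset_GSet_of_Ker_empty (hK : Ker R a κ θ ξ = ∅) {A : Set ℕ} (hA : A ∈ 𝒜) :
    ∃ τ ∈ JSet R a κ θ ξ, A ⊆ GSet R a κ θ τ := by
  obtain ⟨f, hf, rfl⟩ := (h𝒜 A).1 hA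
  have hne : {p : Ordinal.{0} × Node Ordinal.{0} | p.1 < θ ∧ (∃ n, p.2 = pre f n) ∧
      ¬ Bad R a κ θ (0, ξ, p.1, p.2)}.Nonempty := by
    have : pre f 0 ∉ Ker R a κ θ ξ := by rw [hK]; simp
    have h2 : ∃ γ < θ, ¬ Bad R a κ θ (0, ξ, γ, pre f 0) := by
      by_contra! hn
      exact this ⟨hf 0, hn⟩
    obtain ⟨γ, hγ, hB⟩ := h2
    exact ⟨(γ, pre f 0), hγ, ⟨0, rfl⟩, hB⟩
  obtain ⟨⟨γ, s⟩, ⟨hγ, ⟨n, hs⟩, hB⟩, hmin⟩ := PRel_wf.has_min _ hne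
  dsimp only at hγ hs hB
  subst hs
  refine ⟨(0, ξ, γ, pre f n), ⟨⟨hξ, hγ, fun e he => ((tree_iff.1 (hf n)).1 e he).trans hκ⟩,
    Or.inr ⟨rfl, rfl, hB⟩⟩, fun j hj => ?_⟩
  refine ⟨pre f (max n (j + 1)), pre_isPrefix_pre f (le_max_left _ _), ?_, hf _, fun δ hδ hbef => ?_⟩
  · exact (getD_map_bit_pre f (le_max_right n (j + 1))).trans hj
  · by_contra hB'
    refine hmin (δ, pre f (max n (j + 1))) ⟨hδ, ⟨_, rfl⟩, hB'⟩ ?_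
    rcases bef_iff.1 hbef with h | h
    · exact absurd rfl h
    · exact h

end

/-- A countable family of sets no finite subfamily of which covers a cofinite set has an
infinite set almost disjoint from all its members. -/
theorem exists_infinite_almost_disjoint {E : ℕ → Set ℕ}
    (h : ∀ n m, ∃ j ≥ m, ∀ i < n, j ∉ E i) :
    ∃ x : Set ℕ, x.Infinite ∧ ∀ i, (x ∩ E i).Finite := by
  choose p hp hp' using fun n => h n n
  refine ⟨Set.range p, Set.infinite_of_not_bddAbove ?_, ?_⟩
  · rintro ⟨b, hb⟩
    have := hb ⟨b + 1, rfl⟩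
    have := hp (b + 1)
    omega
  · intro i
    refine ((Set.finite_le_nat i).image p).subset ?_
    rintro _ ⟨⟨n, rfl⟩, hn⟩
    refine ⟨n, ?_, rfl⟩
    by_contra hni
    exact hp' n i (not_le.1 hni) hn

theorem lt_ord_succ_continuum : Ordinal.omega.{0} 1 < (Order.succ Cardinal.continuum.{0}).ord := by
  rw [← Cardinal.ord_aleph, Cardinal.ord_lt_ord]
  exact Cardinal.aleph_one_le_continuum.trans_lt (Order.lt_succ _)

theorem mk_node_le : Cardinal.mk (List (ℕ × (Ordinal.omega.{0} 1).ToType)) ≤ Cardinal.continuum := by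
  have h : Cardinal.mk (ℕ × (Ordinal.omega.{0} 1).ToType) ≤ Cardinal.continuum := by
    rw [Cardinal.mk_prod, Cardinal.mk_toType, Ordinal.card_omega]
    simp only [Cardinal.lift_id, Cardinal.mk_nat]
    exact Cardinal.mul_le_of_le Cardinal.aleph0_le_continuum Cardinal.aleph0_le_continuum
      Cardinal.aleph_one_le_continuum
  exact (Cardinal.mk_list_le_max _).trans (max_le Cardinal.aleph0_le_continuum h)

theorem exists_bound_of_nodes (F : Node Ordinal.{0} → Ordinal.{0})
    (hF : ∀ s, F s < (Order.succ Cardinal.continuum.{0}).ord) :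
    ∃ γ < (Order.succ Cardinal.continuum.{0}).ord,
      ∀ s, (∀ e ∈ s, e.2 < Ordinal.omega 1) → F s < γ := by
  let f : List (ℕ × (Ordinal.omega.{0} 1).ToType) → Ordinal.{0} := fun l =>
    F (mapNode (fun x => (Ordinal.ToType.mk.symm x).1) l)
  refine ⟨⨆ l, f l + 1, Ordinal.iSup_add_one_lt_of_lt_cof ?_ fun l => hF _, fun s hs => ?_⟩
  · rw [(Cardinal.isRegular_succ Cardinal.aleph0_le_continuum).cof_ord]
    exact mk_node_le.trans_lt (Order.lt_succ _)
  · obtain ⟨l, rfl⟩ : ∃ l : List (ℕ × (Ordinal.omega.{0} 1).ToType),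
        mapNode (fun x => (Ordinal.ToType.mk.symm x).1) l = s := by
      refine ⟨s.pmap (fun e he => (e.1, Ordinal.ToType.mk ⟨e.2, he⟩)) hs, ?_⟩
      simp [mapNode, List.map_pmap]
    exact (Order.lt_add_one_iff.2 le_rfl).trans_le (Ordinal.le_iSup (fun l => f l + 1) l)

theorem exists_eq_of_lt_ord (F : Ordinal.{0} → Set ℕ) :
    ∃ η ξ, η < ξ ∧ ξ < (Order.succ Cardinal.continuum.{0}).ord ∧ F η = F ξ := by
  by_contra! hn
  let G : (Order.succ Cardinal.continuum.{0}).ord.ToType → Set ℕ := fun x =>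
    F (Ordinal.ToType.mk.symm x).1
  have hG : Function.Injective G := by
    intro x y hxy
    apply Ordinal.ToType.mk.symm.injective
    apply Subtype.ext
    rcases lt_trichotomy (Ordinal.ToType.mk.symm x).1 (Ordinal.ToType.mk.symm y).1 with h | h | h
    · exact absurd hxy (hn _ _ h (Ordinal.ToType.mk.symm y).2)
    · exact h
    · exact absurd hxy.symm (hn _ _ h (Ordinal.ToType.mk.symm x).2)
  have := Cardinal.mk_le_of_injective hG
  rw [Cardinal.mk_toType, Cardinal.card_ord, Cardinal.mk_set, Cardinal.mk_nat,
    Cardinal.two_power_aleph0] at this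
  exact absurd this (not_le.2 (Order.lt_succ _))

theorem exists_tree_of_sigma12 {a : ℕ → ℕ} {𝒜 : Set (Set ℕ)} (hS : Sigma12In a 𝒜) :
    ∃ R : List Bool × List ℕ × List ℕ × List ℕ → Bool, Primrec R ∧
      ∀ A, A ∈ 𝒜 ↔ ∃ f : ℕ → ℕ × Ordinal.{0},
        (∀ n, STree R a (Ordinal.omega 1) (pre f n)) ∧ A = {i | bit (f i) = true} := by
  obtain ⟨R, hR, rfl⟩ := hS
  obtain ⟨R', hR', hiff, hmono⟩ := exists_primrec_mono hR
  refine ⟨R', hR', fun A => ?_⟩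
  simp only [ofFn_eq_pre, Set.mem_ofPred_eq, hiff]
  constructor
  · rintro ⟨x, rfl, hx⟩
    obtain ⟨f, hf, hb⟩ := (exists_branch_iff (fun x y z a' m n => hmono x y z _ m n) x).1 hx
    exact ⟨f, hf, by simp only [hb]⟩
  · rintro ⟨f, hf, rfl⟩
    exact ⟨fun i => bit (f i), rfl, (exists_branch_iff (fun x y z a' m n => hmono x y z _ m n) _).2
      ⟨f, hf, fun _ => rfl⟩⟩

theorem exists_notMem_of_univ_notMem_Idl {R : List Bool × List ℕ × List ℕ × List ℕ → Bool}
    {a : ℕ → ℕ} {κ θ ξ : Ordinal.{0}} (hU : Set.univ ∉ Idl R a κ θ ξ) {E : ℕ → Set ℕ}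
    (hE : ∀ i, E i ∈ Idl R a κ θ ξ) (n m : ℕ) : ∃ j ≥ m, ∀ i < n, j ∉ E i := by
  by_contra! hn
  have hfin : ∀ n, (⋃ i < n, E i) ∈ Idl R a κ θ ξ := by
    intro n
    induction n with
    | zero => simpa using Idl_finite Set.finite_empty
    | succ n ih => rw [Set.biUnion_lt_succ]; exact Idl_union ih (hE n)
  refine hU (Idl_mono (Idl_union (hfin n) (Idl_finite (Set.finite_lt_nat m))) fun j _ => ?_)
  rcases lt_or_ge j m with h | h
  · exact Or.inr h
  · obtain ⟨i, hi, hj⟩ := hn j h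
    exact Or.inl (Set.mem_biUnion hi hj)

/-!
STATEMENT 17 (Theorem 1.3(1) / 3.5): if `ℵ₁^{L[a]} < ℵ₁` (expressed through its
classical Solovay–Mansfield equivalent, the perfect set property for `Π¹₁(a)` sets),
then there are no infinite `Σ¹₂(a)` maximal almost disjoint families: every `Σ¹₂(a)`
infinite almost disjoint family `𝒜` of infinite subsets of `ω` admits an infinite
`x ⊆ ω` with `x ∩ y` finite for every `y ∈ 𝒜`.
-/

theorem no_sigma12_in_a_mad_family (a : ℕ → ℕ)
    (hsmall : Aleph1OfLaCountable a)
    (𝒜 : Set (Set ℕ)) (hS : Sigma12In a 𝒜)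
    (hinf : 𝒜.Infinite) (hmem : ∀ y ∈ 𝒜, y.Infinite)
    (had : AlmostDisjointFam 𝒜) :
    ∃ x : Set ℕ, x.Infinite ∧ ∀ y ∈ 𝒜, (x ∩ y).Finite := by
  obtain ⟨R, hR, h𝒜⟩ := exists_tree_of_sigma12 hS
  have hκ := lt_ord_succ_continuum
  obtain ⟨ξ, hξ, hK, hprev⟩ := exists_Ker_empty hκ exists_bound_of_nodes h𝒜 hinf hmem had
    exists_eq_of_lt_ord
  have hU := univ_notMem_Idl hκ hinf hmem had hprev
  set θ := (Order.succ Cardinal.continuum.{0}).ord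
  have hcount : (GSet R a (Ordinal.omega 1) θ '' JSet R a (Ordinal.omega 1) θ ξ).Countable :=
    (countable_GSet hR hsmall hκ).mono (by rintro _ ⟨τ, hτ, rfl⟩; exact ⟨τ, hτ.1, rfl⟩)
  have hne : (GSet R a (Ordinal.omega 1) θ '' JSet R a (Ordinal.omega 1) θ ξ).Nonempty := by
    obtain ⟨A, hA⟩ := hinf.nonempty
    obtain ⟨τ, hτ, -⟩ := subset_GSet_of_Ker_empty hκ hξ h𝒜 hK hA
    exact ⟨_, τ, hτ, rfl⟩
  obtain ⟨E, hE⟩ := hcount.exists_eq_range hne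
  have hEI : ∀ i, E i ∈ Idl R a (Ordinal.omega 1) θ ξ := by
    intro i
    obtain ⟨τ, hτ, h⟩ : E i ∈ GSet R a (Ordinal.omega 1) θ '' JSet R a (Ordinal.omega 1) θ ξ :=
      hE ▸ ⟨i, rfl⟩
    exact h ▸ GSet_mem_Idl hτ
  obtain ⟨x, hx, hxE⟩ :=
    exists_infinite_almost_disjoint (exists_notMem_of_univ_notMem_Idl hU hEI)
  refine ⟨x, hx, fun A hA => ?_⟩
  obtain ⟨τ, hτ, hAτ⟩ := subset_GSet_of_Ker_empty hκ hξ h𝒜 hK hA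
  obtain ⟨i, hi⟩ : GSet R a (Ordinal.omega 1) θ τ ∈ Set.range E := hE ▸ ⟨τ, hτ, rfl⟩
  exact (hxE i).subset (Set.inter_subset_inter_right x (hi ▸ hAτ))
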